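/- Let U be a nonnegative solution of the extension problem on the punctured half-ball 𝔅_2^+, with trace u(x) = U(x,0). If lim_{|x| → 0} |x|^{(n−2σ)/2} u(x) = 0, then u can be extended as a continuous function near the origin: there exist τ > 0 and a continuous function v on B_τ such that v(x) = u(x) for all x ∈ B_τ \ {0}. -/

import Mathlib

open scoped Topology MeasureTheory RealInnerProductSpace
open Filter MeasureTheory

noncomputable section

/-- Points of `ℝ^{n+1}`, written `X = (x, t)` with `x ∈ ℝⁿ` and `t ∈ ℝ`. -/
abbrev Pt (n : ℕ) := EuclideanSpace ℝ (Fin n) × ℝ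

/-- The Euclidean norm on `ℝ^{n+1} = ℝⁿ × ℝ`. -/
def enorm' {n : ℕ} (X : Pt n) : ℝ := Real.sqrt (‖X.1‖ ^ 2 + X.2 ^ 2)

/-- Partial derivative in the last (`t`) direction. -/
def dt {n : ℕ} (U : Pt n → ℝ) (X : Pt n) : ℝ := fderiv ℝ U X (0, 1)

/-- Second derivative in the direction `v`. -/
def d2 {n : ℕ} (U : Pt n → ℝ) (X v : Pt n) : ℝ :=
  fderiv ℝ (fun Y => fderiv ℝ U Y v) X v

/-- The Laplacian on `ℝ^{n+1}`. -/
def lapl {n : ℕ} (U : Pt n → ℝ) (X : Pt n) : ℝ :=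
  (∑ i : Fin n, d2 U X (EuclideanSpace.single i (1 : ℝ), (0 : ℝ))) + d2 U X (0, 1)

/-- `U` is a nonnegative solution of the extension problem on the punctured half-ball
`𝔅_R^+`: it is nonnegative and continuous on `{|X| ≤ R, t ≥ 0} \ {0}`, `C²` on `𝔅_R^+`,
satisfies `ΔU + ((1-2σ)/t) ∂_t U = 0` there, and satisfies the nonlinear Neumann condition
`lim_{t→0⁺} t^{1-2σ} ∂_t U(x,t) = -u(x)^{(n+2σ)/(n-2σ)}` for `x ∈ B_R \ {0}`. -/
def ExtSol (n : ℕ) (σ R : ℝ) (U : Pt n → ℝ) : Prop :=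
  (∀ X : Pt n, enorm' X ≤ R → 0 ≤ X.2 → X ≠ 0 → 0 ≤ U X) ∧
  ContinuousOn U ({X : Pt n | enorm' X ≤ R ∧ 0 ≤ X.2} \ {0}) ∧
  ContDiffOn ℝ 2 U {X : Pt n | enorm' X < R ∧ 0 < X.2} ∧
  (∀ X : Pt n, enorm' X < R → 0 < X.2 →
    lapl U X + ((1 - 2 * σ) / X.2) * dt U X = 0) ∧
  (∀ x : EuclideanSpace ℝ (Fin n), ‖x‖ < R → x ≠ 0 →
    Tendsto (fun t : ℝ => t ^ (1 - 2 * σ) * dt U (x, t)) (𝓝[>] 0)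
      (𝓝 (-(U (x, 0) ^ (((n : ℝ) + 2 * σ) / ((n : ℝ) - 2 * σ))))))

/-! ### The operator `L = Δ + ((1-2σ)/t) ∂_t` and the conormal derivative -/

/-- `F` is `C²` at `X` and `(Δ + ((1-2σ)/t) ∂_t) F (X) = l`. -/
def HasL {n : ℕ} (σ : ℝ) (F : Pt n → ℝ) (X : Pt n) (l : ℝ) : Prop :=
  ContDiffAt ℝ 2 F X ∧ lapl F X + ((1 - 2 * σ) / X.2) * dt F X = l

/-- `F` is continuous up to `t = 0` along the vertical line over `x`, and its conormal derivative
`lim_{t → 0⁺} t^{1-2σ} ∂_t F (x,t)` exists and equals `l`. -/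
def HasN {n : ℕ} (σ : ℝ) (F : Pt n → ℝ) (x : EuclideanSpace ℝ (Fin n)) (l : ℝ) : Prop :=
  (∀ᶠ t in 𝓝[>] (0 : ℝ), DifferentiableAt ℝ F (x, t)) ∧
  ContinuousWithinAt (fun t : ℝ => F (x, t)) (Set.Ici 0) 0 ∧
  Tendsto (fun t : ℝ => t ^ (1 - 2 * σ) * dt F (x, t)) (𝓝[>] 0) (𝓝 l)

section Operators

variable {n : ℕ} {σ : ℝ} {F G : Pt n → ℝ} {X : Pt n} {x : EuclideanSpace ℝ (Fin n)} {k l c : ℝ}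

lemma fderiv_apply_differentiableAt (hF : ContDiffAt ℝ 2 F X) (v : Pt n) :
    DifferentiableAt ℝ (fun Y => fderiv ℝ F Y v) X := by
  have h : ContDiffAt ℝ 1 (fderiv ℝ F) X := hF.fderiv_right (by norm_num)
  exact (h.differentiableAt (by norm_num)).clm_apply (differentiableAt_const v)

lemma eventually_differentiableAt (hF : ContDiffAt ℝ 2 F X) :
    ∀ᶠ Y in 𝓝 X, DifferentiableAt ℝ F Y :=
  (hF.eventually (by simp)).mono fun _ hY => hY.differentiableAt (by norm_num)

lemma d2_add (hF : ContDiffAt ℝ 2 F X) (hG : ContDiffAt ℝ 2 G X) (v : Pt n) :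
    d2 (fun Y => F Y + G Y) X v = d2 F X v + d2 G X v := by
  have h : (fun Y => fderiv ℝ (fun Z => F Z + G Z) Y v) =ᶠ[𝓝 X]
      fun Y => fderiv ℝ F Y v + fderiv ℝ G Y v := by
    filter_upwards [eventually_differentiableAt hF, eventually_differentiableAt hG] with Y h1 h2
    rw [fderiv_fun_add h1 h2]; rfl
  unfold d2
  rw [h.fderiv_eq, fderiv_fun_add (fderiv_apply_differentiableAt hF v)
    (fderiv_apply_differentiableAt hG v)]
  rfl

lemma d2_const_mul (hF : ContDiffAt ℝ 2 F X) (c : ℝ) (v : Pt n) :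
    d2 (fun Y => c * F Y) X v = c * d2 F X v := by
  have h : (fun Y => fderiv ℝ (fun Z => c * F Z) Y v) =ᶠ[𝓝 X] fun Y => c * fderiv ℝ F Y v := by
    filter_upwards [eventually_differentiableAt hF] with Y h1
    rw [fderiv_const_mul h1]; rfl
  unfold d2
  rw [h.fderiv_eq, fderiv_const_mul (fderiv_apply_differentiableAt hF v)]
  rfl

lemma d2_smul (hF : ContDiffAt ℝ 2 F X) (c : ℝ) (v : Pt n) :
    d2 F X (c • v) = c ^ 2 * d2 F X v := by
  unfold d2
  simp only [map_smul, smul_eq_mul]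
  rw [fderiv_const_mul (fderiv_apply_differentiableAt hF v)]
  simp only [FunLike.coe_smul, Pi.smul_apply, smul_eq_mul]
  ring

lemma d2_comp_affine (A : Pt n →L[ℝ] Pt n) (a : Pt n) (hF : ContDiffAt ℝ 2 F (a + A X))
    (v : Pt n) : d2 (fun Y => F (a + A Y)) X v = d2 F (a + A X) (A v) := by
  have hc : ∀ Y : Pt n, HasFDerivAt (fun Y => a + A Y) A Y := fun Y =>
    A.hasFDerivAt.const_add a
  have hcont : Tendsto (fun Y : Pt n => a + A Y) (𝓝 X) (𝓝 (a + A X)) :=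
    (hc X).continuousAt
  have h : (fun Y => fderiv ℝ (fun Z => F (a + A Z)) Y v) =ᶠ[𝓝 X]
      fun Y => fderiv ℝ F (a + A Y) (A v) := by
    filter_upwards [hcont.eventually (eventually_differentiableAt hF)] with Y h1
    exact congrArg (fun T => T v) (h1.hasFDerivAt.comp Y (hc Y)).fderiv
  unfold d2
  rw [h.fderiv_eq]
  have := (fderiv_apply_differentiableAt hF (A v)).hasFDerivAt.comp X (hc X)
  exact congrArg (fun T => T v) this.fderiv

lemma dt_comp_affine (A : Pt n →L[ℝ] Pt n) (a : Pt n) (hF : DifferentiableAt ℝ F (a + A X)) :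
    dt (fun Y => F (a + A Y)) X = fderiv ℝ F (a + A X) (A (0, 1)) := by
  have hc : HasFDerivAt (fun Y => a + A Y) A X := A.hasFDerivAt.const_add a
  exact congrArg (fun T => T (0, 1)) (hF.hasFDerivAt.comp X hc).fderiv

lemma lapl_add (hF : ContDiffAt ℝ 2 F X) (hG : ContDiffAt ℝ 2 G X) :
    lapl (fun Y => F Y + G Y) X = lapl F X + lapl G X := by
  unfold lapl
  simp only [d2_add hF hG, Finset.sum_add_distrib]
  ring

lemma lapl_const_mul (hF : ContDiffAt ℝ 2 F X) (c : ℝ) :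
    lapl (fun Y => c * F Y) X = c * lapl F X := by
  unfold lapl
  simp only [d2_const_mul hF, ← Finset.mul_sum]
  ring

lemma dt_add (hF : DifferentiableAt ℝ F X) (hG : DifferentiableAt ℝ G X) :
    dt (fun Y => F Y + G Y) X = dt F X + dt G X := by
  unfold dt
  rw [fderiv_fun_add hF hG]; rfl

lemma dt_const_mul (hF : DifferentiableAt ℝ F X) (c : ℝ) :
    dt (fun Y => c * F Y) X = c * dt F X := by
  unfold dt
  rw [fderiv_const_mul hF]; rfl

lemma HasL.add (hF : HasL σ F X k) (hG : HasL σ G X l) :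
    HasL σ (fun Y => F Y + G Y) X (k + l) := by
  refine ⟨hF.1.add hG.1, ?_⟩
  rw [lapl_add hF.1 hG.1, dt_add (hF.1.differentiableAt (by norm_num))
    (hG.1.differentiableAt (by norm_num)), ← hF.2, ← hG.2]
  ring

lemma HasL.const_mul (hF : HasL σ F X k) (c : ℝ) : HasL σ (fun Y => c * F Y) X (c * k) := by
  refine ⟨contDiffAt_const.mul hF.1, ?_⟩
  rw [lapl_const_mul hF.1, dt_const_mul (hF.1.differentiableAt (by norm_num)), ← hF.2]
  ring

lemma HasL.sub (hF : HasL σ F X k) (hG : HasL σ G X l) :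
    HasL σ (fun Y => F Y - G Y) X (k - l) := by
  have h := hF.add (hG.const_mul (-1))
  simpa [sub_eq_add_neg] using h

lemma hasL_const (c : ℝ) : HasL σ (fun _ : Pt n => c) X 0 := by
  refine ⟨contDiffAt_const, ?_⟩
  simp [lapl, d2, dt]

lemma HasN.add (hF : HasN σ F x k) (hG : HasN σ G x l) :
    HasN σ (fun Y => F Y + G Y) x (k + l) := by
  refine ⟨(hF.1.and hG.1).mono fun t h => h.1.add h.2, hF.2.1.add hG.2.1, ?_⟩
  refine (hF.2.2.add hG.2.2).congr' ?_
  filter_upwards [hF.1, hG.1] with t h1 h2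
  rw [dt_add h1 h2]; ring

lemma HasN.const_mul (hF : HasN σ F x k) (c : ℝ) : HasN σ (fun Y => c * F Y) x (c * k) := by
  refine ⟨hF.1.mono fun t h => h.const_mul c, continuousWithinAt_const.mul hF.2.1, ?_⟩
  refine (hF.2.2.const_mul c).congr' ?_
  filter_upwards [hF.1] with t h1
  rw [dt_const_mul h1]; ring

lemma HasN.sub (hF : HasN σ F x k) (hG : HasN σ G x l) :
    HasN σ (fun Y => F Y - G Y) x (k - l) := by
  have h := hF.add (hG.const_mul (-1))
  simpa [sub_eq_add_neg] using h

lemma hasN_const (c : ℝ) : HasN σ (fun _ : Pt n => c) x 0 := by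
  refine ⟨by simp, continuousWithinAt_const, ?_⟩
  simp [dt]

/-! ### Derivatives along lines -/

lemma hasDerivAt_line (X v : Pt n) (s : ℝ) : HasDerivAt (fun s : ℝ => X + s • v) v s := by
  simpa using ((hasDerivAt_id s).smul_const v).const_add X

lemma fderiv_eq_of_line {φ : ℝ → ℝ} {v : Pt n} {φ' : ℝ} (hF : DifferentiableAt ℝ F X)
    (h : ∀ s, φ s = F (X + s • v)) (h1 : HasDerivAt φ φ' 0) : fderiv ℝ F X v = φ' := by
  have h0 : X + (0 : ℝ) • v = X := by simp
  have := HasFDerivAt.comp_hasDerivAt (0 : ℝ) (l := F) (f := fun s : ℝ => X + s • v)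
    (by rw [h0]; exact hF.hasFDerivAt) (hasDerivAt_line X v 0)
  have h2 : φ = F ∘ fun s : ℝ => X + s • v := funext h
  rw [h2] at h1
  exact this.unique h1

lemma line_hasDerivAt (hF : ContDiffAt ℝ 2 F X) (v : Pt n) :
    (∀ᶠ s in 𝓝 (0 : ℝ), HasDerivAt (fun s : ℝ => F (X + s • v))
      (fderiv ℝ F (X + s • v) v) s) ∧
    HasDerivAt (fun s : ℝ => fderiv ℝ F (X + s • v) v) (d2 F X v) 0 := by
  have h0 : X + (0 : ℝ) • v = X := by simp
  constructor
  · have hc : Tendsto (fun s : ℝ => X + s • v) (𝓝 0) (𝓝 X) := by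
      have := (hasDerivAt_line X v 0).continuousAt.tendsto
      rwa [h0] at this
    filter_upwards [hc.eventually (eventually_differentiableAt hF)] with s hs
    exact HasFDerivAt.comp_hasDerivAt s hs.hasFDerivAt (hasDerivAt_line X v s)
  · exact HasFDerivAt.comp_hasDerivAt (0 : ℝ) (l := fun Y => fderiv ℝ F Y v)
      (f := fun s : ℝ => X + s • v)
      (by rw [h0]; exact (fderiv_apply_differentiableAt hF v).hasFDerivAt)
      (hasDerivAt_line X v 0)

lemma d2_eq_of_line {φ φ1 : ℝ → ℝ} {v : Pt n} {φ2 : ℝ} (hF : ContDiffAt ℝ 2 F X)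
    (h : ∀ s, φ s = F (X + s • v)) (h1 : ∀ᶠ s in 𝓝 (0 : ℝ), HasDerivAt φ (φ1 s) s)
    (h2 : HasDerivAt φ1 φ2 0) : d2 F X v = φ2 := by
  obtain ⟨h3, h4⟩ := line_hasDerivAt hF v
  have hφ : φ = fun s : ℝ => F (X + s • v) := funext h
  rw [hφ] at h1
  refine h4.unique (h2.congr_of_eventuallyEq ?_)
  filter_upwards [h1, h3] with s a b using b.unique a

lemma d2_nonpos_of_isLocalMax (hF : ContDiffAt ℝ 2 F X) (hm : IsLocalMax F X) (v : Pt n) :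
    d2 F X v ≤ 0 := by
  by_contra! hpos
  obtain ⟨h3, h4⟩ := line_hasDerivAt hF v
  have h0 : X + (0 : ℝ) • v = X := by simp
  set φ : ℝ → ℝ := fun s => F (X + s • v) with hφ
  have hc : ContinuousAt (fun s : ℝ => X + s • v) 0 := (hasDerivAt_line X v 0).continuousAt
  have hmax : IsLocalMax φ 0 := by
    have h5 : Tendsto (fun s : ℝ => X + s • v) (𝓝 0) (𝓝 X) := by
      have := hc.tendsto; rwa [h0] at this
    have := h5.eventually hm
    filter_upwards [this] with s hs
    simpa [hφ] using hs
  have hd : deriv φ =ᶠ[𝓝 0] fun s : ℝ => fderiv ℝ F (X + s • v) v :=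
    h3.mono fun s hs => hs.deriv
  have hdd : deriv (deriv φ) 0 = d2 F X v := by rw [hd.deriv_eq, h4.deriv]
  have hmin := isLocalMin_of_deriv_deriv_pos (f := φ) (x₀ := 0) (by rw [hdd]; exact hpos)
    hmax.deriv_eq_zero h3.self_of_nhds.continuousAt
  have hconst : φ =ᶠ[𝓝 0] fun _ => φ 0 := by
    filter_upwards [hmax, hmin] with s a b using le_antisymm a b
  have h6 : deriv φ =ᶠ[𝓝 0] fun _ => 0 := by
    have := hconst.deriv
    simpa using this
  have : deriv (deriv φ) 0 = 0 := by rw [h6.deriv_eq]; simp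
  rw [hdd] at this
  exact hpos.ne' this

/-! ### Pointwise maximum principles -/

lemma HasL.nonpos_of_isLocalMax (hF : HasL σ F X k) (hm : IsLocalMax F X) : k ≤ 0 := by
  rw [← hF.2]
  have h1 : dt F X = 0 := by unfold dt; rw [hm.fderiv_eq_zero]; rfl
  rw [h1, mul_zero, add_zero]
  unfold lapl
  have h2 := d2_nonpos_of_isLocalMax hF.1 hm
  have := Finset.sum_nonpos (s := Finset.univ)
    (fun (i : Fin n) _ => h2 (EuclideanSpace.single i (1 : ℝ), (0 : ℝ)))
  have := h2 (0, 1)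
  linarith

lemma HasN.nonpos_of_max (hF : HasN σ F x k)
    (hm : ∀ᶠ t in 𝓝[>] (0 : ℝ), F (x, t) ≤ F (x, 0)) : k ≤ 0 := by
  by_contra! hk
  have h1 : ∀ᶠ t in 𝓝[>] (0 : ℝ), 0 < t ^ (1 - 2 * σ) * dt F (x, t) :=
    hF.2.2.eventually (lt_mem_nhds hk)
  have h2 := (hF.1.and (h1.and hm))
  rw [eventually_nhdsWithin_iff] at h2
  obtain ⟨ε, hε, h3⟩ := Metric.eventually_nhds_iff.1 h2
  have hin : ∀ t, 0 < t → t < ε → DifferentiableAt ℝ F (x, t) ∧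
      0 < t ^ (1 - 2 * σ) * dt F (x, t) ∧ F (x, t) ≤ F (x, 0) := fun t h0 ht =>
    h3 (by rw [Real.dist_eq, sub_zero, abs_of_pos h0]; exact ht) h0
  have hder : ∀ t, 0 < t → t < ε → HasDerivAt (fun t : ℝ => F (x, t)) (dt F (x, t)) t := by
    intro t h0 ht
    have hl : HasDerivAt (fun t : ℝ => ((x, t) : Pt n)) (0, 1) t :=
      (hasDerivAt_const t x).prodMk (hasDerivAt_id t)
    exact HasFDerivAt.comp_hasDerivAt t (hin t h0 ht).1.hasFDerivAt hl
  have hmono : StrictMonoOn (fun t : ℝ => F (x, t)) (Set.Icc 0 (ε / 2)) := by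
    refine strictMonoOn_of_deriv_pos (convex_Icc _ _) ?_ ?_
    · intro t ht
      rcases eq_or_lt_of_le ht.1 with h0 | h0
      · subst h0
        exact hF.2.1.mono Set.Icc_subset_Ici_self
      · exact (hder t h0 (by linarith [ht.2])).continuousAt.continuousWithinAt
    · intro t ht
      rw [interior_Icc] at ht
      have ht2 : t < ε := by linarith [ht.2]
      rw [(hder t ht.1 ht2).deriv]
      exact (pos_iff_pos_of_mul_pos (hin t ht.1 ht2).2.1).1 (Real.rpow_pos_of_pos ht.1 _)
  have := hmono (Set.left_mem_Icc.2 (by linarith)) (Set.right_mem_Icc.2 (by linarith))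
    (show (0 : ℝ) < ε / 2 by linarith)
  have h4 := (hin (ε / 2) (by linarith) (by linarith)).2.2
  simp only at this
  linarith

/-! ### Scaling and reflection -/

/-- The affine map `(x, t) ↦ (z + r x, r t)`. -/
def scaleMap (z : EuclideanSpace ℝ (Fin n)) (r : ℝ) (X : Pt n) : Pt n := (z + r • X.1, r * X.2)

lemma scaleMap_eq (z : EuclideanSpace ℝ (Fin n)) (r : ℝ) (X : Pt n) :
    scaleMap z r X = ((z, 0) : Pt n) + (r • ContinuousLinearMap.id ℝ (Pt n)) X := by
  ext <;> simp [scaleMap]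

lemma HasL.comp_scaleMap {z : EuclideanSpace ℝ (Fin n)} {r : ℝ} (hr : 0 < r)
    (hF : HasL σ F (scaleMap z r X) k) :
    HasL σ (fun Y => F (scaleMap z r Y)) X (r ^ 2 * k) := by
  obtain ⟨h1, h2⟩ := hF
  have he : scaleMap z r X = _ := scaleMap_eq z r X
  have hC := h1
  rw [he] at h1
  have hf : (fun Y => F (scaleMap z r Y)) =
      fun Y => F (((z, 0) : Pt n) + (r • ContinuousLinearMap.id ℝ (Pt n)) Y) :=
    funext fun Y => by rw [scaleMap_eq]
  refine ⟨?_, ?_⟩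
  · rw [hf]
    exact h1.comp X (contDiffAt_const.add (ContinuousLinearMap.contDiff _).contDiffAt)
  · have hd2 : ∀ v, d2 (fun Y => F (scaleMap z r Y)) X v = r ^ 2 * d2 F (scaleMap z r X) v := by
      intro v
      rw [hf, d2_comp_affine _ _ h1, ← he]
      exact d2_smul hC r v
    have hdt : dt (fun Y => F (scaleMap z r Y)) X = r * dt F (scaleMap z r X) := by
      rw [hf, dt_comp_affine _ _ (h1.differentiableAt (by norm_num)), ← he]
      exact (fderiv ℝ F (scaleMap z r X)).map_smul r (0, 1)
    rw [← h2, hdt]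
    unfold lapl
    simp only [hd2, ← Finset.mul_sum]
    simp only [scaleMap]
    rcases eq_or_ne X.2 0 with h0 | h0
    · simp [h0]; ring
    · field_simp

lemma HasN.comp_scaleMap {z : EuclideanSpace ℝ (Fin n)} {r : ℝ} (hr : 0 < r)
    (hF : HasN σ F (z + r • x) k) :
    HasN σ (fun Y => F (scaleMap z r Y)) x (r ^ (2 * σ) * k) := by
  obtain ⟨h1, h2, h3⟩ := hF
  have hmap : Tendsto (fun t : ℝ => r * t) (𝓝[>] 0) (𝓝[>] 0) := by
    refine tendsto_nhdsWithin_iff.2 ⟨?_, ?_⟩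
    · have : Tendsto (fun t : ℝ => r * t) (𝓝 0) (𝓝 (r * 0)) := (continuous_const_mul r).tendsto 0
      rw [mul_zero] at this
      exact this.mono_left nhdsWithin_le_nhds
    · filter_upwards [self_mem_nhdsWithin] with t ht
      exact mul_pos hr ht
  have hf : (fun Y => F (scaleMap z r Y)) =
      fun Y => F (((z, 0) : Pt n) + (r • ContinuousLinearMap.id ℝ (Pt n)) Y) :=
    funext fun Y => by rw [scaleMap_eq]
  have hev := hmap.eventually h1
  have hx : ∀ t : ℝ, ((z + r • x, r * t) : Pt n) =
      ((z, 0) : Pt n) + (r • ContinuousLinearMap.id ℝ (Pt n)) (x, t) := fun t => by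
    rw [← scaleMap_eq]; rfl
  refine ⟨?_, ?_, ?_⟩
  · filter_upwards [hev] with t ht
    rw [hx] at ht
    rw [hf]
    exact DifferentiableAt.fun_comp' _ ht (by fun_prop)
  · have : ContinuousWithinAt (fun t : ℝ => F (z + r • x, t)) (Set.Ici 0) (r * 0) := by
      rwa [mul_zero]
    refine this.comp (f := fun t : ℝ => r * t) (continuous_const_mul r).continuousWithinAt ?_
    intro t ht
    exact mul_nonneg hr.le ht
  · refine ((h3.comp hmap).const_mul (r ^ (2 * σ))).congr' ?_
    filter_upwards [hev, self_mem_nhdsWithin] with t ht h0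
    rw [hx] at ht
    rw [hf, dt_comp_affine _ _ ht, ← hx]
    have h0 : 0 < t := h0
    simp only [Function.comp, dt, FunLike.coe_smul, ContinuousLinearMap.id_apply,
      Pi.smul_apply, map_smul, smul_eq_mul]
    rw [Real.mul_rpow hr.le h0.le, ← mul_assoc, ← mul_assoc, ← Real.rpow_add hr]
    rw [show 2 * σ + (1 - 2 * σ) = 1 by ring, Real.rpow_one]
    ring

/-- Reflection of the `x`-variable in the hyperplane `x_i = m`. -/
def reflMap (i : Fin n) (m : ℝ) (x : EuclideanSpace ℝ (Fin n)) : EuclideanSpace ℝ (Fin n) :=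
  x + (2 * (m - x i)) • EuclideanSpace.single i (1 : ℝ)

/-- The linear part of the reflection `x_i ↦ -x_i` acting on `ℝ^{n+1}`. -/
def reflLin (i : Fin n) : Pt n →L[ℝ] Pt n :=
  ContinuousLinearMap.id ℝ (Pt n) - (2 : ℝ) •
    (((EuclideanSpace.proj i).comp (ContinuousLinearMap.fst ℝ (EuclideanSpace ℝ (Fin n)) ℝ)
      ).smulRight ((EuclideanSpace.single i (1 : ℝ), (0 : ℝ)) : Pt n))

lemma reflLin_apply (i : Fin n) (X : Pt n) :
    reflLin i X = (X.1 - (2 * X.1 i) • EuclideanSpace.single i (1 : ℝ), X.2) := by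
  ext <;> simp [reflLin, smul_smul]

lemma reflMap_eq (i : Fin n) (m : ℝ) (X : Pt n) :
    ((reflMap i m X.1, X.2) : Pt n) =
      (((2 * m) • EuclideanSpace.single i (1 : ℝ), (0 : ℝ)) : Pt n) + reflLin i X := by
  rw [reflLin_apply]
  refine Prod.ext ?_ (by simp)
  simp only [reflMap, Prod.fst_add]
  rw [mul_sub, sub_smul]; abel

lemma HasL.comp_refl {i : Fin n} {m : ℝ} (hF : HasL σ F (reflMap i m X.1, X.2) k) :
    HasL σ (fun Y => F (reflMap i m Y.1, Y.2)) X k := by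
  obtain ⟨h1, h2⟩ := hF
  have he := reflMap_eq i m X
  have hC := h1
  rw [he] at h1
  have hf : (fun Y : Pt n => F (reflMap i m Y.1, Y.2)) = fun Y => F
      ((((2 * m) • EuclideanSpace.single i (1 : ℝ), (0 : ℝ)) : Pt n) + reflLin i Y) :=
    funext fun Y => by rw [reflMap_eq]
  refine ⟨?_, ?_⟩
  · rw [hf]
    exact h1.comp X (contDiffAt_const.add (ContinuousLinearMap.contDiff _).contDiffAt)
  · have hd2 : ∀ v, d2 (fun Y : Pt n => F (reflMap i m Y.1, Y.2)) X v =
        d2 F (reflMap i m X.1, X.2) (reflLin i v) := by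
      intro v
      rw [hf, d2_comp_affine _ _ h1, ← he]
    have ht : reflLin i ((0, 1) : Pt n) = (0, 1) := by
      rw [reflLin_apply]; simp
    have hj : ∀ j : Fin n, d2 (fun Y : Pt n => F (reflMap i m Y.1, Y.2)) X
        (EuclideanSpace.single j (1 : ℝ), (0 : ℝ)) =
        d2 F (reflMap i m X.1, X.2) (EuclideanSpace.single j (1 : ℝ), (0 : ℝ)) := by
      intro j
      rw [hd2, reflLin_apply]
      by_cases hij : i = j
      · subst hij
        have : ((EuclideanSpace.single i (1 : ℝ) -
            (2 * (EuclideanSpace.single i (1 : ℝ) : EuclideanSpace ℝ (Fin n)) i) •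
              EuclideanSpace.single i (1 : ℝ), (0 : ℝ)) : Pt n) =
            (-1 : ℝ) • (EuclideanSpace.single i (1 : ℝ), (0 : ℝ)) := by
          refine Prod.ext ?_ (by simp)
          simp only [PiLp.single_apply, if_true, mul_one, Prod.smul_fst]
          rw [two_smul]; simp
        rw [this, d2_smul hC]; norm_num
      · simp [hij]
    have hdt : dt (fun Y : Pt n => F (reflMap i m Y.1, Y.2)) X
        = dt F (reflMap i m X.1, X.2) := by
      rw [hf, dt_comp_affine _ _ (h1.differentiableAt (by norm_num)), ← he, ht]; rfl
    rw [← h2, hdt]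
    unfold lapl
    simp only [hd2 (0, 1), ht, hj]

lemma HasN.comp_refl {i : Fin n} {m : ℝ} (hF : HasN σ F (reflMap i m x) k) :
    HasN σ (fun Y => F (reflMap i m Y.1, Y.2)) x k := by
  obtain ⟨h1, h2, h3⟩ := hF
  have hf : (fun Y : Pt n => F (reflMap i m Y.1, Y.2)) = fun Y => F
      ((((2 * m) • EuclideanSpace.single i (1 : ℝ), (0 : ℝ)) : Pt n) + reflLin i Y) :=
    funext fun Y => by rw [reflMap_eq]
  have ht : reflLin i ((0, 1) : Pt n) = (0, 1) := by
    rw [reflLin_apply]; simp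
  have hx : ∀ t : ℝ, ((reflMap i m x, t) : Pt n) = _ := fun t => reflMap_eq i m (x, t)
  refine ⟨?_, h2, ?_⟩
  · filter_upwards [h1] with t ht
    rw [hx] at ht
    rw [hf]
    exact DifferentiableAt.fun_comp' _ ht (by fun_prop)
  · refine h3.congr' ?_
    filter_upwards [h1] with t h4
    rw [hx] at h4
    rw [hf, dt_comp_affine _ _ h4, ← hx, ht]; rfl

end Operators

/-! ### Explicit functions -/

section Barriers

variable {n : ℕ} {σ : ℝ}

lemma norm_sub_sq_line (x z : EuclideanSpace ℝ (Fin n)) (i : Fin n) (s : ℝ) :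
    ‖x + s • EuclideanSpace.single i (1 : ℝ) - z‖ ^ 2 =
      ‖x - z‖ ^ 2 + 2 * s * (x - z) i + s ^ 2 := by
  rw [show x + s • EuclideanSpace.single i (1 : ℝ) - z =
    (x - z) + s • EuclideanSpace.single i (1 : ℝ) by abel, norm_add_sq_real, inner_smul_right,
    norm_smul]
  simp [EuclideanSpace.inner_single_right]
  ring

/-- `L` applied to a function of `(|x - z|², t)`. -/
lemma hasL_radial {F : Pt n → ℝ} {z : EuclideanSpace ℝ (Fin n)} {X : Pt n} {g : ℝ → ℝ → ℝ}
    {g1 k1 : ℝ → ℝ} {g2 k2 : ℝ} (hF : ∀ Y, F Y = g (‖Y.1 - z‖ ^ 2) Y.2) (hC : ContDiffAt ℝ 2 F X)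
    (h1 : ∀ᶠ q in 𝓝 (‖X.1 - z‖ ^ 2), HasDerivAt (fun q => g q X.2) (g1 q) q)
    (h2 : HasDerivAt g1 g2 (‖X.1 - z‖ ^ 2))
    (h3 : ∀ᶠ t in 𝓝 X.2, HasDerivAt (fun t => g (‖X.1 - z‖ ^ 2) t) (k1 t) t)
    (h4 : HasDerivAt k1 k2 X.2) :
    HasL σ F X (4 * ‖X.1 - z‖ ^ 2 * g2 + 2 * n * g1 (‖X.1 - z‖ ^ 2) + k2 +
      (1 - 2 * σ) / X.2 * k1 X.2) := by
  set q0 := ‖X.1 - z‖ ^ 2 with hq0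
  refine ⟨hC, ?_⟩
  have hdt : dt F X = k1 X.2 := by
    refine fderiv_eq_of_line (φ := fun s => g q0 (X.2 + s)) (hC.differentiableAt (by norm_num))
      (fun s => by rw [hF]; simp [hq0]) ?_
    have h := h3.self_of_nhds
    refine HasDerivAt.comp_const_add X.2 0 ?_
    rwa [add_zero]
  have htt : d2 F X (0, 1) = k2 := by
    refine d2_eq_of_line (φ := fun s => g q0 (X.2 + s)) (φ1 := fun s => k1 (X.2 + s)) hC
      (fun s => by rw [hF]; simp [hq0]) ?_ ?_
    · have hc : Tendsto (fun s : ℝ => X.2 + s) (𝓝 0) (𝓝 X.2) := by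
        simpa using (continuous_const_add X.2).tendsto 0
      filter_upwards [hc.eventually h3] with s hs
      exact HasDerivAt.comp_const_add X.2 s hs
    · refine HasDerivAt.comp_const_add X.2 0 ?_
      rwa [add_zero]
  have hxx : ∀ i : Fin n, d2 F X (EuclideanSpace.single i (1 : ℝ), (0 : ℝ)) =
      4 * ((X.1 - z) i) ^ 2 * g2 + 2 * g1 q0 := by
    intro i
    set y := (X.1 - z) i with hy
    have hp : ∀ s : ℝ, HasDerivAt (fun s : ℝ => q0 + 2 * s * y + s ^ 2) (2 * y + 2 * s) s := by
      intro s
      have := (((hasDerivAt_id s).const_mul 2).mul_const y).const_add q0 |>.add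
        ((hasDerivAt_id s).pow 2)
      refine this.congr_deriv ?_
      simp
    have hp0 : q0 + 2 * 0 * y + 0 ^ 2 = q0 := by simp
    have hc : Tendsto (fun s : ℝ => q0 + 2 * s * y + s ^ 2) (𝓝 0) (𝓝 q0) := by
      have := (hp 0).continuousAt.tendsto
      rwa [hp0] at this
    refine d2_eq_of_line (φ := fun s => g (q0 + 2 * s * y + s ^ 2) X.2)
      (φ1 := fun s => g1 (q0 + 2 * s * y + s ^ 2) * (2 * y + 2 * s)) hC
      (fun s => by
        rw [hF]
        simp only [Prod.fst_add, Prod.smul_fst, Prod.snd_add, Prod.smul_snd, smul_zero, add_zero]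
        rw [norm_sub_sq_line]) ?_ ?_
    · filter_upwards [hc.eventually h1] with s hs
      exact HasDerivAt.comp s hs (hp s)
    · have e1 : HasDerivAt (fun s => g1 (q0 + 2 * s * y + s ^ 2)) (g2 * (2 * y + 2 * 0)) 0 :=
        HasDerivAt.comp (0 : ℝ) (by rw [hp0]; exact h2) (hp 0)
      have e2 : HasDerivAt (fun s : ℝ => 2 * y + 2 * s) 2 0 := by
        simpa using ((hasDerivAt_id (0 : ℝ)).const_mul 2).const_add (2 * y)
      refine (e1.mul e2).congr_deriv ?_
      simp; ring
  have hsum : ∑ i : Fin n, ((X.1 - z) i) ^ 2 = q0 := by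
    rw [hq0, EuclideanSpace.norm_sq_eq]; simp
  unfold lapl
  rw [hdt, htt]
  simp only [hxx, Finset.sum_add_distrib, Finset.sum_const, Finset.card_univ, Fintype.card_fin,
    ← Finset.sum_mul, ← Finset.mul_sum, hsum, nsmul_eq_mul]
  ring

lemma hasN_of_eventually_hasDerivAt {F : Pt n → ℝ} {x : EuclideanSpace ℝ (Fin n)} {k1 : ℝ → ℝ}
    {l : ℝ} (hd : ∀ᶠ t in 𝓝[>] (0 : ℝ), DifferentiableAt ℝ F (x, t))
    (hc : ContinuousWithinAt (fun t : ℝ => F (x, t)) (Set.Ici 0) 0)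
    (hk : ∀ᶠ t in 𝓝[>] (0 : ℝ), HasDerivAt (fun t => F (x, t)) (k1 t) t)
    (hl : Tendsto (fun t : ℝ => t ^ (1 - 2 * σ) * k1 t) (𝓝[>] 0) (𝓝 l)) : HasN σ F x l := by
  refine ⟨hd, hc, hl.congr' ?_⟩
  filter_upwards [hd, hk] with t ht htk
  have h := ht.hasFDerivAt.comp_hasDerivAt t
    ((hasDerivAt_const t x).prodMk (hasDerivAt_id t))
  rw [htk.unique h]; rfl

lemma hasN_of_hasDerivAt {F : Pt n → ℝ} {x : EuclideanSpace ℝ (Fin n)} {k1 : ℝ → ℝ} {l : ℝ}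
    (hd : ∀ t, 0 < t → DifferentiableAt ℝ F (x, t))
    (hc : ContinuousWithinAt (fun t : ℝ => F (x, t)) (Set.Ici 0) 0)
    (hk : ∀ t, 0 < t → HasDerivAt (fun t => F (x, t)) (k1 t) t)
    (hl : Tendsto (fun t : ℝ => t ^ (1 - 2 * σ) * k1 t) (𝓝[>] 0) (𝓝 l)) : HasN σ F x l :=
  hasN_of_eventually_hasDerivAt (eventually_nhdsWithin_of_forall hd) hc
    (eventually_nhdsWithin_of_forall hk) hl

lemma normSq_add_sq_pos {z : EuclideanSpace ℝ (Fin n)} {X : Pt n} (hX : X ≠ (z, 0)) :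
    0 < ‖X.1 - z‖ ^ 2 + X.2 ^ 2 := by
  by_contra! h
  apply hX
  have h1 : ‖X.1 - z‖ ^ 2 = 0 := by nlinarith [sq_nonneg ‖X.1 - z‖, sq_nonneg X.2]
  have h2 : X.2 ^ 2 = 0 := by nlinarith [sq_nonneg ‖X.1 - z‖, sq_nonneg X.2]
  refine Prod.ext ?_ ?_
  · simpa [sub_eq_zero] using h1
  · simpa using h2

/-- The function `t^m (|x - z|² + t²)^{-b}`. -/
def powBlock (z : EuclideanSpace ℝ (Fin n)) (m b : ℝ) (X : Pt n) : ℝ :=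
  X.2 ^ m * (‖X.1 - z‖ ^ 2 + X.2 ^ 2) ^ (-b)

lemma powBlock_contDiffAt (z : EuclideanSpace ℝ (Fin n)) (m b : ℝ) {X : Pt n} (hX : 0 < X.2) :
    ContDiffAt ℝ 2 (powBlock z m b) X := by
  unfold powBlock
  have h1 : ContDiffAt ℝ 2 (fun X : Pt n => X.2) X := contDiffAt_snd
  have h2 : ContDiffAt ℝ 2 (fun X : Pt n => ‖X.1 - z‖ ^ 2) X :=
    (contDiffAt_fst.sub contDiffAt_const).norm_sq ℝ
  exact (h1.rpow_const_of_ne hX.ne').mul ((h2.add (h1.pow 2)).rpow_const_of_ne (by positivity))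

lemma powBlock_hasDerivAt (z x : EuclideanSpace ℝ (Fin n)) (m b : ℝ) {t : ℝ} (ht : 0 < t) :
    HasDerivAt (fun t => powBlock z m b (x, t))
      (m * t ^ (m - 1) * (‖x - z‖ ^ 2 + t ^ 2) ^ (-b) +
        t ^ m * ((2 * t) * (-b) * (‖x - z‖ ^ 2 + t ^ 2) ^ (-b - 1))) t := by
  have h1 : HasDerivAt (fun t : ℝ => ‖x - z‖ ^ 2 + t ^ 2) (2 * t) t := by
    simpa using ((hasDerivAt_id t).pow 2).const_add (‖x - z‖ ^ 2)
  exact (Real.hasDerivAt_rpow_const (Or.inl ht.ne')).mul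
    (h1.rpow_const (Or.inl (by positivity)))

lemma hasL_powBlock (z : EuclideanSpace ℝ (Fin n)) {m : ℝ} (b : ℝ) (hm : m * (m - 2 * σ) = 0)
    {X : Pt n} (hX : 0 < X.2) :
    HasL σ (powBlock z m b) X (-(2 * b) * (n - 2 * σ - 2 * b + 2 * m) *
      (X.2 ^ m * (‖X.1 - z‖ ^ 2 + X.2 ^ 2) ^ (-b - 1))) := by
  set q0 := ‖X.1 - z‖ ^ 2 with hq0
  set t := X.2 with ht
  have hq0n : 0 ≤ q0 := by positivity
  have hR : 0 < q0 + t ^ 2 := by positivity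
  have hder : ∀ (e : ℝ) (s : ℝ), 0 < s → HasDerivAt (fun s : ℝ => (q0 + s ^ 2) ^ e)
      ((2 * s) * e * (q0 + s ^ 2) ^ (e - 1)) s := by
    intro e s hs
    have h1 : HasDerivAt (fun t : ℝ => q0 + t ^ 2) (2 * s) s := by
      simpa using ((hasDerivAt_id s).pow 2).const_add q0
    exact h1.rpow_const (Or.inl (by positivity))
  have hderq : ∀ (e : ℝ) (q : ℝ), 0 < q + t ^ 2 → HasDerivAt (fun q : ℝ => (q + t ^ 2) ^ e)
      (e * (q + t ^ 2) ^ (e - 1)) q := by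
    intro e q hq
    simpa using ((hasDerivAt_id q).add_const (t ^ 2)).rpow_const (p := e) (Or.inl hq.ne')
  have key := hasL_radial (σ := σ) (F := powBlock z m b) (z := z) (X := X)
    (g := fun q t => t ^ m * (q + t ^ 2) ^ (-b))
    (g1 := fun q => t ^ m * (-b * (q + t ^ 2) ^ (-b - 1)))
    (g2 := t ^ m * (-b * ((-b - 1) * (q0 + t ^ 2) ^ (-b - 1 - 1))))
    (k1 := fun t => m * t ^ (m - 1) * (q0 + t ^ 2) ^ (-b) +
        t ^ m * ((2 * t) * (-b) * (q0 + t ^ 2) ^ (-b - 1)))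
    (k2 := (m * ((m - 1) * t ^ (m - 1 - 1)) * (q0 + t ^ 2) ^ (-b) +
        m * t ^ (m - 1) * ((2 * t) * (-b) * (q0 + t ^ 2) ^ (-b - 1))) +
        (m * t ^ (m - 1) * ((2 * t) * (-b) * (q0 + t ^ 2) ^ (-b - 1)) +
        t ^ m * ((2 * (-b)) * (q0 + t ^ 2) ^ (-b - 1) +
          (2 * t) * (-b) * ((2 * t) * (-b - 1) * (q0 + t ^ 2) ^ (-b - 1 - 1)))))
    (fun Y => rfl) (powBlock_contDiffAt z m b hX) ?_ ?_ ?_ ?_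
  · convert key using 1
    rw [← hq0, ← ht]
    have e1 : t ^ (m - 1) = t ^ m / t := Real.rpow_sub_one hX.ne' m
    have e2 : t ^ (m - 1 - 1) = t ^ m / t / t := by rw [Real.rpow_sub_one hX.ne', e1]
    have e3 : (q0 + t ^ 2) ^ (-b - 1 - 1) = (q0 + t ^ 2) ^ (-b - 1) / (q0 + t ^ 2) :=
      Real.rpow_sub_one hR.ne' _
    have e4 : (q0 + t ^ 2) ^ (-b) = (q0 + t ^ 2) ^ (-b - 1) * (q0 + t ^ 2) := by
      rw [Real.rpow_sub_one hR.ne']; field_simp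
    simp only [e1, e2, e3, e4]
    generalize (q0 + t ^ 2) ^ (-b - 1) = A
    generalize t ^ m = B
    have hX' : t ≠ 0 := hX.ne'
    have hR' := hR.ne'
    field_simp
    linear_combination (-(A * B * (q0 + t ^ 2) ^ 2)) * hm
  · have : ∀ᶠ q in 𝓝 q0, 0 < q + t ^ 2 :=
      (continuous_add_const (t ^ 2)).continuousAt.eventually (lt_mem_nhds hR)
    filter_upwards [this] with q hq
    exact (hderq (-b) q hq).const_mul _
  · exact ((hderq (-b - 1) q0 hR).const_mul _).const_mul _
  · filter_upwards [lt_mem_nhds hX] with s hs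
    exact (Real.hasDerivAt_rpow_const (Or.inl hs.ne')).mul (hder (-b) s hs)
  · have d1 : HasDerivAt (fun s : ℝ => s ^ (m - 1)) ((m - 1) * t ^ (m - 1 - 1)) t :=
      Real.hasDerivAt_rpow_const (Or.inl hX.ne')
    have d2 : HasDerivAt (fun s : ℝ => s ^ m) (m * t ^ (m - 1)) t :=
      Real.hasDerivAt_rpow_const (Or.inl hX.ne')
    have d3 : HasDerivAt (fun s : ℝ => 2 * s * (-b)) (2 * (-b)) t := by
      simpa using ((hasDerivAt_id t).const_mul 2).mul_const (-b)
    exact ((d1.const_mul m).mul (hder (-b) t hX)).add (d2.mul (d3.mul (hder (-b - 1) t hX)))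

lemma powBlock_continuousAt (z : EuclideanSpace ℝ (Fin n)) {m : ℝ} (hm : 0 ≤ m) (b : ℝ)
    {X : Pt n} (hX : X ≠ (z, 0)) : ContinuousAt (powBlock z m b) X := by
  unfold powBlock
  have h1 : ContinuousAt (fun X : Pt n => X.2 ^ m) X :=
    continuous_snd.continuousAt.rpow_const (Or.inr hm)
  have h2 : ContinuousAt (fun X : Pt n => ‖X.1 - z‖ ^ 2 + X.2 ^ 2) X := by fun_prop
  exact h1.mul (h2.rpow_const (Or.inl (normSq_add_sq_pos hX).ne'))

lemma tendsto_add_sq_rpow {q : ℝ} (hq : 0 < q) (e : ℝ) :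
    Tendsto (fun t : ℝ => (q + t ^ 2) ^ e) (𝓝[>] 0) (𝓝 (q ^ e)) := by
  have h : ContinuousAt (fun t : ℝ => (q + t ^ 2) ^ e) 0 :=
    ContinuousAt.rpow_const (by fun_prop) (Or.inl (by simpa using hq.ne'))
  have h2 := h.tendsto
  simp only [ne_eq, OfNat.ofNat_ne_zero, not_false_eq_true, zero_pow, add_zero] at h2
  exact h2.mono_left nhdsWithin_le_nhds

lemma tendsto_rpow_zero {e : ℝ} (he : 0 < e) :
    Tendsto (fun t : ℝ => t ^ e) (𝓝[>] 0) (𝓝 0) := by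
  have h : ContinuousAt (fun t : ℝ => t ^ e) 0 := Real.continuousAt_rpow_const _ _ (Or.inr he.le)
  have h2 := h.tendsto
  rw [Real.zero_rpow he.ne'] at h2
  exact h2.mono_left nhdsWithin_le_nhds

lemma hasN_powBlock_zero (hσ : σ < 1) (z : EuclideanSpace ℝ (Fin n)) (b : ℝ)
    {x : EuclideanSpace ℝ (Fin n)} (hx : x ≠ z) : HasN σ (powBlock z 0 b) x 0 := by
  have hq : 0 < ‖x - z‖ ^ 2 := by
    have := norm_pos_iff.2 (sub_ne_zero.2 hx); positivity
  refine hasN_of_hasDerivAt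
    (fun t ht => (powBlock_contDiffAt z 0 b (X := (x, t)) ht).differentiableAt (by norm_num))
    ?_ (fun t ht => powBlock_hasDerivAt z x 0 b ht) ?_
  · have h : ContinuousAt (powBlock z 0 b) (x, 0) :=
      powBlock_continuousAt z le_rfl b (by simp [hx])
    exact (h.comp (f := fun t : ℝ => ((x, t) : Pt n)) (by fun_prop)).continuousWithinAt
  · have h := ((tendsto_rpow_zero (e := 2 - 2 * σ) (by linarith)).mul
      (tendsto_add_sq_rpow hq (-b - 1))).const_mul (-2 * b)
    rw [zero_mul, mul_zero] at h
    refine h.congr' ?_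
    filter_upwards [self_mem_nhdsWithin] with t ht
    have ht : 0 < t := ht
    rw [show 2 - 2 * σ = (1 - 2 * σ) + 1 by ring, Real.rpow_add_one ht.ne', Real.rpow_zero]
    ring

lemma hasN_powBlock_two (hσ : 0 < σ) (z : EuclideanSpace ℝ (Fin n)) (b : ℝ)
    {x : EuclideanSpace ℝ (Fin n)} (hx : x ≠ z) :
    HasN σ (powBlock z (2 * σ) b) x (2 * σ * (‖x - z‖ ^ 2) ^ (-b)) := by
  have hq : 0 < ‖x - z‖ ^ 2 := by
    have := norm_pos_iff.2 (sub_ne_zero.2 hx); positivity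
  refine hasN_of_hasDerivAt
    (fun t ht => (powBlock_contDiffAt z _ b (X := (x, t)) ht).differentiableAt (by norm_num))
    ?_ (fun t ht => powBlock_hasDerivAt z x _ b ht) ?_
  · have h : ContinuousAt (powBlock z (2 * σ) b) (x, 0) :=
      powBlock_continuousAt z (by linarith) b (by simp [hx])
    exact (h.comp (f := fun t : ℝ => ((x, t) : Pt n)) (by fun_prop)).continuousWithinAt
  · have h := ((tendsto_add_sq_rpow hq (-b)).const_mul (2 * σ)).add
      (((tendsto_rpow_zero (e := 2) (by norm_num)).mul
      (tendsto_add_sq_rpow hq (-b - 1))).const_mul (-2 * b))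
    rw [zero_mul, mul_zero, add_zero] at h
    refine h.congr' ?_
    filter_upwards [self_mem_nhdsWithin] with t ht
    have ht : 0 < t := ht
    have e1 : t ^ (1 - 2 * σ) * t ^ (2 * σ - 1) = 1 := by
      rw [← Real.rpow_add ht]; simp
    have e2 : t ^ (1 - 2 * σ) * t ^ (2 * σ) = t := by
      rw [← Real.rpow_add ht]; simp
    rw [mul_add]
    have e3 : t ^ (2 : ℝ) = t * t := by norm_num [sq]
    rw [e3]
    linear_combination (-(2 * σ * (‖x - z‖ ^ 2 + t ^ 2) ^ (-b))) * e1 +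
      (2 * t * b * (‖x - z‖ ^ 2 + t ^ 2) ^ (-b - 1)) * e2

/-- Functions of `t` alone: the quadratics `(t - T)²`. -/
lemma hasL_sq_sub (T : ℝ) (X : Pt n) :
    HasL σ (fun Y : Pt n => (Y.2 - T) ^ 2) X (2 + (1 - 2 * σ) / X.2 * (2 * (X.2 - T))) := by
  have hd : ∀ t : ℝ, HasDerivAt (fun t : ℝ => (t - T) ^ 2) (2 * (t - T)) t := fun t => by
    simpa using ((hasDerivAt_id t).sub_const T).fun_pow 2
  have h := hasL_radial (σ := σ) (F := fun Y : Pt n => (Y.2 - T) ^ 2) (z := 0) (X := X)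
    (g := fun _ t => (t - T) ^ 2) (g1 := fun _ => 0) (g2 := 0) (k1 := fun t => 2 * (t - T))
    (k2 := 2) (fun Y => rfl) ((contDiffAt_snd.sub contDiffAt_const).pow 2)
    (Eventually.of_forall fun q => hasDerivAt_const _ _) (hasDerivAt_const _ _)
    (Eventually.of_forall hd) (by simpa using ((hasDerivAt_id X.2).sub_const T).const_mul 2)
  simpa using h

lemma hasN_sq (hσ : σ < 1) (x : EuclideanSpace ℝ (Fin n)) :
    HasN σ (fun Y : Pt n => Y.2 ^ 2) x 0 := by
  refine hasN_of_hasDerivAt (k1 := fun t => 2 * t) (fun t _ => by fun_prop) (by fun_prop)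
    (fun t _ => by simpa using (hasDerivAt_id t).fun_pow 2) ?_
  have h := (tendsto_rpow_zero (e := 2 - 2 * σ) (by linarith)).const_mul 2
  rw [mul_zero] at h
  refine h.congr' ?_
  filter_upwards [self_mem_nhdsWithin] with t ht
  have ht : 0 < t := ht
  rw [show 2 - 2 * σ = (1 - 2 * σ) + 1 by ring, Real.rpow_add_one ht.ne']
  ring

lemma hasL_norm_sq (X : Pt n) : HasL σ (fun Y : Pt n => ‖Y.1‖ ^ 2) X (2 * n) := by
  have h := hasL_radial (σ := σ) (F := fun Y : Pt n => ‖Y.1‖ ^ 2) (z := 0) (X := X)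
    (g := fun q _ => q) (g1 := fun _ => 1) (g2 := 0) (k1 := fun _ => 0)
    (k2 := 0) (fun Y => by simp) (contDiffAt_fst.norm_sq ℝ)
    (Eventually.of_forall fun q => hasDerivAt_id _) (hasDerivAt_const _ _)
    (Eventually.of_forall fun t => hasDerivAt_const _ _) (hasDerivAt_const _ _)
  simpa using h

lemma hasN_of_fst {φ : EuclideanSpace ℝ (Fin n) → ℝ} (hφ : Differentiable ℝ φ)
    (x : EuclideanSpace ℝ (Fin n)) : HasN σ (fun Y : Pt n => φ Y.1) x 0 := by
  refine hasN_of_hasDerivAt (k1 := fun _ => 0) (fun t _ => by fun_prop)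
    continuousWithinAt_const (fun t _ => hasDerivAt_const t (φ x)) (by simp)

lemma hasL_coord (i : Fin n) (m : ℝ) (X : Pt n) :
    HasL σ (fun Y : Pt n => 4 * (Y.1 i - m) - (Y.1 i - m) ^ 2) X (-2) := by
  have hc : ContDiff ℝ 2 (fun Y : Pt n => Y.1 i) := by
    have := (EuclideanSpace.proj (𝕜 := ℝ) i).comp
      (ContinuousLinearMap.fst ℝ (EuclideanSpace ℝ (Fin n)) ℝ) |>.contDiff (n := 2)
    exact this
  have hC : ContDiffAt ℝ 2 (fun Y : Pt n => 4 * (Y.1 i - m) - (Y.1 i - m) ^ 2) X := by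
    have := hc.sub (contDiff_const (c := m))
    exact ((contDiff_const.mul this).sub (this.pow 2)).contDiffAt
  refine ⟨hC, ?_⟩
  have hv : ∀ v : Pt n, d2 (fun Y : Pt n => 4 * (Y.1 i - m) - (Y.1 i - m) ^ 2) X v
      = -2 * (v.1 i) ^ 2 ∧ fderiv ℝ (fun Y : Pt n => 4 * (Y.1 i - m) - (Y.1 i - m) ^ 2) X v
      = 4 * v.1 i - 2 * (X.1 i - m) * v.1 i := by
    intro v
    have hl : ∀ s : ℝ, HasDerivAt (fun s : ℝ => X.1 i + s * v.1 i - m) (v.1 i) s := fun s => by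
      simpa using (((hasDerivAt_id s).mul_const (v.1 i)).const_add (X.1 i)).sub_const m
    have h1 : ∀ s : ℝ, HasDerivAt
        (fun s : ℝ => 4 * (X.1 i + s * v.1 i - m) - (X.1 i + s * v.1 i - m) ^ 2)
        (4 * v.1 i - 2 * (X.1 i + s * v.1 i - m) * v.1 i) s := fun s => by
      simpa using ((hl s).const_mul 4).fun_sub ((hl s).fun_pow 2)
    constructor
    · refine d2_eq_of_line hC (fun s => by simp) (Eventually.of_forall h1) ?_
      refine ((((hl 0).const_mul 2).mul_const (v.1 i)).const_sub (4 * v.1 i)).congr_deriv ?_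
      ring
    · refine fderiv_eq_of_line (hC.differentiableAt (by norm_num)) (fun s => by simp)
        ((h1 0).congr_deriv ?_)
      simp
  have hdt : dt (fun Y : Pt n => 4 * (Y.1 i - m) - (Y.1 i - m) ^ 2) X = 0 := by
    unfold dt; rw [(hv _).2]; simp
  rw [hdt]
  unfold lapl
  simp only [(hv _).1]
  rw [Finset.sum_eq_single i] <;> simp +contextual [Ne.symm]

end Barriers

/-! ### A maximum principle on punctured domains -/

section MaxPrinciple

variable {n : ℕ} {σ : ℝ}

lemma powBlock_zero_left (z : EuclideanSpace ℝ (Fin n)) (b : ℝ) (X : Pt n) :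
    powBlock z 0 b X = (‖X.1 - z‖ ^ 2 + X.2 ^ 2) ^ (-b) := by
  simp [powBlock]

/-- The point at `X` is either one where `F ≤ 0`, or a strict subsolution point of `K`. -/
def SubAt (σ : ℝ) (K : Set (Pt n)) (F : Pt n → ℝ) (X : Pt n) : Prop :=
  F X ≤ 0 ∨ (0 < X.2 ∧ K ∈ 𝓝 X ∧ ∃ l, 0 < l ∧ HasL σ F X l) ∨
    (X.2 = 0 ∧ (∀ᶠ t in 𝓝[>] (0 : ℝ), (X.1, t) ∈ K) ∧ ∃ l, 0 < l ∧ HasN σ F X.1 l)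

lemma nonpos_of_subAt (hn : 2 ≤ n) (hσ : σ ∈ Set.Ioo (0 : ℝ) 1) {K : Set (Pt n)}
    (hK : IsCompact K) (p : EuclideanSpace ℝ (Fin n)) {F : Pt n → ℝ}
    (hc : ContinuousOn F (K \ {(p, 0)})) {M : ℝ} (hM : ∀ X ∈ K, X ≠ (p, 0) → F X ≤ M)
    (h : ∀ X ∈ K, X ≠ (p, 0) → SubAt σ K F X) : ∀ X ∈ K, X ≠ (p, 0) → F X ≤ 0 := by
  intro X0 hX0 hXp
  by_contra! hpos
  have hn' : (2 : ℝ) ≤ n := by exact_mod_cast hn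
  set γ : ℝ := ((n : ℝ) - 2 * σ) / 2 with hγ
  have hγ0 : 0 < γ := by have := hσ.2; rw [hγ]; linarith
  set B : Pt n → ℝ := powBlock p 0 γ with hB
  have hBpos : ∀ X : Pt n, X ≠ (p, 0) → 0 < B X := fun X hX => by
    rw [hB, powBlock_zero_left]; exact Real.rpow_pos_of_pos (normSq_add_sq_pos hX) _
  set ε : ℝ := F X0 / (2 * B X0) with hε
  have hB0 := hBpos X0 hXp
  have hε0 : 0 < ε := by positivity
  have hG0 : 0 < F X0 - ε * B X0 := by
    have : ε * B X0 = F X0 / 2 := by rw [hε]; field_simp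
    linarith
  obtain ⟨ρ, hρ, hρ1⟩ : ∃ ρ : ℝ, 0 < ρ ∧ ∀ R, 0 < R → R < ρ → M < ε * R ^ (-γ) := by
    have h1 : Tendsto (fun R : ℝ => ε * R ^ (-γ)) (𝓝[>] 0) atTop :=
      (tendsto_rpow_neg_nhdsGT_zero (by linarith)).const_mul_atTop hε0
    have h2 := h1.eventually (eventually_gt_atTop M)
    rw [eventually_nhdsWithin_iff] at h2
    obtain ⟨ρ, hρ, h3⟩ := Metric.eventually_nhds_iff.1 h2
    refine ⟨ρ, hρ, fun R hR hR1 => h3 ?_ hR⟩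
    rw [Real.dist_eq, sub_zero, abs_of_pos hR]; exact hR1
  set G : Pt n → ℝ := fun X => F X - ε * B X with hG
  have hsmall : ∀ X ∈ K, X ≠ (p, 0) → ‖X.1 - p‖ ^ 2 + X.2 ^ 2 < ρ → G X < 0 := by
    intro X hX hp hR
    have h1 := hρ1 _ (normSq_add_sq_pos hp) hR
    have h2 := hM X hX hp
    have h3 : B X = (‖X.1 - p‖ ^ 2 + X.2 ^ 2) ^ (-γ) := powBlock_zero_left _ _ _
    simp only [hG, h3]; linarith
  set K' : Set (Pt n) := K ∩ {X | ρ ≤ ‖X.1 - p‖ ^ 2 + X.2 ^ 2} with hK'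
  have hK'c : IsCompact K' :=
    hK.inter_right (isClosed_le continuous_const (by fun_prop))
  have hK'p : ∀ X ∈ K', X ≠ (p, 0) := by
    rintro X hX rfl
    have := hX.2
    simp at this
    linarith
  have hX0' : X0 ∈ K' := by
    refine ⟨hX0, ?_⟩
    by_contra! h1
    exact absurd (hsmall X0 hX0 hXp (by simpa using h1)) (not_lt.2 hG0.le)
  have hGc : ContinuousOn G K' := by
    refine (hc.mono fun X hX => ⟨hX.1, hK'p X hX⟩).sub (continuousOn_const.mul ?_)
    exact fun X hX => (powBlock_continuousAt p le_rfl γ (hK'p X hX)).continuousWithinAt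
  obtain ⟨X1, hX1, hmax⟩ := hK'c.exists_isMaxOn ⟨X0, hX0'⟩ hGc
  have hG1 : 0 < G X1 := hG0.trans_le (hmax hX0')
  have hX1p := hK'p X1 hX1
  have hall : ∀ Y ∈ K, Y ≠ (p, 0) → G Y ≤ G X1 := by
    intro Y hY hYp
    by_cases hR : ‖Y.1 - p‖ ^ 2 + Y.2 ^ 2 < ρ
    · exact ((hsmall Y hY hYp hR).trans hG1).le
    · exact hmax ⟨hY, not_lt.1 hR⟩
  rcases h X1 hX1.1 hX1p with h0 | ⟨ht, hKn, l, hl, hL⟩ | ⟨ht, hKn, l, hl, hN⟩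
  · have := hBpos X1 hX1p
    simp only [hG] at hG1
    nlinarith
  · have hLB : HasL σ B X1 0 := by
      have := hasL_powBlock (σ := σ) p (m := 0) γ (by ring) ht
      rwa [show -(2 * γ) * ((n : ℝ) - 2 * σ - 2 * γ + 2 * 0) = 0 by rw [hγ]; ring, zero_mul] at this
    have hloc : IsLocalMax G X1 := by
      filter_upwards [hKn, isOpen_ne.mem_nhds hX1p] with Y hY hYp using hall Y hY hYp
    have := (hL.sub (hLB.const_mul ε)).nonpos_of_isLocalMax hloc
    linarith
  · have hxp : X1.1 ≠ p := fun h1 => hX1p (Prod.ext h1 ht)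
    have := (hN.sub ((hasN_powBlock_zero hσ.2 p γ hxp).const_mul ε)).nonpos_of_max ?_
    · linarith
    · filter_upwards [hKn] with t h1
      have := hall (X1.1, t) h1 (by simp [hxp])
      rwa [show X1 = (X1.1, 0) from Prod.ext rfl ht] at this

end MaxPrinciple

/-! ### A modulus of continuity by reflection -/

section Reflection

variable {n : ℕ} {σ : ℝ}

/-- A bounded solution on the slab `|t - T| ≤ 1`, `t ≥ 0` over the ball of radius `5`, punctured at
the boundary point `p`, with conormal derivative `-f`. -/
structure SlabSol (σ M F₀ T : ℝ) (V : Pt n → ℝ) (p : EuclideanSpace ℝ (Fin n))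
    (f : EuclideanSpace ℝ (Fin n) → ℝ) : Prop where
  cont : ContinuousOn V ({X | ‖X.1‖ ≤ 5 ∧ 0 ≤ X.2 ∧ |X.2 - T| ≤ 1} \ {(p, 0)})
  bound : ∀ X : Pt n, ‖X.1‖ ≤ 5 → 0 ≤ X.2 → |X.2 - T| ≤ 1 → X ≠ (p, 0) → |V X| ≤ M
  hasL : ∀ X : Pt n, ‖X.1‖ ≤ 5 → 0 < X.2 → |X.2 - T| ≤ 1 → HasL σ V X 0
  hasN : T ≤ 1 → ∀ x, ‖x‖ ≤ 5 → x ≠ p → HasN σ V x (-f x)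
  source : T ≤ 1 → ∀ x, ‖x‖ ≤ 5 → x ≠ p → |f x| ≤ F₀

lemma SlabSol.neg {M F₀ T : ℝ} {V : Pt n → ℝ} {p : EuclideanSpace ℝ (Fin n)}
    {f : EuclideanSpace ℝ (Fin n) → ℝ} (h : SlabSol σ M F₀ T V p f) :
    SlabSol σ M F₀ T (fun X => -1 * V X) p (fun x => -f x) where
  cont := continuousOn_const.mul h.cont
  bound X h1 h2 h3 h4 := by simpa using h.bound X h1 h2 h3 h4
  hasL X h1 h2 h3 := by simpa using (h.hasL X h1 h2 h3).const_mul (-1)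
  hasN h1 x h2 h3 := by simpa using (h.hasN h1 x h2 h3).const_mul (-1)
  source h1 x h2 h3 := by simpa using h.source h1 x h2 h3

lemma reflMap_apply_same (i : Fin n) (m : ℝ) (x : EuclideanSpace ℝ (Fin n)) :
    reflMap i m x i = 2 * m - x i := by
  simp [reflMap]; ring

lemma reflMap_reflMap (i : Fin n) (m : ℝ) (x : EuclideanSpace ℝ (Fin n)) :
    reflMap i m (reflMap i m x) = x := by
  have h := reflMap_apply_same i m x
  rw [reflMap, h, reflMap, add_assoc, ← add_smul]
  rw [show 2 * (m - x i) + 2 * (m - (2 * m - x i)) = 0 by ring, zero_smul, add_zero]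

lemma abs_apply_le_norm (x : EuclideanSpace ℝ (Fin n)) (i : Fin n) : |x i| ≤ ‖x‖ :=
  PiLp.norm_apply_le x i

lemma norm_reflMap_le (i : Fin n) (m : ℝ) (x : EuclideanSpace ℝ (Fin n)) (hm : |m| ≤ 1)
    (hx : ‖x‖ ≤ 1) : ‖reflMap i m x‖ ≤ 5 := by
  have h1 := abs_apply_le_norm x i
  have h2 : |2 * (m - x i)| ≤ 4 := by
    rw [abs_mul, abs_two]; have := abs_sub m (x i); linarith
  calc ‖reflMap i m x‖ ≤ ‖x‖ + ‖(2 * (m - x i)) • EuclideanSpace.single i (1 : ℝ)‖ :=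
        norm_add_le _ _
    _ ≤ 1 + 4 := by
        refine add_le_add hx ?_
        rw [norm_smul]; simpa using h2
    _ = 5 := by norm_num

lemma exists_puncture (i : Fin n) (m : ℝ) (p : EuclideanSpace ℝ (Fin n)) :
    ∃ p' : EuclideanSpace ℝ (Fin n), ∀ y : EuclideanSpace ℝ (Fin n), m ≤ y i → y ≠ p' →
      y ≠ p ∧ reflMap i m y ≠ p := by
  rcases le_or_gt m (p i) with hp | hp
  · refine ⟨p, fun y hy hyp => ⟨hyp, fun h => hyp ?_⟩⟩
    have h1 : 2 * m - y i = p i := by rw [← reflMap_apply_same, h]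
    rw [← h, reflMap, show m - y i = 0 by linarith]; simp
  · refine ⟨reflMap i m p, fun y hy hyp => ⟨fun h => ?_, fun h => hyp ?_⟩⟩
    · rw [h] at hy; linarith
    · rw [← h, reflMap_reflMap]

/-- Comparison of a solution with its reflection, given a barrier `h` in the `t` variable. -/
lemma SlabSol.sub_refl_le (hn : 2 ≤ n) (hσ : σ ∈ Set.Ioo (0 : ℝ) 1) {M F₀ T : ℝ} {V : Pt n → ℝ}
    {p : EuclideanSpace ℝ (Fin n)} {f : EuclideanSpace ℝ (Fin n) → ℝ}
    (hV : SlabSol σ M F₀ T V p f) (hM : 0 ≤ M) {t₁ t₂ : ℝ} (ht₁ : 0 ≤ t₁) (ht₁T : T - 1 ≤ t₁)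
    (ht₂T : t₂ ≤ T + 1) (hT : t₁ = 0 → T ≤ 1) {h lh : ℝ → ℝ} {H κ A : ℝ} (hc : Continuous h)
    (hh0 : ∀ t, t₁ ≤ t → t ≤ t₂ → 0 ≤ h t) (hh1 : 0 < t₁ → 2 * M ≤ h t₁) (hh2 : 2 * M ≤ h t₂)
    (hL : ∀ X : Pt n, t₁ < X.2 → X.2 < t₂ → HasL σ (fun Y : Pt n => h Y.2) X (lh X.2))
    (hH : ∀ t, t₁ < t → t < t₂ → lh t ≤ H)
    (hN : t₁ = 0 → ∀ x, HasN σ (fun Y : Pt n => h Y.2) x (-κ)) (hκ : 2 * F₀ < κ)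
    (hA : 2 * n * M + H / 2 < A) (hA0 : 0 ≤ A) (i : Fin n) {m : ℝ} (hm : |m| ≤ 1)
    {y : EuclideanSpace ℝ (Fin n)} (hy : ‖y‖ ≤ 1) (hyi : m ≤ y i) {t : ℝ} (ht : 0 < t)
    (htt₁ : t₁ ≤ t) (htt₂ : t ≤ t₂) :
    V (y, t) - V (reflMap i m y, t) ≤
      2 * M * ‖y‖ ^ 2 + A * (4 * (y i - m) - (y i - m) ^ 2) + h t := by
  obtain ⟨p', hp'⟩ := exists_puncture i m p
  set ψ : Pt n → ℝ := fun Y =>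
    2 * M * ‖Y.1‖ ^ 2 + A * (4 * (Y.1 i - m) - (Y.1 i - m) ^ 2) + h Y.2 with hψ
  set F : Pt n → ℝ := fun Y => (V Y - V (reflMap i m Y.1, Y.2)) - ψ Y with hF
  set K : Set (Pt n) := {Y | ‖Y.1‖ ≤ 1 ∧ m ≤ Y.1 i ∧ t₁ ≤ Y.2 ∧ Y.2 ≤ t₂} with hK
  have hcoord : Continuous fun Y : Pt n => Y.1 i := by fun_prop
  have hKc : IsCompact K := by
    refine ((isCompact_closedBall (0 : EuclideanSpace ℝ (Fin n)) 1).prod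
      (isCompact_Icc (a := t₁) (b := t₂))).of_isClosed_subset ?_ ?_
    · refine IsClosed.inter (isClosed_le continuous_fst.norm continuous_const) (IsClosed.inter
        (isClosed_le continuous_const hcoord) (IsClosed.inter
        (isClosed_le continuous_const continuous_snd)
        (isClosed_le continuous_snd continuous_const)))
    · rintro Y ⟨h1, _, h3, h4⟩
      exact ⟨by simpa using h1, h3, h4⟩
  have habs : ∀ Y ∈ K, |Y.2 - T| ≤ 1 := fun Y hY => by
    rw [abs_le]; constructor <;> linarith [hY.2.2.1, hY.2.2.2]
  have hpY : ∀ Y ∈ K, Y ≠ (p', 0) → Y ≠ (p, 0) ∧ ((reflMap i m Y.1, Y.2) : Pt n) ≠ (p, 0) := by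
    intro Y hY hYp
    by_cases h0 : Y.2 = 0
    · have : Y.1 ≠ p' := fun h1 => hYp (Prod.ext h1 h0)
      obtain ⟨h1, h2⟩ := hp' Y.1 hY.2.1 this
      exact ⟨fun h3 => h1 (congrArg Prod.fst h3), fun h3 => h2 (congrArg Prod.fst h3)⟩
    · exact ⟨fun h3 => h0 (congrArg Prod.snd h3), fun h3 => h0 (congrArg Prod.snd h3)⟩
  have h0K : ∀ Y ∈ K, 0 ≤ Y.2 := fun Y hY => ht₁.trans hY.2.2.1
  have hD : ∀ Y ∈ K, Y ≠ (p', 0) → V Y - V (reflMap i m Y.1, Y.2) ≤ 2 * M := by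
    intro Y hY hYp
    obtain ⟨h1, h2⟩ := hpY Y hY hYp
    have e1 := hV.bound Y (by linarith [hY.1]) (h0K Y hY) (habs Y hY) h1
    have e2 := hV.bound (reflMap i m Y.1, Y.2) (norm_reflMap_le i m _ hm hY.1) (h0K Y hY)
      (habs Y hY) h2
    rw [abs_le] at e1 e2
    linarith
  have hξ : ∀ Y ∈ K, 0 ≤ 4 * (Y.1 i - m) - (Y.1 i - m) ^ 2 := by
    intro Y hY
    have h1 := (abs_le.1 ((abs_apply_le_norm Y.1 i).trans hY.1)).2
    have h2 := (abs_le.1 hm).1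
    nlinarith [hY.2.1]
  have hψ0 : ∀ Y ∈ K, 0 ≤ ψ Y := fun Y hY => by
    have := mul_nonneg hA0 (hξ Y hY)
    have := hh0 Y.2 hY.2.2.1 hY.2.2.2
    simp only [hψ]; positivity
  have hres := nonpos_of_subAt hn hσ hKc p' (F := F) (M := 2 * M) ?_ ?_ ?_ (y, t)
    ⟨hy, hyi, htt₁, htt₂⟩ (fun h1 => ht.ne' (congrArg Prod.snd h1))
  · simp only [hF, hψ] at hres; linarith
  · refine (ContinuousOn.sub ?_ ?_).sub ?_
    · exact hV.cont.mono fun Y hY => ⟨⟨by linarith [hY.1.1], h0K Y hY.1, habs Y hY.1⟩,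
        (hpY Y hY.1 hY.2).1⟩
    · refine hV.cont.comp (f := fun Y : Pt n => (reflMap i m Y.1, Y.2)) ?_ ?_
      · have : Continuous fun Y : Pt n => ((reflMap i m Y.1, Y.2) : Pt n) := by
          unfold reflMap; fun_prop
        exact this.continuousOn
      · exact fun Y hY => ⟨⟨norm_reflMap_le i m _ hm hY.1.1, h0K Y hY.1, habs Y hY.1⟩,
          (hpY Y hY.1 hY.2).2⟩
    · have : Continuous ψ := by simp only [hψ]; fun_prop
      exact this.continuousOn
  · intro Y hY hYp
    have := hD Y hY hYp
    have := hψ0 Y hY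
    simp only [hF]; linarith
  · intro Y hY hYp
    have hd := hD Y hY hYp
    have hh := hh0 Y.2 hY.2.2.1 hY.2.2.2
    have hAξ := mul_nonneg hA0 (hξ Y hY)
    have hMx : 0 ≤ 2 * M * ‖Y.1‖ ^ 2 := by positivity
    by_cases c1 : Y.1 i = m
    · left
      have hr : reflMap i m Y.1 = Y.1 := by rw [reflMap, c1]; simp
      have := hψ0 Y hY
      simp only [hF, hr]; linarith
    by_cases c2 : ‖Y.1‖ = 1
    · left
      simp only [hF, hψ]
      rw [c2] at hMx ⊢
      linarith
    by_cases c3 : Y.2 = t₂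
    · left
      have : 2 * M ≤ h Y.2 := by rw [c3]; exact hh2
      simp only [hF, hψ]; linarith
    have c1' := lt_of_le_of_ne hY.2.1 (Ne.symm c1)
    have c2' := lt_of_le_of_ne hY.1 c2
    have c3' := lt_of_le_of_ne hY.2.2.2 c3
    have hop : ∀ᶠ Z in 𝓝 Y, ‖Z.1‖ < 1 ∧ m < Z.1 i ∧ Z.2 < t₂ := by
      refine (IsOpen.eventually_mem (isOpen_lt continuous_fst.norm continuous_const) c2').and
        ((IsOpen.eventually_mem (isOpen_lt continuous_const hcoord) c1').and
        (IsOpen.eventually_mem (isOpen_lt continuous_snd continuous_const) c3'))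
    rcases eq_or_lt_of_le hY.2.2.1 with c4 | c4
    · rcases eq_or_lt_of_le ht₁ with c5 | c5
      · right; right
        have h0 : Y.2 = 0 := by rw [← c4, ← c5]
        have hT1 := hT c5.symm
        have hx : Y.1 ≠ p' := fun h1 => hYp (Prod.ext h1 h0)
        obtain ⟨h1, h2⟩ := hp' Y.1 hY.2.1 hx
        have n1 := norm_reflMap_le i m _ hm hY.1
        have N1 := hV.hasN hT1 Y.1 (by linarith) h1
        have N2 := (hV.hasN hT1 _ n1 h2).comp_refl
        have N3 : HasN σ (fun Y : Pt n => ‖Y.1‖ ^ 2) Y.1 0 :=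
          hasN_of_fst (φ := fun x => ‖x‖ ^ 2) ((contDiff_norm_sq ℝ (n := 1)).differentiable
            (by norm_num)) _
        have N4 : HasN σ (fun Y : Pt n => 4 * (Y.1 i - m) - (Y.1 i - m) ^ 2) Y.1 0 :=
          hasN_of_fst (φ := fun x => 4 * (x i - m) - (x i - m) ^ 2) (by fun_prop) _
        refine ⟨h0, ?_, _, ?_, (N1.sub N2).sub (((N3.const_mul (2 * M)).add
          (N4.const_mul A)).add (hN c5.symm Y.1))⟩
        · have hc : Tendsto (fun s : ℝ => ((Y.1, s) : Pt n)) (𝓝[>] 0) (𝓝 Y) := by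
            have : Tendsto (fun s : ℝ => ((Y.1, s) : Pt n)) (𝓝 0) (𝓝 (Y.1, 0)) :=
              (by fun_prop : Continuous fun s : ℝ => ((Y.1, s) : Pt n)).tendsto 0
            rw [← h0] at this
            simpa [← h0] using this.mono_left (nhdsWithin_le_nhds (s := Set.Ioi Y.2))
          filter_upwards [hc.eventually hop, self_mem_nhdsWithin] with s hs h3
          have h3 : 0 < s := h3
          exact ⟨hs.1.le, hs.2.1.le, by simp; linarith, hs.2.2.le⟩
        · have e1 := abs_le.1 (hV.source hT1 Y.1 (by linarith) h1)
          have e2 := abs_le.1 (hV.source hT1 _ n1 h2)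
          linarith
      · left
        have : 2 * M ≤ h Y.2 := by rw [← c4]; exact hh1 c5
        simp only [hF, hψ]; linarith
    · right; left
      have hY0 : 0 < Y.2 := ht₁.trans_lt c4
      refine ⟨hY0, ?_, _, ?_, ((hV.hasL Y (by linarith) hY0 (habs Y hY)).sub
        ((hV.hasL (reflMap i m Y.1, Y.2) (norm_reflMap_le i m _ hm hY.1) hY0
          (habs Y hY)).comp_refl)).sub ((((hasL_norm_sq Y).const_mul (2 * M)).add
          ((hasL_coord i m Y).const_mul A)).add (hL Y c4 c3'))⟩
      · filter_upwards [hop, IsOpen.eventually_mem (isOpen_lt continuous_const continuous_snd) c4]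
          with Z hZ h4
        exact ⟨hZ.1.le, hZ.2.1.le, le_of_lt h4, hZ.2.2.le⟩
      · have := hH Y.2 c4 c3'
        nlinarith

end Reflection

section Modulus

variable {n : ℕ} {σ : ℝ}

lemma hasL_rpow {X : Pt n} (hX : 0 < X.2) :
    HasL σ (fun Y : Pt n => Y.2 ^ (2 * σ)) X 0 := by
  have h := hasL_powBlock (n := n) (σ := σ) 0 (m := 2 * σ) 0 (by ring) hX
  have e : powBlock (0 : EuclideanSpace ℝ (Fin n)) (2 * σ) 0 = fun Y : Pt n => Y.2 ^ (2 * σ) := by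
    funext Y; simp [powBlock]
  rw [e] at h
  simpa using h

lemma hasN_rpow (hσ : 0 < σ) (x : EuclideanSpace ℝ (Fin n)) :
    HasN σ (fun Y : Pt n => Y.2 ^ (2 * σ)) x (2 * σ) := by
  refine hasN_of_hasDerivAt (k1 := fun t => 2 * σ * t ^ (2 * σ - 1))
    (fun t ht => ?_) ?_ (fun t ht => Real.hasDerivAt_rpow_const (Or.inl ht.ne')) ?_
  · exact DifferentiableAt.rpow_const (by fun_prop) (Or.inl ht.ne')
  · exact (Real.continuousAt_rpow_const _ _ (Or.inr (by linarith))).continuousWithinAt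
  · refine tendsto_const_nhds.congr' ?_
    filter_upwards [self_mem_nhdsWithin] with t ht
    have ht : 0 < t := ht
    have e1 : t ^ (1 - 2 * σ) * t ^ (2 * σ - 1) = 1 := by
      rw [← Real.rpow_add ht]; simp
    linear_combination (-(2 * σ)) * e1

lemma exists_rpow_le {K ε : ℝ} (hσ : 0 < σ) (hε : 0 < ε) :
    ∃ s : ℝ, 0 < s ∧ s ≤ 1 ∧ K * s ^ (2 * σ) ≤ ε := by
  have h1 := (tendsto_rpow_zero (e := 2 * σ) (by linarith)).const_mul K
  rw [mul_zero] at h1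
  have h2 := (h1.eventually (gt_mem_nhds hε)).and (Ioc_mem_nhdsGT (zero_lt_one' ℝ))
  obtain ⟨s, hs, hs1⟩ := h2.exists
  exact ⟨s, hs1.1, hs1.2, hs.le⟩

/-- The reflection estimate at low heights. -/
lemma SlabSol.sub_refl_le_low (hn : 2 ≤ n) (hσ : σ ∈ Set.Ioo (0 : ℝ) 1) {M F₀ T : ℝ} {V : Pt n → ℝ}
    {p : EuclideanSpace ℝ (Fin n)} {f : EuclideanSpace ℝ (Fin n) → ℝ}
    (hV : SlabSol σ M F₀ T V p f) (hM : 0 ≤ M) {K t₂ η A : ℝ} (hT : 0 < T) (hTt₂ : T ≤ t₂)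
    (ht₂ : t₂ ≤ 1) (hK0 : 0 < K) (hK : 2 * F₀ < K * (2 * σ)) (ht₂K : K * t₂ ^ (2 * σ) ≤ η)
    (hA : 2 * n * M + 4 * (M / t₂ ^ 2) < A) (i : Fin n) {m : ℝ} (hm : |m| ≤ 1)
    {y : EuclideanSpace ℝ (Fin n)} (hy : ‖y‖ ≤ 1) (hyi : m ≤ y i) :
    V (y, T) - V (reflMap i m y, T) ≤ 2 * M * ‖y‖ ^ 2 + A * (4 * (y i - m) - (y i - m) ^ 2) +
      (η + 2 * (M / t₂ ^ 2) * T ^ 2) := by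
  obtain ⟨hσ0, hσ1⟩ := hσ
  have ht₂0 : 0 < t₂ := hT.trans_le hTt₂
  have hb2 : 0 ≤ M / t₂ ^ 2 := by positivity
  have hb3 : 0 ≤ 2 * (n : ℝ) * M := by positivity
  have hmono : ∀ t, 0 ≤ t → t ≤ t₂ → K * t ^ (2 * σ) ≤ η := fun t h0 h1 =>
    (mul_le_mul_of_nonneg_left (Real.rpow_le_rpow h0 h1 (by linarith)) hK0.le).trans ht₂K
  have hcont : Continuous fun t : ℝ => η - K * t ^ (2 * σ) + 2 * (M / t₂ ^ 2) * t ^ 2 := by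
    have : Continuous fun t : ℝ => t ^ (2 * σ) := Real.continuous_rpow_const (by linarith)
    fun_prop
  have hL : ∀ X : Pt n, 0 < X.2 → X.2 < t₂ →
      HasL σ (fun Y : Pt n => η - K * Y.2 ^ (2 * σ) + 2 * (M / t₂ ^ 2) * Y.2 ^ 2) X
        (2 * (M / t₂ ^ 2) * (4 - 4 * σ)) := by
    intro X h0 _
    have h1 := ((hasL_const (X := X) (σ := σ) η).sub ((hasL_rpow h0).const_mul K)).add
      ((hasL_sq_sub (σ := σ) 0 X).const_mul (2 * (M / t₂ ^ 2)))
    simp only [sub_zero] at h1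
    have e : 2 + (1 - 2 * σ) / X.2 * (2 * X.2) = 4 - 4 * σ := by
      have := h0.ne'
      field_simp
      ring
    rw [e, mul_zero, sub_zero, zero_add] at h1
    exact h1
  have hN : ∀ x, HasN σ (fun Y : Pt n => η - K * Y.2 ^ (2 * σ) + 2 * (M / t₂ ^ 2) * Y.2 ^ 2) x
      (-(K * (2 * σ))) := by
    intro x
    have h1 := ((hasN_const (x := x) (σ := σ) η).sub ((hasN_rpow hσ0 x).const_mul K)).add
      ((hasN_sq hσ1 x).const_mul (2 * (M / t₂ ^ 2)))
    rwa [mul_zero, add_zero, zero_sub] at h1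
  have h := hV.sub_refl_le hn ⟨hσ0, hσ1⟩ hM le_rfl (t₁ := 0) (t₂ := t₂) (by linarith)
    (by linarith) (fun _ => by linarith) (lh := fun _ => 2 * (M / t₂ ^ 2) * (4 - 4 * σ))
    (H := 8 * (M / t₂ ^ 2)) (A := A) hcont ?_ (fun h0 => absurd h0 (lt_irrefl _)) ?_ hL ?_
    (fun _ => hN) hK (by linarith) (by linarith) i hm hy hyi hT hT.le hTt₂
  · have h1 : 0 < K * T ^ (2 * σ) := mul_pos hK0 (Real.rpow_pos_of_pos hT _)
    linarith
  · intro t h0 h1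
    have := hmono t h0 h1
    have : 0 ≤ 2 * (M / t₂ ^ 2) * t ^ 2 := by positivity
    linarith
  · have e : 2 * (M / t₂ ^ 2) * t₂ ^ 2 = 2 * M := by field_simp
    rw [e]; linarith
  · intro t _ _
    nlinarith

/-- The reflection estimate at heights away from zero. -/
lemma SlabSol.sub_refl_le_high (hn : 2 ≤ n) (hσ : σ ∈ Set.Ioo (0 : ℝ) 1) {M F₀ T : ℝ}
    {V : Pt n → ℝ} {p : EuclideanSpace ℝ (Fin n)} {f : EuclideanSpace ℝ (Fin n) → ℝ}
    (hV : SlabSol σ M F₀ T V p f) (hM : 0 ≤ M) {T₁ A : ℝ} (hT₁ : 0 < T₁) (hTT : T₁ < T)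
    (hT₁1 : T₁ ≤ 1) (hA : 2 * n * M + 16 * (M / T₁ ^ 2) < A) (i : Fin n) {m : ℝ} (hm : |m| ≤ 1)
    {y : EuclideanSpace ℝ (Fin n)} (hy : ‖y‖ ≤ 1) (hyi : m ≤ y i) :
    V (y, T) - V (reflMap i m y, T) ≤
      2 * M * ‖y‖ ^ 2 + A * (4 * (y i - m) - (y i - m) ^ 2) := by
  obtain ⟨hσ0, hσ1⟩ := hσ
  have hb1 : 0 ≤ M / T₁ ^ 2 := by positivity
  have hb3 : 0 ≤ 2 * (n : ℝ) * M := by positivity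
  have e : 8 * (M / T₁ ^ 2) * (T₁ / 2) ^ 2 = 2 * M := by field_simp; ring
  have h := hV.sub_refl_le hn ⟨hσ0, hσ1⟩ hM (t₁ := T - T₁ / 2) (t₂ := T + T₁ / 2) (by linarith)
    (by linarith) (by linarith) (fun _ => by linarith)
    (h := fun t => 8 * (M / T₁ ^ 2) * (t - T) ^ 2)
    (lh := fun t => 8 * (M / T₁ ^ 2) * (2 + (1 - 2 * σ) / t * (2 * (t - T))))
    (H := 32 * (M / T₁ ^ 2)) (κ := 2 * F₀ + 1) (A := A) (by fun_prop)
    (fun t _ _ => by positivity) (fun _ => ?_) ?_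
    (fun X _ _ => (hasL_sq_sub (σ := σ) T X).const_mul (8 * (M / T₁ ^ 2))) ?_
    (fun h0 => by linarith) (by linarith) (by linarith) (by linarith) i hm hy hyi
    (t := T) (by linarith) (by linarith) (by linarith)
  · simpa using h
  · rw [show T - T₁ / 2 - T = -(T₁ / 2) by ring, neg_sq, e]
  · rw [show T + T₁ / 2 - T = T₁ / 2 by ring, e]
  · intro t h1 h2
    have ht : 0 < t := by linarith
    have h3 : (1 - 2 * σ) / t * (2 * (t - T)) ≤ 2 := by
      rw [div_mul_eq_mul_div, div_le_iff₀ ht]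
      nlinarith
    nlinarith

lemma exists_sub_refl_le (hn : 2 ≤ n) (hσ : σ ∈ Set.Ioo (0 : ℝ) 1) {M F₀ δ : ℝ} (hM : 0 ≤ M)
    (hF₀ : 0 ≤ F₀) (hδ : 0 < δ) : ∃ ρ : ℝ, 0 < ρ ∧ ρ < 1 ∧ ∀ T : ℝ, 0 < T →
      ∀ (V : Pt n → ℝ) (p : EuclideanSpace ℝ (Fin n)) (f : EuclideanSpace ℝ (Fin n) → ℝ),
      SlabSol σ M F₀ T V p f → ∀ (i : Fin n) (m : ℝ) (y : EuclideanSpace ℝ (Fin n)),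
      |m| ≤ ρ → ‖y‖ ≤ ρ → m ≤ y i → V (y, T) - V (reflMap i m y, T) ≤ δ := by
  have hσ0 := hσ.1
  obtain ⟨K, hK0, hK⟩ : ∃ K : ℝ, 0 < K ∧ 2 * F₀ < K * (2 * σ) := by
    refine ⟨(2 * F₀ + 1) / (2 * σ), by positivity, ?_⟩
    rw [div_mul_cancel₀ _ (by positivity)]; linarith
  obtain ⟨t₂, ht₂, ht₂1, ht₂K⟩ := exists_rpow_le (K := K) hσ0 (show 0 < δ / 4 by positivity)
  obtain ⟨θ, hθ, hθ1, hθM⟩ : ∃ θ : ℝ, 0 < θ ∧ θ ≤ 1 ∧ 2 * M * θ ^ 2 ≤ δ / 4 := by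
    have h1 : (δ / 4) / (2 * M + δ / 4) ≤ 1 := by
      rw [div_le_one (by positivity)]; linarith
    have h0 : 0 < (δ / 4) / (2 * M + δ / 4) := by positivity
    have h2 : (2 * M + δ / 4) * ((δ / 4) / (2 * M + δ / 4)) = δ / 4 := by field_simp
    refine ⟨_, h0, h1, ?_⟩
    have h3 : ((δ / 4) / (2 * M + δ / 4)) ^ 2 ≤ (δ / 4) / (2 * M + δ / 4) := by
      rw [sq]; exact mul_le_of_le_one_left h0.le h1
    have := mul_le_mul_of_nonneg_left h3 (by positivity : 0 ≤ 2 * M)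
    nlinarith [mul_pos hδ h0]
  have hT₁ : 0 < θ * t₂ := by positivity
  have hT₁1 : θ * t₂ ≤ t₂ := mul_le_of_le_one_left ht₂.le hθ1
  have hb1 : 0 ≤ M / (θ * t₂) ^ 2 := by positivity
  have hb2 : 0 ≤ M / t₂ ^ 2 := by positivity
  have hb3 : 0 ≤ 2 * (n : ℝ) * M := by positivity
  set A : ℝ := 2 * n * M + 16 * (M / (θ * t₂) ^ 2) + 4 * (M / t₂ ^ 2) + 1 with hA
  have hA1 : 1 ≤ A := by linarith
  obtain ⟨ρ, hρ, hρ1, hρA⟩ : ∃ ρ : ℝ, 0 < ρ ∧ ρ < 1 ∧ (2 * M + 8 * A) * ρ ≤ δ / 2 := by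
    have h0 : 0 < 2 * M + 8 * A := by positivity
    refine ⟨min (1 / 2) ((δ / 2) / (2 * M + 8 * A)), by positivity,
      (min_le_left _ _).trans_lt (by norm_num), ?_⟩
    calc (2 * M + 8 * A) * min (1 / 2) ((δ / 2) / (2 * M + 8 * A))
        ≤ (2 * M + 8 * A) * ((δ / 2) / (2 * M + 8 * A)) := by gcongr; exact min_le_right _ _
      _ = δ / 2 := by field_simp
  refine ⟨ρ, hρ, hρ1, fun T hT V p f hV i m y hm hy hmy => ?_⟩
  suffices hs : V (y, T) - V (reflMap i m y, T) ≤
      2 * M * ‖y‖ ^ 2 + A * (4 * (y i - m) - (y i - m) ^ 2) + δ / 2 by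
    have h1 : ‖y‖ ^ 2 ≤ ρ := by nlinarith [norm_nonneg y]
    have h2 : 4 * (y i - m) - (y i - m) ^ 2 ≤ 8 * ρ := by
      have := (abs_le.1 ((abs_apply_le_norm y i).trans hy)).2
      have := (abs_le.1 hm).1
      nlinarith [sq_nonneg (y i - m)]
    have h3 : 2 * M * ‖y‖ ^ 2 ≤ 2 * M * ρ := by gcongr
    have h4 := mul_le_mul_of_nonneg_left h2 (by linarith : 0 ≤ A)
    linarith
  rcases le_or_gt T (θ * t₂) with hTT | hTT
  · have h := hV.sub_refl_le_low hn hσ hM hT (hTT.trans hT₁1) ht₂1 hK0 hK ht₂K (A := A)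
      (by linarith) i (hm.trans hρ1.le) (hy.trans hρ1.le) hmy
    have h2 : 2 * (M / t₂ ^ 2) * T ^ 2 ≤ δ / 4 := by
      refine le_trans ?_ hθM
      calc 2 * (M / t₂ ^ 2) * T ^ 2 ≤ 2 * (M / t₂ ^ 2) * (θ * t₂) ^ 2 := by gcongr
        _ = 2 * M * θ ^ 2 := by field_simp
    linarith
  · have h := hV.sub_refl_le_high hn hσ hM hT₁ hTT (hT₁1.trans ht₂1) (A := A)
      (by linarith) i (hm.trans hρ1.le) (hy.trans hρ1.le) hmy
    linarith

/-- Solutions on slabs have a modulus of continuity in `x` which does not depend on the height. -/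
lemma exists_modulus (hn : 2 ≤ n) (hσ : σ ∈ Set.Ioo (0 : ℝ) 1) {M F₀ δ : ℝ} (hM : 0 ≤ M)
    (hF₀ : 0 ≤ F₀) (hδ : 0 < δ) : ∃ ρ : ℝ, 0 < ρ ∧ ρ < 1 ∧ ∀ T : ℝ, 0 < T →
      ∀ (V : Pt n → ℝ) (p : EuclideanSpace ℝ (Fin n)) (f : EuclideanSpace ℝ (Fin n) → ℝ),
      SlabSol σ M F₀ T V p f → ∀ x x' : EuclideanSpace ℝ (Fin n), ‖x‖ ≤ ρ → ‖x'‖ ≤ ρ →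
      |V (x, T) - V (x', T)| ≤ δ := by
  have hn0 : (0 : ℝ) < n := by exact_mod_cast (by omega : 0 < n)
  obtain ⟨ρ, hρ, hρ1, h⟩ := exists_sub_refl_le hn hσ hM hF₀ (show 0 < δ / (2 * n) by positivity)
  refine ⟨ρ, hρ, hρ1, fun T hT V p f hV => ?_⟩
  have habs : ∀ (i : Fin n) (m : ℝ) (y : EuclideanSpace ℝ (Fin n)), |m| ≤ ρ → ‖y‖ ≤ ρ →
      m ≤ y i → |V (reflMap i m y, T) - V (y, T)| ≤ δ / (2 * n) := by
    intro i m y h1 h2 h3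
    have a := h T hT V p f hV i m y h1 h2 h3
    have b := h T hT _ p _ hV.neg i m y h1 h2 h3
    rw [abs_le]; constructor <;> linarith
  have hstep : ∀ (i : Fin n) (z : EuclideanSpace ℝ (Fin n)) (s : ℝ), ‖z‖ ≤ ρ →
      ‖z + s • EuclideanSpace.single i (1 : ℝ)‖ ≤ ρ →
      |V (z + s • EuclideanSpace.single i (1 : ℝ), T) - V (z, T)| ≤ δ / (2 * n) := by
    intro i z s h1 h2
    set w := z + s • EuclideanSpace.single i (1 : ℝ) with hw
    have hwi : w i = z i + s := by simp [hw]
    have e1 := abs_le.1 ((abs_apply_le_norm z i).trans h1)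
    have e2 := abs_le.1 ((abs_apply_le_norm w i).trans h2)
    have hm : |z i + s / 2| ≤ ρ := by rw [abs_le]; constructor <;> linarith
    rcases le_total s 0 with hs | hs
    · have := habs i (z i + s / 2) z hm h1 (by linarith)
      rwa [reflMap, show 2 * (z i + s / 2 - z i) = s by ring] at this
    · have := habs i (z i + s / 2) w hm h2 (by linarith)
      rw [reflMap, hwi, show 2 * (z i + s / 2 - (z i + s)) = -s by ring, hw, add_assoc,
        ← add_smul, add_neg_cancel, zero_smul, add_zero, abs_sub_comm] at this
      exact this
  have hzero : ∀ x : EuclideanSpace ℝ (Fin n), ‖x‖ ≤ ρ → |V (x, T) - V (0, T)| ≤ δ / 2 := by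
    intro x hx
    set trunc : Finset (Fin n) → EuclideanSpace ℝ (Fin n) := fun s =>
      ∑ i ∈ s, x i • EuclideanSpace.single i (1 : ℝ) with htr
    have happ : ∀ s j, trunc s j = if j ∈ s then x j else 0 := by
      intro s j
      simp [htr, Finset.sum_apply, Pi.single_apply]
    have hnorm : ∀ s, ‖trunc s‖ ≤ ρ := by
      intro s
      refine le_trans ?_ hx
      rw [EuclideanSpace.norm_eq, EuclideanSpace.norm_eq]
      refine Real.sqrt_le_sqrt (Finset.sum_le_sum fun j _ => ?_)
      rw [happ]
      split_ifs
      · exact le_rfl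
      · simp [sq_nonneg]
    have hind : ∀ s : Finset (Fin n), |V (trunc s, T) - V (0, T)| ≤ s.card * (δ / (2 * n)) := by
      intro s
      induction s using Finset.induction_on with
      | empty => simp [htr]
      | insert i s his ih =>
        have he : trunc (insert i s) = trunc s + x i • EuclideanSpace.single i (1 : ℝ) := by
          simp only [htr]; rw [Finset.sum_insert his, add_comm]
        have h1 := hstep i (trunc s) (x i) (hnorm s) (by rw [← he]; exact hnorm _)
        rw [← he] at h1
        rw [Finset.card_insert_of_notMem his]
        push_cast
        have := abs_sub_le (V (trunc (insert i s), T)) (V (trunc s, T)) (V (0, T))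
        linarith
    have hx' : trunc Finset.univ = x := by
      ext j; rw [happ]; simp
    have := hind Finset.univ
    rw [hx', Finset.card_univ, Fintype.card_fin] at this
    refine this.trans (le_of_eq ?_)
    field_simp
  intro x x' hx hx'
  have := hzero x hx
  have h2 := hzero x' hx'
  rw [abs_sub_comm] at h2
  have := abs_sub_le (V (x, T)) (V (0, T)) (V (x', T))
  linarith

end Modulus

/-! ### A lower bound at the boundary from a cone barrier -/

section Cone

variable {n : ℕ} {σ : ℝ}

/-- The radius at height `t` of the region under the ball of radius `δ` at height `t₀`. -/
def coneRad (δ t₀ t : ℝ) : ℝ := δ + (t₀ ^ 2 - t ^ 2) / (8 * t₀)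

/-- The barrier `ζ^a (ζ² - |x - x₀|²)²`, where `ζ` is the radius at height `t`. -/
def coneBarrier (x₀ : EuclideanSpace ℝ (Fin n)) (a δ t₀ : ℝ) (X : Pt n) : ℝ :=
  coneRad δ t₀ X.2 ^ a * (coneRad δ t₀ X.2 ^ 2 - ‖X.1 - x₀‖ ^ 2) ^ 2

lemma coneRad_hasDerivAt {δ t₀ : ℝ} (t : ℝ) :
    HasDerivAt (coneRad δ t₀) (-(2 * t) / (8 * t₀)) t := by
  unfold coneRad
  have h := ((((hasDerivAt_id t).fun_pow 2).const_sub (t₀ ^ 2)).div_const (8 * t₀)).const_add δ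
  exact h.congr_deriv (by simp)

lemma continuous_coneRad (δ t₀ : ℝ) : Continuous (coneRad δ t₀) :=
  continuous_iff_continuousAt.2 fun t => (coneRad_hasDerivAt t).continuousAt

lemma coneBarrier_contDiffAt (x₀ : EuclideanSpace ℝ (Fin n)) (a : ℝ) {δ t₀ : ℝ} {X : Pt n}
    (hζ : 0 < coneRad δ t₀ X.2) : ContDiffAt ℝ 2 (coneBarrier x₀ a δ t₀) X := by
  have h1 : ContDiffAt ℝ 2 (fun X : Pt n => coneRad δ t₀ X.2) X := by
    unfold coneRad
    exact contDiffAt_const.add ((contDiffAt_const.sub (contDiffAt_snd.pow 2)).div_const _)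
  have h2 : ContDiffAt ℝ 2 (fun X : Pt n => ‖X.1 - x₀‖ ^ 2) X :=
    (contDiffAt_fst.sub contDiffAt_const).norm_sq ℝ
  exact (h1.rpow_const_of_ne hζ.ne').mul (((h1.pow 2).sub h2).pow 2)

/-- The derivative of `ζ ↦ ζ^a (ζ² - q)²`. -/
def coneDeriv (a q ζ : ℝ) : ℝ := a * ζ ^ (a - 1) * (ζ ^ 2 - q) ^ 2 + ζ ^ a * (4 * ζ * (ζ ^ 2 - q))

lemma hasDerivAt_coneProfile (a q : ℝ) {ζ : ℝ} (hζ : 0 < ζ) :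
    HasDerivAt (fun ζ : ℝ => ζ ^ a * (ζ ^ 2 - q) ^ 2) (coneDeriv a q ζ) ζ := by
  have h1 : HasDerivAt (fun ζ : ℝ => ζ ^ 2 - q) (2 * ζ) ζ := by
    simpa using ((hasDerivAt_id ζ).fun_pow 2).sub_const q
  refine ((Real.hasDerivAt_rpow_const (p := a) (Or.inl hζ.ne')).mul (h1.fun_pow 2)).congr_deriv ?_
  simp only [coneDeriv]; ring

lemma hasDerivAt_coneDeriv (a q : ℝ) {ζ : ℝ} (hζ : 0 < ζ) :
    HasDerivAt (coneDeriv a q) (ζ ^ a * (a * (a - 1) * (ζ ^ 2 - q) ^ 2 / ζ ^ 2 +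
      (8 * a + 4) * (ζ ^ 2 - q) + 8 * ζ ^ 2)) ζ := by
  have h1 : HasDerivAt (fun ζ : ℝ => ζ ^ 2 - q) (2 * ζ) ζ := by
    simpa using ((hasDerivAt_id ζ).fun_pow 2).sub_const q
  have h2 : HasDerivAt (fun ζ : ℝ => 4 * ζ * (ζ ^ 2 - q))
      (4 * (ζ ^ 2 - q) + 4 * ζ * (2 * ζ)) ζ := by
    simpa using ((hasDerivAt_id ζ).const_mul 4).fun_mul h1
  have h3 := (((Real.hasDerivAt_rpow_const (p := a - 1) (Or.inl hζ.ne')).const_mul a).fun_mul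
    (h1.fun_pow 2)).fun_add
    ((Real.hasDerivAt_rpow_const (p := a) (Or.inl hζ.ne')).fun_mul h2)
  refine h3.congr_deriv ?_
  rw [Real.rpow_sub_one hζ.ne' (a - 1), Real.rpow_sub_one hζ.ne' a]
  have := hζ.ne'
  simp
  field_simp
  ring

lemma hasL_coneBarrier (x₀ : EuclideanSpace ℝ (Fin n)) (a : ℝ) {δ t₀ : ℝ} {X : Pt n}
    (ht₀ : 0 < t₀) (hX : 0 < X.2) {ζ ν : ℝ} (hζ : 0 < ζ) (hζX : ζ = coneRad δ t₀ X.2)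
    (hν : ν * ζ ^ 2 = ζ ^ 2 - ‖X.1 - x₀‖ ^ 2) :
    HasL σ (coneBarrier x₀ a δ t₀) X (ζ ^ a * ζ ^ 2 *
      ((X.2 / (4 * t₀)) ^ 2 * (a * (a - 1) * ν ^ 2 + (8 * a + 4) * ν + 8) +
        (1 - σ) / (2 * t₀) * ζ * (ν * (-a * ν - 4)) + 8 * (1 - ν) - 4 * n * ν)) := by
  set q0 := ‖X.1 - x₀‖ ^ 2 with hq0
  have hζc : 0 < coneRad δ t₀ X.2 := hζX ▸ hζ
  have hq : q0 = ζ ^ 2 - ν * ζ ^ 2 := by linarith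
  have hev : ∀ᶠ t in 𝓝 X.2, 0 < coneRad δ t₀ t :=
    (continuous_coneRad δ t₀).continuousAt.eventually (lt_mem_nhds hζc)
  have key := hasL_radial (σ := σ) (F := coneBarrier x₀ a δ t₀) (z := x₀) (X := X)
    (g := fun q t => coneRad δ t₀ t ^ a * (coneRad δ t₀ t ^ 2 - q) ^ 2)
    (g1 := fun q => ζ ^ a * (-2 * (ζ ^ 2 - q))) (g2 := ζ ^ a * 2)
    (k1 := fun t => coneDeriv a q0 (coneRad δ t₀ t) * (-(2 * t) / (8 * t₀)))
    (k2 := (ζ ^ a * (a * (a - 1) * (ζ ^ 2 - q0) ^ 2 / ζ ^ 2 +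
      (8 * a + 4) * (ζ ^ 2 - q0) + 8 * ζ ^ 2)) * (-(2 * X.2) / (8 * t₀)) * (-(2 * X.2) / (8 * t₀)) +
      coneDeriv a q0 ζ * (-2 / (8 * t₀)))
    (fun Y => rfl) (coneBarrier_contDiffAt x₀ a hζc) ?_ ?_ ?_ ?_
  · convert key using 1
    rw [← hq0, ← hζX, hq]
    unfold coneDeriv
    rw [Real.rpow_sub_one hζ.ne' a]
    generalize ζ ^ a = A
    have := hζ.ne'
    have := ht₀.ne'
    have := hX.ne'
    field_simp
    ring
  · refine Eventually.of_forall fun q => ?_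
    rw [← hζX]
    have h1 : HasDerivAt (fun q : ℝ => ζ ^ 2 - q) (-1) q := (hasDerivAt_id q).const_sub _
    refine ((h1.fun_pow 2).const_mul (ζ ^ a)).congr_deriv ?_
    simp
  · have h1 : HasDerivAt (fun q : ℝ => ζ ^ 2 - q) (-1) q0 := (hasDerivAt_id q0).const_sub _
    refine ((h1.const_mul (-2)).const_mul (ζ ^ a)).congr_deriv ?_
    ring
  · filter_upwards [hev] with t ht
    exact (hasDerivAt_coneProfile a q0 ht).comp t (coneRad_hasDerivAt t)
  · have h1 : HasDerivAt (fun t : ℝ => -(2 * t) / (8 * t₀)) (-2 / (8 * t₀)) X.2 := by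
      simpa using (((hasDerivAt_id X.2).const_mul 2).neg).div_const (8 * t₀)
    have h2 := (hasDerivAt_coneDeriv a q0 hζc).comp X.2 (coneRad_hasDerivAt (δ := δ) (t₀ := t₀) X.2)
    have h3 := h2.mul h1
    rw [← hζX] at h3
    refine h3.congr_deriv ?_
    simp [← hζX]

lemma hasN_coneBarrier (hσ : σ < 1) (x₀ : EuclideanSpace ℝ (Fin n)) (a : ℝ) {δ t₀ : ℝ}
    (hδ : 0 < δ) (ht₀ : 0 < t₀) (x : EuclideanSpace ℝ (Fin n)) :
    HasN σ (coneBarrier x₀ a δ t₀) x 0 := by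
  have h0 : 0 < coneRad δ t₀ 0 := by
    unfold coneRad; rw [zero_pow two_ne_zero, sub_zero]; positivity
  have hev : ∀ᶠ t in 𝓝[>] (0 : ℝ), 0 < coneRad δ t₀ t :=
    ((continuous_coneRad δ t₀).continuousAt.eventually (lt_mem_nhds h0)).filter_mono
      nhdsWithin_le_nhds
  refine hasN_of_eventually_hasDerivAt
    (k1 := fun t => coneDeriv a (‖x - x₀‖ ^ 2) (coneRad δ t₀ t) * (-(2 * t) / (8 * t₀))) ?_ ?_ ?_ ?_
  · filter_upwards [hev] with t ht
    exact (coneBarrier_contDiffAt x₀ a (X := (x, t)) ht).differentiableAt (by norm_num)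
  · have h : ContinuousAt (coneBarrier x₀ a δ t₀) (x, 0) :=
      (coneBarrier_contDiffAt x₀ a (X := (x, 0)) h0).continuousAt
    exact (h.comp (f := fun t : ℝ => ((x, t) : Pt n)) (by fun_prop)).continuousWithinAt
  · filter_upwards [hev] with t ht
    exact (hasDerivAt_coneProfile a (‖x - x₀‖ ^ 2) ht).comp t (coneRad_hasDerivAt t)
  · have h1 : ContinuousAt (fun t => coneDeriv a (‖x - x₀‖ ^ 2) (coneRad δ t₀ t)) 0 :=
      (hasDerivAt_coneDeriv a _ h0).continuousAt.comp (continuous_coneRad δ t₀).continuousAt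
    have h2 := ((tendsto_rpow_zero (e := 2 - 2 * σ) (by linarith)).mul
      (h1.tendsto.mono_left (nhdsWithin_le_nhds (s := Set.Ioi 0)))).mul_const (-2 / (8 * t₀))
    rw [zero_mul, zero_mul] at h2
    refine h2.congr' ?_
    filter_upwards [self_mem_nhdsWithin] with t ht
    have ht : 0 < t := ht
    rw [show 2 - 2 * σ = (1 - 2 * σ) + 1 by ring, Real.rpow_add_one ht.ne']
    ring

lemma cone_quadratic_pos {n N s θ c ν : ℝ} (hn : 2 ≤ n) (hs : 0 < s) (hs1 : s ≤ 1)
    (hN : 1000 * n ^ 3 ≤ N * s) (hθ : 0 ≤ θ) (hθ1 : θ ≤ 1 / 16) (hc : 0 ≤ c) (hc1 : c ≤ 1)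
    (hν : 0 ≤ ν) (hν1 : ν ≤ 1) (h : 1 / 64 ≤ θ ∨ 3 * s / 64 ≤ c) :
    0 < θ * (N * (N + 1) * ν ^ 2 - (8 * N - 4) * ν + 8) + c * (ν * (N * ν - 4)) +
      8 * (1 - ν) - 4 * n * ν := by
  have hn3 : 8 ≤ n ^ 3 := by
    nlinarith [sq_nonneg (n - 2), mul_pos (show 0 < n by linarith) (show 0 < n by linarith)]
  have hN0 : 0 < N := by
    by_contra! h0
    nlinarith [mul_nonneg (neg_nonneg.2 h0) hs.le]
  have hNs : N * s ≤ N := mul_le_of_le_one_right hN0.le hs1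
  have hb : N ^ 2 * ν ^ 2 - 8 * (N * ν) + 8 ≤ N * (N + 1) * ν ^ 2 - (8 * N - 4) * ν + 8 := by
    nlinarith [mul_nonneg hN0.le (sq_nonneg ν)]
  rcases le_or_gt (2 * n * ν) 1 with h1 | h1
  · have hν4 : ν ≤ 1 / 4 := by nlinarith
    have h2 : -8 ≤ N * (N + 1) * ν ^ 2 - (8 * N - 4) * ν + 8 := by
      nlinarith [sq_nonneg (N * ν - 4)]
    have h3 : -(1 / 2) ≤ θ * (N * (N + 1) * ν ^ 2 - (8 * N - 4) * ν + 8) := by nlinarith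
    have h4 : -1 ≤ c * (ν * (N * ν - 4)) := by
      have e1 : -1 ≤ ν * (N * ν - 4) := by nlinarith [mul_nonneg hN0.le (sq_nonneg ν)]
      nlinarith
    linarith
  · have hν0 : 0 < ν := by nlinarith
    have h2 : 500 * n ^ 2 ≤ N * s * ν := by
      have e1 : 1000 * n ^ 3 * ν ≤ N * s * ν := by gcongr
      have e2 : 500 * n ^ 2 * 1 ≤ 500 * n ^ 2 * (2 * n * ν) := by gcongr
      nlinarith
    have h2' : N * s * ν ≤ N * ν := by gcongr
    have hn2 : 4 ≤ n ^ 2 := by nlinarith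
    have hNν : 2000 ≤ N * ν := by linarith
    have h3 : N ^ 2 * ν ^ 2 / 2 ≤ N * (N + 1) * ν ^ 2 - (8 * N - 4) * ν + 8 := by
      refine le_trans ?_ hb
      nlinarith
    have h30 : 0 ≤ N ^ 2 * ν ^ 2 / 2 := by positivity
    have hθ0 : 0 ≤ θ * (N * (N + 1) * ν ^ 2 - (8 * N - 4) * ν + 8) :=
      mul_nonneg hθ (h30.trans h3)
    have hc0 : 0 ≤ ν * (N * ν - 4) := by apply mul_nonneg hν; linarith
    rcases h with h | h
    · have h4 : 1 / 64 * (N ^ 2 * ν ^ 2 / 2) ≤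
          θ * (N * (N + 1) * ν ^ 2 - (8 * N - 4) * ν + 8) :=
        mul_le_mul h h3 h30 hθ
      have h5 : 4 * n * ν < 1 / 64 * (N ^ 2 * ν ^ 2 / 2) := by
        have e1 : N * ν * 2000 ≤ N * ν * (N * ν) := by gcongr
        have e2 : n ≤ N := by nlinarith
        have e3 : n * ν ≤ N * ν := by gcongr
        nlinarith
      have := mul_nonneg hc hc0
      linarith
    · have h4 : 3 * s / 64 * (ν * (N * ν - 4)) ≤ c * (ν * (N * ν - 4)) := by gcongr
      have h5 : 4 * n * ν < 3 * s / 64 * (ν * (N * ν - 4)) := by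
        have e1 : 4 * n < 3 / 64 * (N * s * ν - 4 * s) := by nlinarith
        nlinarith
      linarith

end Cone

section ConeBound

variable {n : ℕ} {σ : ℝ}

lemma le_coneRad {δ t₀ t : ℝ} (ht₀ : 0 < t₀) (ht : 0 ≤ t) (htt : t ≤ t₀) : δ ≤ coneRad δ t₀ t := by
  have : 0 ≤ (t₀ ^ 2 - t ^ 2) / (8 * t₀) := by
    apply div_nonneg _ (by linarith); nlinarith
  unfold coneRad; linarith

lemma coneRad_le {δ t₀ t : ℝ} (ht₀ : 0 < t₀) : coneRad δ t₀ t ≤ δ + t₀ / 8 := by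
  have : (t₀ ^ 2 - t ^ 2) / (8 * t₀) ≤ t₀ / 8 := by
    rw [div_le_iff₀ (by linarith)]; nlinarith [sq_nonneg t]
  unfold coneRad; linarith

lemma exists_hasL_coneBarrier_pos (hn : 2 ≤ n) (hσ : σ ∈ Set.Ioo (0 : ℝ) 1) {N : ℝ}
    (hN : 1000 * (n : ℝ) ^ 3 ≤ N * (1 - σ)) (x₀ : EuclideanSpace ℝ (Fin n)) {δ t₀ : ℝ}
    (hδ : 0 < δ) (hδt : δ ≤ t₀) {X : Pt n} (hX : 0 < X.2) (hXt : X.2 ≤ t₀)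
    (hXx : ‖X.1 - x₀‖ ≤ coneRad δ t₀ X.2) : ∃ l, 0 < l ∧ HasL σ (coneBarrier x₀ (-N) δ t₀) X l := by
  obtain ⟨hσ0, hσ1⟩ := hσ
  have ht₀ : 0 < t₀ := hδ.trans_le hδt
  set ζ := coneRad δ t₀ X.2 with hζ
  have hζδ : δ ≤ ζ := le_coneRad ht₀ hX.le hXt
  have hζ0 : 0 < ζ := hδ.trans_le hζδ
  have hq : ‖X.1 - x₀‖ ^ 2 ≤ ζ ^ 2 := by gcongr
  set ν := (ζ ^ 2 - ‖X.1 - x₀‖ ^ 2) / ζ ^ 2 with hν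
  have hν0 : 0 ≤ ν := div_nonneg (by linarith) (by positivity)
  have hν1 : ν ≤ 1 := by
    rw [hν, div_le_one (by positivity)]; linarith [sq_nonneg ‖X.1 - x₀‖]
  refine ⟨_, ?_, hasL_coneBarrier x₀ (-N) ht₀ hX hζ0 hζ (ν := ν) (by rw [hν]; field_simp)⟩
  have hn' : (2 : ℝ) ≤ n := by exact_mod_cast hn
  have h := cone_quadratic_pos (n := n) (N := N) (s := 1 - σ) (θ := (X.2 / (4 * t₀)) ^ 2)
    (c := (1 - σ) / (2 * t₀) * ζ) (ν := ν) hn' (by linarith) (by linarith) hN (by positivity)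
    ?_ ?_ ?_ hν0 hν1 ?_
  · have h1 : 0 < ζ ^ (-N) * ζ ^ 2 := mul_pos (Real.rpow_pos_of_pos hζ0 _) (by positivity)
    refine mul_pos h1 (lt_of_lt_of_eq h ?_)
    ring
  · have : X.2 / (4 * t₀) ≤ 1 / 4 := by rw [div_le_iff₀ (by positivity)]; linarith
    calc (X.2 / (4 * t₀)) ^ 2 ≤ (1 / 4) ^ 2 := by gcongr
      _ = 1 / 16 := by norm_num
  · have : 0 < 1 - σ := by linarith
    positivity
  · have h1 : ζ ≤ 2 * t₀ := (coneRad_le ht₀).trans (by linarith)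
    rw [div_mul_eq_mul_div, div_le_one (by positivity)]
    nlinarith
  · rcases le_or_gt (t₀ / 2) X.2 with h1 | h1
    · left
      have : 1 / 8 ≤ X.2 / (4 * t₀) := by rw [le_div_iff₀ (by positivity)]; linarith
      calc (1 / 64 : ℝ) = (1 / 8) ^ 2 := by norm_num
        _ ≤ _ := by gcongr
    · right
      have h2 : 3 * t₀ / 32 ≤ ζ := by
        have : 3 * t₀ / 32 ≤ (t₀ ^ 2 - X.2 ^ 2) / (8 * t₀) := by
          rw [le_div_iff₀ (by positivity)]; nlinarith
        rw [hζ, coneRad]; linarith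
      have : 0 < 1 - σ := by linarith
      calc 3 * (1 - σ) / 64 = (1 - σ) / (2 * t₀) * (3 * t₀ / 32) := by field_simp; ring
        _ ≤ _ := by gcongr

/-- A nonnegative supersolution which is at least `m₀` on a disc at height `t₀` is bounded below
at the boundary under this disc. -/
lemma boundary_lower_bound (hn : 2 ≤ n) (hσ : σ ∈ Set.Ioo (0 : ℝ) 1) {N : ℝ}
    (hN : 1000 * (n : ℝ) ^ 3 ≤ N * (1 - σ)) {V : Pt n → ℝ} {f : EuclideanSpace ℝ (Fin n) → ℝ}
    {x₀ p : EuclideanSpace ℝ (Fin n)} {δ t₀ m₀ : ℝ} (hδ : 0 < δ) (hδt : δ ≤ t₀) (hm₀ : 0 < m₀)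
    (hVc : ContinuousOn V ({X | ‖X.1 - x₀‖ ≤ 2 * t₀ ∧ 0 ≤ X.2 ∧ X.2 ≤ t₀} \ {(p, 0)}))
    (hV0 : ∀ X : Pt n, ‖X.1 - x₀‖ ≤ 2 * t₀ → 0 ≤ X.2 → X.2 ≤ t₀ → X ≠ (p, 0) → 0 ≤ V X)
    (hL : ∀ X : Pt n, ‖X.1 - x₀‖ ≤ 2 * t₀ → 0 < X.2 → X.2 ≤ t₀ → HasL σ V X 0)
    (hNV : ∀ x, ‖x - x₀‖ ≤ 2 * t₀ → x ≠ p → HasN σ V x (-f x))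
    (hf : ∀ x, ‖x - x₀‖ ≤ 2 * t₀ → x ≠ p → 0 ≤ f x)
    (hm : ∀ x, ‖x - x₀‖ ≤ δ → m₀ ≤ V (x, t₀)) {x : EuclideanSpace ℝ (Fin n)} (hxp : x ≠ p)
    (hx : ‖x - x₀‖ ≤ (δ + t₀ / 8) / 2) :
    m₀ * (9 / 16) * (δ / (δ + t₀ / 8)) ^ (N - 4) ≤ V (x, 0) := by
  have ht₀ : 0 < t₀ := hδ.trans_le hδt
  have hn' : (2 : ℝ) ≤ n := by exact_mod_cast hn
  have hN4 : 4 ≤ N := by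
    have h1 : (1 : ℝ) ≤ (n : ℝ) ^ 3 := one_le_pow₀ (by linarith)
    by_contra! h2
    have := hσ.1
    have := hσ.2
    nlinarith
  set φ := coneBarrier x₀ (-N) δ t₀ with hφ
  set c : ℝ := m₀ * δ ^ (N - 4) with hc
  have hδN : 0 < δ ^ (N - 4) := Real.rpow_pos_of_pos hδ _
  have hc0 : 0 < c := by positivity
  set K : Set (Pt n) := {X | ‖X.1 - x₀‖ ≤ coneRad δ t₀ X.2 ∧ 0 ≤ X.2 ∧ X.2 ≤ t₀} with hK
  have hradc : Continuous fun X : Pt n => coneRad δ t₀ X.2 :=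
    (continuous_coneRad δ t₀).comp continuous_snd
  have hnormc : Continuous fun X : Pt n => ‖X.1 - x₀‖ := by fun_prop
  have hK2 : ∀ X ∈ K, ‖X.1 - x₀‖ ≤ 2 * t₀ := fun X hX =>
    hX.1.trans ((coneRad_le ht₀).trans (by linarith))
  have hKc : IsCompact K := by
    refine ((isCompact_closedBall x₀ (2 * t₀)).prod
      (isCompact_Icc (a := (0 : ℝ)) (b := t₀))).of_isClosed_subset ?_ ?_
    · exact IsClosed.inter (isClosed_le hnormc hradc) (IsClosed.inter
        (isClosed_le continuous_const continuous_snd) (isClosed_le continuous_snd continuous_const))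
    · intro X hX
      exact ⟨by simpa [dist_eq_norm] using hK2 X hX, hX.2.1, hX.2.2⟩
  have hζ : ∀ X ∈ K, δ ≤ coneRad δ t₀ X.2 := fun X hX => le_coneRad ht₀ hX.2.1 hX.2.2
  have hcφ : ∀ X ∈ K, c * φ X ≤ m₀ := by
    intro X hX
    have h1 := hζ X hX
    set ζ := coneRad δ t₀ X.2 with hζd
    have hζ0 : 0 < ζ := hδ.trans_le h1
    have hq : ‖X.1 - x₀‖ ^ 2 ≤ ζ ^ 2 := pow_le_pow_left₀ (norm_nonneg _) hX.1 2
    have h2 : φ X ≤ ζ ^ (-N) * (ζ ^ 2) ^ 2 := by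
      have := Real.rpow_pos_of_pos hζ0 (-N)
      rw [hφ, coneBarrier, ← hζd]
      exact mul_le_mul_of_nonneg_left
        (pow_le_pow_left₀ (by linarith) (by linarith [sq_nonneg ‖X.1 - x₀‖]) 2) this.le
    have h3 : ζ ^ (-N) * (ζ ^ 2) ^ 2 = ζ ^ (-(N - 4)) := by
      rw [← pow_mul, ← Real.rpow_natCast, ← Real.rpow_add hζ0]; norm_num; ring_nf
    have h4 : ζ ^ (-(N - 4)) ≤ δ ^ (-(N - 4)) :=
      Real.rpow_le_rpow_of_nonpos hδ h1 (by linarith)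
    have h5 : δ ^ (N - 4) * δ ^ (-(N - 4)) = 1 := by
      rw [← Real.rpow_add hδ]; simp
    calc c * φ X ≤ c * δ ^ (-(N - 4)) := by
          rw [h3] at h2; exact mul_le_mul_of_nonneg_left (h2.trans h4) hc0.le
      _ = m₀ * (δ ^ (N - 4) * δ ^ (-(N - 4))) := by rw [hc]; ring
      _ = m₀ := by rw [h5, mul_one]
  have hεle : ∀ ε : ℝ, 0 < ε → c * φ (x, 0) - ε * t₀ ^ (2 * σ) ≤ V (x, 0) := by
    intro ε hε
    set F : Pt n → ℝ := fun X => (c * φ X - V X) + ε * (X.2 ^ (2 * σ) - t₀ ^ (2 * σ)) with hF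
    have hε0 : ∀ X ∈ K, ε * (X.2 ^ (2 * σ) - t₀ ^ (2 * σ)) ≤ 0 := by
      intro X hX
      have : X.2 ^ (2 * σ) ≤ t₀ ^ (2 * σ) :=
        Real.rpow_le_rpow hX.2.1 hX.2.2 (by linarith [hσ.1])
      exact mul_nonpos_of_nonneg_of_nonpos hε.le (by linarith)
    have hxK : ((x, 0) : Pt n) ∈ K := by
      refine ⟨?_, le_rfl, ht₀.le⟩
      have : coneRad δ t₀ (0 : ℝ) = δ + t₀ / 8 := by
        unfold coneRad; field_simp; ring
      simp only [this]
      linarith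
    have hres := nonpos_of_subAt hn hσ hKc p (F := F) (M := m₀) ?_ ?_ ?_ (x, 0) hxK
      (by simp [hxp])
    · simp only [hF] at hres
      rw [Real.zero_rpow (by linarith [hσ.1])] at hres
      linarith
    · refine (ContinuousOn.sub (continuousOn_const.mul ?_) ?_).add ?_
      · exact fun X hX => (coneBarrier_contDiffAt x₀ (-N)
          (hδ.trans_le (hζ X hX.1))).continuousAt.continuousWithinAt
      · exact hVc.mono fun X hX => ⟨⟨hK2 X hX.1, hX.1.2⟩, hX.2⟩
      · have : Continuous fun X : Pt n => X.2 ^ (2 * σ) :=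
          continuous_snd.rpow_const fun _ => Or.inr (by linarith [hσ.1])
        exact (continuous_const.mul (this.sub continuous_const)).continuousOn
    · intro X hX hXp
      have := hV0 X (hK2 X hX) hX.2.1 hX.2.2 hXp
      have := hcφ X hX
      have := hε0 X hX
      simp only [hF]; linarith
    · intro X hX hXp
      have hVX := hV0 X (hK2 X hX) hX.2.1 hX.2.2 hXp
      have hcX := hcφ X hX
      have hεX := hε0 X hX
      by_cases c1 : ‖X.1 - x₀‖ = coneRad δ t₀ X.2
      · left
        have : φ X = 0 := by rw [hφ, coneBarrier, c1]; ring
        simp only [hF, this]; linarith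
      by_cases c2 : X.2 = t₀
      · left
        have h1 : coneRad δ t₀ t₀ = δ := by simp [coneRad]
        have h2 := hm X.1 (by have := hX.1; rwa [c2, h1] at this)
        rw [← c2] at h2
        simp only [hF]; linarith
      have c1' := lt_of_le_of_ne hX.1 c1
      have c2' := lt_of_le_of_ne hX.2.2 c2
      have hop : ∀ᶠ Z in 𝓝 X, ‖Z.1 - x₀‖ < coneRad δ t₀ Z.2 ∧ Z.2 < t₀ :=
        (IsOpen.eventually_mem (isOpen_lt hnormc hradc) c1').and
          (IsOpen.eventually_mem (isOpen_lt continuous_snd continuous_const) c2')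
      rcases eq_or_lt_of_le hX.2.1 with h0 | h0
      · right; right
        have hx0 : X.1 ≠ p := fun h1 => hXp (Prod.ext h1 h0.symm)
        refine ⟨h0.symm, ?_, _, ?_, (((hasN_coneBarrier hσ.2 x₀ (-N) hδ ht₀ X.1).const_mul c).sub
          (hNV X.1 (hK2 X hX) hx0)).add (((hasN_rpow hσ.1 X.1).sub
          (hasN_const (t₀ ^ (2 * σ)))).const_mul ε)⟩
        · have hc : Tendsto (fun s : ℝ => ((X.1, s) : Pt n)) (𝓝[>] 0) (𝓝 X) := by
            have : Tendsto (fun s : ℝ => ((X.1, s) : Pt n)) (𝓝 0) (𝓝 (X.1, 0)) :=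
              (by fun_prop : Continuous fun s : ℝ => ((X.1, s) : Pt n)).tendsto 0
            rw [h0] at this
            simpa [h0] using this.mono_left (nhdsWithin_le_nhds (s := Set.Ioi X.2))
          filter_upwards [hc.eventually hop, self_mem_nhdsWithin] with s hs h3
          have h3 : 0 < s := h3
          exact ⟨hs.1.le, h3.le, hs.2.le⟩
        · have := hf X.1 (hK2 X hX) hx0
          have := mul_pos hε hσ.1
          linarith
      · right; left
        obtain ⟨l, hl, hLφ⟩ := exists_hasL_coneBarrier_pos hn hσ hN x₀ hδ hδt h0 hX.2.2 hX.1
        refine ⟨h0, ?_, _, ?_, ((hLφ.const_mul c).sub (hL X (hK2 X hX) h0 hX.2.2)).add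
          (((hasL_rpow h0).sub (hasL_const (t₀ ^ (2 * σ)))).const_mul ε)⟩
        · filter_upwards [hop, IsOpen.eventually_mem (isOpen_lt continuous_const continuous_snd) h0]
            with Z hZ h4
          exact ⟨hZ.1.le, le_of_lt h4, hZ.2.le⟩
        · have := mul_pos hc0 hl
          linarith
  have hcV : c * φ (x, 0) ≤ V (x, 0) := by
    refine le_of_forall_pos_le_add fun η hη => ?_
    have ht : 0 < t₀ ^ (2 * σ) := Real.rpow_pos_of_pos ht₀ _
    have := hεle (η / t₀ ^ (2 * σ)) (by positivity)
    rw [div_mul_cancel₀ _ ht.ne'] at this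
    linarith
  refine le_trans ?_ hcV
  set ζ : ℝ := δ + t₀ / 8 with hζd
  have hζ0 : 0 < ζ := by positivity
  have hr : coneRad δ t₀ (0 : ℝ) = ζ := by
    rw [hζd]; unfold coneRad; field_simp; ring
  have h1 : φ (x, 0) = ζ ^ (-N) * (ζ ^ 2 - ‖x - x₀‖ ^ 2) ^ 2 := by
    rw [hφ, coneBarrier]; simp only [hr]
  have h2 : 3 / 4 * ζ ^ 2 ≤ ζ ^ 2 - ‖x - x₀‖ ^ 2 := by
    have : ‖x - x₀‖ ^ 2 ≤ (ζ / 2) ^ 2 := by gcongr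
    linarith
  have h3 : ζ ^ (-N) * (3 / 4 * ζ ^ 2) ^ 2 ≤ φ (x, 0) := by
    rw [h1]
    have := Real.rpow_pos_of_pos hζ0 (-N)
    gcongr
  have h4 : ζ ^ (-N) * (ζ ^ 2) ^ 2 = (ζ ^ (N - 4))⁻¹ := by
    rw [← Real.rpow_neg hζ0.le, ← pow_mul, ← Real.rpow_natCast, ← Real.rpow_add hζ0]
    norm_num; ring_nf
  calc m₀ * (9 / 16) * (δ / ζ) ^ (N - 4) = c * (ζ ^ (-N) * (3 / 4 * ζ ^ 2) ^ 2) := by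
        rw [Real.div_rpow hδ.le hζ0.le, hc,
          show ζ ^ (-N) * (3 / 4 * ζ ^ 2) ^ 2 = 9 / 16 * (ζ ^ (-N) * (ζ ^ 2) ^ 2) by ring, h4]
        ring
    _ ≤ c * φ (x, 0) := by gcongr

end ConeBound

/-! ### Bounds away from the singularity -/

section UnitScale

variable {n : ℕ} {σ : ℝ}

/-- A nonnegative solution of the extension problem on a punctured half-cylinder of size `r`. -/
structure IsSol (σ r : ℝ) (V : Pt n → ℝ) : Prop where
  nonneg : ∀ X : Pt n, ‖X‖ < r → 0 ≤ X.2 → X ≠ 0 → 0 ≤ V X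
  cont : ContinuousOn V ({X | ‖X‖ < r ∧ 0 ≤ X.2} \ {0})
  hasL : ∀ X : Pt n, ‖X‖ < r → 0 < X.2 → HasL σ V X 0
  hasN : ∀ x, ‖x‖ < r → x ≠ 0 →
    HasN σ V x (-(V (x, 0) ^ (((n : ℝ) + 2 * σ) / ((n : ℝ) - 2 * σ))))

lemma norm_mk_zero (x : EuclideanSpace ℝ (Fin n)) : ‖((x, 0) : Pt n)‖ = ‖x‖ := by
  simp [Prod.norm_def]

lemma exists_unit_smul (hn : 2 ≤ n) (x : EuclideanSpace ℝ (Fin n)) :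
    ∃ e : EuclideanSpace ℝ (Fin n), ‖e‖ = 1 ∧ x = ‖x‖ • e := by
  rcases eq_or_ne x 0 with rfl | hx
  · exact ⟨EuclideanSpace.single ⟨0, by omega⟩ 1, by simp, by simp⟩
  · have : ‖x‖ ≠ 0 := norm_ne_zero_iff.2 hx
    exact ⟨‖x‖⁻¹ • x, by rw [norm_smul, norm_inv, norm_norm, inv_mul_cancel₀ this],
      by rw [smul_smul, mul_inv_cancel₀ this, one_smul]⟩

/-- The cutoff distance to the boundary of the shell `1/2 ≤ ‖X‖ ≤ 2`. -/
def shellDist (X : Pt n) : ℝ := min (‖X‖ - 1 / 2) (2 - ‖X‖)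

lemma shellDist_ge (X Y : Pt n) : shellDist X - ‖Y - X‖ ≤ shellDist Y := by
  have h1 := norm_sub_norm_le Y X
  have h2 := norm_sub_norm_le X Y
  rw [norm_sub_rev] at h2
  refine le_min ?_ ?_
  · have := min_le_left (‖X‖ - 1 / 2) (2 - ‖X‖)
    unfold shellDist; linarith
  · have := min_le_right (‖X‖ - 1 / 2) (2 - ‖X‖)
    unfold shellDist; linarith

/-- At a point where the weighted maximum on the shell is attained, the solution is bounded below
on a disc of comparable radius. -/
lemma IsSol.half_le_of_max {k : ℕ} {B ρ : ℝ} (hσ : 0 < σ) (hnσ : 0 < (n : ℝ) - 2 * σ)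
    (hρ : ∀ T : ℝ, 0 < T → ∀ (V : Pt n → ℝ) (p : EuclideanSpace ℝ (Fin n))
      (f : EuclideanSpace ℝ (Fin n) → ℝ),
      SlabSol σ (2 ^ k) (B ^ (((n : ℝ) + 2 * σ) / ((n : ℝ) - 2 * σ))) T V p f →
      ∀ x x' : EuclideanSpace ℝ (Fin n), ‖x‖ ≤ ρ → ‖x'‖ ≤ ρ → |V (x, T) - V (x', T)| ≤ 1 / 2)
    (hρ0 : 0 < ρ) {V : Pt n → ℝ} (hV : IsSol σ 8 V)
    (hVB : ∀ x : EuclideanSpace ℝ (Fin n), 1 / 32 ≤ ‖x‖ → ‖x‖ < 8 → V (x, 0) ≤ B) {X₀ : Pt n}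
    (ht₀ : 0 < X₀.2) (hd : 0 < shellDist X₀) (hV1 : 1 ≤ V X₀)
    (hmax : ∀ X : Pt n, 0 ≤ X.2 → 0 ≤ shellDist X →
      shellDist X ^ k * V X ≤ shellDist X₀ ^ k * V X₀)
    {y : EuclideanSpace ℝ (Fin n)} (hy : ‖y - X₀.1‖ ≤ shellDist X₀ / 20 * ρ) :
    V X₀ / 2 ≤ V (y, X₀.2) := by
  set d := shellDist X₀ with hd0
  set l := d / 20 with hl
  have hl0 : 0 < l := by positivity
  have hdle : d ≤ 3 / 4 := by
    have h1 : d ≤ ‖X₀‖ - 1 / 2 := min_le_left _ _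
    have h2 : d ≤ 2 - ‖X₀‖ := min_le_right _ _
    linarith
  have hM0 : 0 < V X₀ := by linarith
  set T := X₀.2 / l with hT
  have hT0 : 0 < T := by positivity
  have hlT : l * T = X₀.2 := by rw [hT]; field_simp
  -- The rescaled slab stays well inside the shell.
  have hslab : ∀ X : Pt n, ‖X.1‖ ≤ 5 → |X.2 - T| ≤ 1 →
      d / 2 ≤ shellDist (scaleMap X₀.1 l X) := by
    intro X h1 h2
    have h3 : ‖scaleMap X₀.1 l X - X₀‖ ≤ d / 4 := by
      rw [Prod.norm_def]
      refine max_le ?_ ?_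
      · have : (scaleMap X₀.1 l X - X₀).1 = l • X.1 := by simp [scaleMap]
        rw [this, norm_smul, Real.norm_of_nonneg hl0.le]
        calc l * ‖X.1‖ ≤ l * 5 := by gcongr
          _ = d / 4 := by rw [hl]; ring
      · have : (scaleMap X₀.1 l X - X₀).2 = l * (X.2 - T) := by
          rw [mul_sub, hlT]; simp [scaleMap]
        rw [this, norm_mul, Real.norm_of_nonneg hl0.le, Real.norm_eq_abs]
        calc l * |X.2 - T| ≤ l * 1 := by gcongr
          _ ≤ d / 4 := by rw [hl]; linarith
    have := shellDist_ge X₀ (scaleMap X₀.1 l X)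
    linarith
  have hshell : ∀ X : Pt n, 0 < shellDist X → 1 / 2 < ‖X‖ ∧ ‖X‖ < 2 := by
    intro X h
    have h1 := lt_min_iff.1 h
    exact ⟨by linarith [h1.1], by linarith [h1.2]⟩
  have hin : ∀ X : Pt n, ‖X.1‖ ≤ 5 → |X.2 - T| ≤ 1 →
      1 / 2 < ‖scaleMap X₀.1 l X‖ ∧ ‖scaleMap X₀.1 l X‖ < 2 := fun X h1 h2 =>
    hshell _ (by have := hslab X h1 h2; linarith)
  have hin0 : ∀ X : Pt n, ‖X.1‖ ≤ 5 → |X.2 - T| ≤ 1 → scaleMap X₀.1 l X ≠ 0 := by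
    intro X h1 h2 h3
    have := (hin X h1 h2).1
    rw [h3, norm_zero] at this
    linarith
  have hbd : T ≤ 1 → ∀ x : EuclideanSpace ℝ (Fin n), ‖x‖ ≤ 5 →
      1 / 2 < ‖X₀.1 + l • x‖ ∧ ‖X₀.1 + l • x‖ < 2 := by
    intro h1 x hx
    have := hin (x, 0) hx (by rw [zero_sub, abs_neg, abs_of_pos hT0]; exact h1)
    rwa [show scaleMap X₀.1 l (x, 0) = (X₀.1 + l • x, 0) by simp [scaleMap], norm_mk_zero] at this
  set P : ℝ := ((n : ℝ) + 2 * σ) / ((n : ℝ) - 2 * σ) with hP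
  have hP0 : 0 ≤ P := div_nonneg (by linarith) hnσ.le
  have hS : SlabSol σ (2 ^ k) (B ^ P) T (fun X => (V X₀)⁻¹ * V (scaleMap X₀.1 l X)) 0
      (fun x => (V X₀)⁻¹ * (l ^ (2 * σ) * V (X₀.1 + l • x, 0) ^ P)) := by
    refine ⟨?_, ?_, ?_, ?_, ?_⟩
    · refine continuousOn_const.mul (hV.cont.comp (Continuous.continuousOn ?_) ?_)
      · unfold scaleMap; fun_prop
      · rintro X ⟨⟨h1, h2, h3⟩, -⟩
        exact ⟨⟨(hin X h1 h3).2.trans (by norm_num), mul_nonneg hl0.le h2⟩, hin0 X h1 h3⟩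
    · intro X h1 h2 h3 _
      have h4 : 0 ≤ (scaleMap X₀.1 l X).2 := mul_nonneg hl0.le h2
      have h5 := hV.nonneg _ ((hin X h1 h3).2.trans (by norm_num)) h4 (hin0 X h1 h3)
      rw [abs_of_nonneg (by positivity), inv_mul_le_iff₀ hM0]
      have h6 := hslab X h1 h3
      have h7 := hmax _ h4 (by linarith)
      have h8 : (d / 2) ^ k * V (scaleMap X₀.1 l X) ≤ d ^ k * V X₀ := le_trans (by gcongr) h7
      rw [div_pow, div_mul_eq_mul_div, div_le_iff₀ (by positivity)] at h8
      have h9 : 0 < d ^ k := by positivity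
      nlinarith
    · intro X h1 h2 h3
      have := ((hV.hasL _ ((hin X h1 h3).2.trans (by norm_num))
        (mul_pos hl0 h2)).comp_scaleMap hl0).const_mul (V X₀)⁻¹
      simpa using this
    · intro h1 x hx _
      have h2 := hbd h1 x hx
      have := ((hV.hasN _ (h2.2.trans (by norm_num))
        (norm_pos_iff.1 (by linarith))).comp_scaleMap hl0).const_mul (V X₀)⁻¹
      simpa using this
    · intro h1 x hx _
      have h2 := hbd h1 x hx
      have h3 := hVB _ (by linarith) (h2.2.trans (by norm_num))
      have h4 := hV.nonneg (X₀.1 + l • x, 0) (by rw [norm_mk_zero]; linarith) le_rfl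
        (by rw [← norm_pos_iff, norm_mk_zero]; linarith)
      have h5 : 0 ≤ V (X₀.1 + l • x, 0) ^ P := Real.rpow_nonneg h4 _
      have h6 : V (X₀.1 + l • x, 0) ^ P ≤ B ^ P := by gcongr
      have h7 : l ^ (2 * σ) ≤ 1 := Real.rpow_le_one hl0.le (by linarith) (by linarith)
      have h8 : 0 ≤ l ^ (2 * σ) := Real.rpow_nonneg hl0.le _
      rw [abs_of_nonneg (by positivity)]
      calc _ ≤ 1 * (1 * B ^ P) := by
            gcongr
            exact inv_le_one_of_one_le₀ hV1
        _ = B ^ P := by ring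
  have hyl : ‖l⁻¹ • (y - X₀.1)‖ ≤ ρ := by
    rw [norm_smul, norm_inv, Real.norm_of_nonneg hl0.le, inv_mul_le_iff₀ hl0]; exact hy
  have h := (abs_le.1 (hρ T hT0 _ _ _ hS (l⁻¹ • (y - X₀.1)) 0 hyl (by simpa using hρ0.le))).1
  have e1 : scaleMap X₀.1 l (l⁻¹ • (y - X₀.1), T) = (y, X₀.2) := by
    simp [scaleMap, smul_smul, hl0.ne', hlT]
  have e2 : scaleMap X₀.1 l (0, T) = X₀ := by
    simp [scaleMap, hlT]
  simp only [e1, e2] at h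
  rw [inv_mul_cancel₀ hM0.ne'] at h
  have h9 : 1 / 2 ≤ (V X₀)⁻¹ * V (y, X₀.2) := by linarith
  rw [le_inv_mul_iff₀ hM0] at h9
  linarith

/-- A solution bounded on the boundary away from the singularity is bounded on the unit sphere. -/
lemma exists_bound_unit (hn : 2 ≤ n) (hσ : σ ∈ Set.Ioo (0 : ℝ) 1) {B : ℝ} (hB : 0 ≤ B) :
    ∃ C : ℝ, ∀ V : Pt n → ℝ, IsSol σ 8 V →
      (∀ x : EuclideanSpace ℝ (Fin n), 1 / 32 ≤ ‖x‖ → ‖x‖ < 8 → V (x, 0) ≤ B) →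
      ∀ X : Pt n, ‖X‖ = 1 → 0 ≤ X.2 → V X ≤ C := by
  have hσ0 := hσ.1
  have hσ1 := hσ.2
  have hn' : (2 : ℝ) ≤ n := by exact_mod_cast hn
  obtain ⟨k, hk⟩ := exists_nat_ge (1000 * (n : ℝ) ^ 3 / (1 - σ))
  rw [div_le_iff₀ (by linarith)] at hk
  have hk0 : k ≠ 0 := by
    rintro rfl
    have : 0 < (n : ℝ) ^ 3 := by positivity
    norm_num at hk; linarith
  obtain ⟨ρ, hρ, hρ1, hmod⟩ := exists_modulus (M := 2 ^ k) (δ := 1 / 2)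
    (F₀ := B ^ (((n : ℝ) + 2 * σ) / ((n : ℝ) - 2 * σ))) hn hσ (by positivity)
    (Real.rpow_nonneg hB _) (by norm_num)
  refine ⟨2 ^ k * (B + 1 + 32 / 9 * B * (45 / ρ) ^ k), fun V hV hVB X hX hXt => ?_⟩
  set K : Set (Pt n) := {X | (1 / 2 ≤ ‖X‖ ∧ ‖X‖ ≤ 2) ∧ 0 ≤ X.2} with hK
  have hKd : ∀ {X : Pt n}, X ∈ K ↔ 0 ≤ shellDist X ∧ 0 ≤ X.2 := by
    intro X
    simp [hK, shellDist]
  have hKc : IsCompact K := by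
    refine (isCompact_closedBall (0 : Pt n) 2).of_isClosed_subset ?_ ?_
    · exact ((isClosed_le continuous_const continuous_norm).inter
        (isClosed_le continuous_norm continuous_const)).inter
        (isClosed_le continuous_const continuous_snd)
    · intro X hX
      simpa using hX.1.2
  have hK0 : ∀ X ∈ K, X ≠ 0 := by
    rintro X hX rfl
    have := hX.1.1
    rw [norm_zero] at this
    linarith
  have hGc : ContinuousOn (fun X => shellDist X ^ k * V X) K := by
    refine ContinuousOn.mul (Continuous.continuousOn ?_) (hV.cont.mono fun X hX =>
      ⟨⟨by linarith [hX.1.2], hX.2⟩, hK0 X hX⟩)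
    unfold shellDist; fun_prop
  have hXK : X ∈ K := ⟨⟨by rw [hX]; norm_num, by rw [hX]; norm_num⟩, hXt⟩
  obtain ⟨X₀, hX₀, hmax⟩ := hKc.exists_isMaxOn ⟨X, hXK⟩ hGc
  have hX₀d := hKd.1 hX₀
  have hdX : shellDist X = 1 / 2 := by rw [shellDist, hX]; norm_num
  have hfin : V X ≤ 2 ^ k * (shellDist X₀ ^ k * V X₀) := by
    have h1 : shellDist X ^ k * V X ≤ shellDist X₀ ^ k * V X₀ := hmax hXK
    rw [hdX, one_div, inv_pow, inv_mul_le_iff₀ (by positivity)] at h1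
    exact h1
  refine hfin.trans (mul_le_mul_of_nonneg_left ?_ (by positivity))
  have hq : 0 ≤ 32 / 9 * B * (45 / ρ) ^ k := by positivity
  set d := shellDist X₀ with hd
  have hdle : d ≤ 1 := by
    have h1 : d ≤ ‖X₀‖ - 1 / 2 := min_le_left _ _
    have h2 : d ≤ 2 - ‖X₀‖ := min_le_right _ _
    linarith
  have hVX0 : 0 ≤ V X₀ := hV.nonneg _ (by linarith [hX₀.1.2]) hX₀.2 (hK0 _ hX₀)
  have hdk : d ^ k ≤ 1 := pow_le_one₀ hX₀d.1 hdle
  by_cases hc : V X₀ ≤ B + 1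
  · have : d ^ k * V X₀ ≤ 1 * (B + 1) := by gcongr
    linarith
  push Not at hc
  rcases eq_or_lt_of_le hX₀d.1 with h0 | hd0
  · rw [← h0, zero_pow hk0]; linarith
  have hns : ‖X₀‖ = max ‖X₀.1‖ X₀.2 := by
    rw [Prod.norm_def, Real.norm_of_nonneg hX₀.2]
  have ht0 : 0 < X₀.2 := by
    rcases eq_or_lt_of_le hX₀.2 with h0 | h0
    · exfalso
      rw [← h0, max_eq_left (norm_nonneg _)] at hns
      have h1 := hVB X₀.1 (by linarith [hX₀.1.1]) (by linarith [hX₀.1.2])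
      rw [h0] at h1
      linarith
    · exact h0
  have hx2 : ‖X₀.1‖ ≤ 2 := (le_max_left _ _).trans (hns ▸ hX₀.1.2)
  have ht2 : X₀.2 ≤ 2 := (le_max_right _ _).trans (hns ▸ hX₀.1.2)
  have hhalf : ∀ y : EuclideanSpace ℝ (Fin n), ‖y - X₀.1‖ ≤ d / 20 * ρ →
      V X₀ / 2 ≤ V (y, X₀.2) := fun y hy =>
    hV.half_le_of_max hσ0 (by linarith) hmod hρ hVB ht0 hd0 (by linarith)
      (fun Z h1 h2 => hmax (hKd.2 ⟨h2, h1⟩)) hy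
  set δ := min (d / 20 * ρ) X₀.2 with hδ
  have hδ0 : 0 < δ := lt_min (by positivity) ht0
  obtain ⟨e, he, hxe⟩ := exists_unit_smul hn X₀.1
  set x := X₀.1 + (X₀.2 / 16) • e with hx
  have hxn : ‖x‖ = ‖X₀.1‖ + X₀.2 / 16 := by
    have : x = (‖X₀.1‖ + X₀.2 / 16) • e := by rw [hx, add_smul, ← hxe]
    rw [this, norm_smul, he, mul_one, Real.norm_of_nonneg (by positivity)]
  have hx32 : 1 / 32 ≤ ‖x‖ := by
    rw [hxn]
    have h1 : 1 / 2 ≤ max ‖X₀.1‖ X₀.2 := hns ▸ hX₀.1.1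
    rcases le_max_iff.1 h1 with h2 | h2
    · linarith
    · linarith [norm_nonneg X₀.1]
  have hball : ∀ X : Pt n, ‖X.1 - X₀.1‖ ≤ 2 * X₀.2 → 0 ≤ X.2 → X.2 ≤ X₀.2 → ‖X‖ < 8 := by
    intro X h1 h2 h3
    rw [Prod.norm_def]
    refine max_lt ?_ ?_
    · have := norm_sub_norm_le X.1 X₀.1
      linarith
    · rw [Real.norm_of_nonneg h2]; linarith
  have hball' : ∀ x : EuclideanSpace ℝ (Fin n), ‖x - X₀.1‖ ≤ 2 * X₀.2 → ‖x‖ < 8 := by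
    intro x h1
    rw [← norm_mk_zero]
    exact hball (x, 0) h1 le_rfl ht0.le
  have hlow := boundary_lower_bound hn hσ (N := k + 4) (V := V) (x₀ := X₀.1) (p := 0) (δ := δ)
    (t₀ := X₀.2) (m₀ := V X₀ / 2) (x := x) (by nlinarith) hδ0 (min_le_right _ _) (by linarith)
    (hV.cont.mono fun X h => ⟨⟨hball X h.1.1 h.1.2.1 h.1.2.2, h.1.2.1⟩, h.2⟩)
    (fun X h1 h2 h3 h4 => hV.nonneg X (hball X h1 h2 h3) h2 h4)
    (fun X h1 h2 h3 => hV.hasL X (hball X h1 h2.le h3) h2)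
    (fun x h1 h2 => hV.hasN x (hball' x h1) h2)
    (fun x h1 h2 => Real.rpow_nonneg (hV.nonneg (x, 0) (hball (x, 0) h1 le_rfl ht0.le) le_rfl
      (by simpa using h2)) _)
    (fun y hy => hhalf y (hy.trans (min_le_left _ _)))
    (norm_pos_iff.1 (by linarith))
    (by rw [hx, add_sub_cancel_left, norm_smul, he, mul_one, Real.norm_of_nonneg (by positivity)]
        linarith)
  rw [add_sub_cancel_right, Real.rpow_natCast] at hlow
  have hVx := hVB x hx32 (by rw [hxn]; linarith)
  have hratio : d * ρ / 45 ≤ δ / (δ + X₀.2 / 8) := by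
    rw [le_div_iff₀ (by positivity)]
    rcases le_total (d / 20 * ρ) X₀.2 with h1 | h1
    · have : δ = d / 20 * ρ := min_eq_left h1
      have h2 : δ + X₀.2 / 8 ≤ 9 / 4 := by linarith
      have h3 : 0 ≤ d * ρ / 45 := by positivity
      calc d * ρ / 45 * (δ + X₀.2 / 8) ≤ d * ρ / 45 * (9 / 4) := by gcongr
        _ = δ := by rw [this]; ring
    · have : δ = X₀.2 := min_eq_right h1
      rw [this]
      have : d * ρ ≤ 1 := mul_le_one₀ hdle hρ.le hρ1.le
      nlinarith
  have h1 : V X₀ / 2 * (9 / 16) * (d * ρ / 45) ^ k ≤ B := by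
    refine le_trans ?_ (hlow.trans hVx)
    gcongr
  have h2 : d ^ k = (d * ρ / 45) ^ k * (45 / ρ) ^ k := by
    rw [← mul_pow]; congr 1; field_simp
  have h3 : 0 ≤ (45 / ρ) ^ k := by positivity
  calc d ^ k * V X₀ = 32 / 9 * (V X₀ / 2 * (9 / 16) * (d * ρ / 45) ^ k) * (45 / ρ) ^ k := by
        rw [h2]; ring
    _ ≤ 32 / 9 * B * (45 / ρ) ^ k := by gcongr
    _ ≤ _ := by linarith

end UnitScale

/-! ### Comparison with barriers near the singularity -/

section Barriers

variable {n : ℕ} {σ : ℝ}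

/-- A positive strict supersolution of the problem linearised at `V`. -/
structure Barrier (σ r : ℝ) (V Ψ : Pt n → ℝ) : Prop where
  pos : ∀ X : Pt n, ‖X‖ ≤ r → 0 ≤ X.2 → X ≠ 0 → 0 < Ψ X
  cont : ∀ X : Pt n, X ≠ 0 → ContinuousAt Ψ X
  hasL : ∀ X : Pt n, ‖X‖ ≤ r → 0 < X.2 → ∃ l, l < 0 ∧ HasL σ Ψ X l
  hasN : ∀ x : EuclideanSpace ℝ (Fin n), ‖x‖ ≤ r → x ≠ 0 → 0 < V (x, 0) → ∃ l,
    V (x, 0) ^ (((n : ℝ) + 2 * σ) / ((n : ℝ) - 2 * σ)) * Ψ (x, 0) < l * V (x, 0) ∧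
      HasN σ Ψ x (-l)

lemma Barrier.const_mul {r c : ℝ} {V Ψ : Pt n → ℝ} (h : Barrier σ r V Ψ) (hc : 0 < c) :
    Barrier σ r V (fun X => c * Ψ X) where
  pos X h1 h2 h3 := mul_pos hc (h.pos X h1 h2 h3)
  cont X hX := continuousAt_const.mul (h.cont X hX)
  hasL X h1 h2 := by
    obtain ⟨l, hl, hL⟩ := h.hasL X h1 h2
    exact ⟨_, mul_neg_of_pos_of_neg hc hl, hL.const_mul c⟩
  hasN x h1 h2 h3 := by
    obtain ⟨l, hl, hN⟩ := h.hasN x h1 h2 h3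
    refine ⟨c * l, ?_, by simpa using hN.const_mul c⟩
    have := mul_lt_mul_of_pos_left hl hc
    linarith

lemma Barrier.add {r : ℝ} {V Ψ Θ : Pt n → ℝ} (h : Barrier σ r V Ψ) (h' : Barrier σ r V Θ) :
    Barrier σ r V (fun X => Ψ X + Θ X) where
  pos X h1 h2 h3 := add_pos (h.pos X h1 h2 h3) (h'.pos X h1 h2 h3)
  cont X hX := (h.cont X hX).add (h'.cont X hX)
  hasL X h1 h2 := by
    obtain ⟨l, hl, hL⟩ := h.hasL X h1 h2
    obtain ⟨l', hl', hL'⟩ := h'.hasL X h1 h2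
    exact ⟨_, add_neg hl hl', hL.add hL'⟩
  hasN x h1 h2 h3 := by
    obtain ⟨l, hl, hN⟩ := h.hasN x h1 h2 h3
    obtain ⟨l', hl', hN'⟩ := h'.hasN x h1 h2 h3
    refine ⟨l + l', by linarith, ?_⟩
    rw [neg_add]
    exact hN.add hN'

lemma tendsto_vertical (x : EuclideanSpace ℝ (Fin n)) :
    Tendsto (fun t : ℝ => ((x, t) : Pt n)) (𝓝[>] 0) (𝓝 (x, 0)) :=
  ((by fun_prop : Continuous fun t : ℝ => ((x, t) : Pt n)).tendsto 0).mono_left nhdsWithin_le_nhds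

/-- A solution which is negligible against the barrier `Θ` at the origin and below `Φ` on the
outer boundary is below `Φ`, if `Φ` dominates `Θ`. -/
lemma IsSol.le_of_barrier_of_le {r η : ℝ} {V Φ : Pt n → ℝ} (hr : r < 1) (hη0 : 0 < η)
    (hV : IsSol σ 1 V) (hΦ : Barrier σ r V Φ)
    (hout : ∀ X : Pt n, ‖X‖ = r → 0 ≤ X.2 → V X ≤ Φ X)
    (hη : ∀ X : Pt n, ‖X‖ < η → 0 ≤ X.2 → X ≠ 0 → V X ≤ Φ X) {X₀ : Pt n} (hX₀r : ‖X₀‖ ≤ r)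
    (hX₀t : 0 ≤ X₀.2) (hX₀ : X₀ ≠ 0) : V X₀ ≤ Φ X₀ := by
  by_contra! hlt
  set K : Set (Pt n) := {X | (η ≤ ‖X‖ ∧ ‖X‖ ≤ r) ∧ 0 ≤ X.2} with hK
  have hKc : IsCompact K := by
    refine (isCompact_closedBall (0 : Pt n) r).of_isClosed_subset ?_ ?_
    · exact ((isClosed_le continuous_const continuous_norm).inter
        (isClosed_le continuous_norm continuous_const)).inter
        (isClosed_le continuous_const continuous_snd)
    · intro X hX
      simpa using hX.1.2
  have hK0 : ∀ X ∈ K, X ≠ 0 := by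
    rintro X hX rfl
    have := hX.1.1
    rw [norm_zero] at this
    linarith
  have hX₀K : X₀ ∈ K := by
    refine ⟨⟨?_, hX₀r⟩, hX₀t⟩
    by_contra! h
    exact absurd (hη X₀ h hX₀t hX₀) (not_le.2 hlt)
  have hpos : ∀ X ∈ K, 0 < Φ X := fun X hX => hΦ.pos X hX.1.2 hX.2 (hK0 X hX)
  have hqc : ContinuousOn (fun X => V X / Φ X) K :=
    (hV.cont.mono fun X hX => ⟨⟨hX.1.2.trans_lt hr, hX.2⟩, hK0 X hX⟩).div
      (fun X hX => (hΦ.cont X (hK0 X hX)).continuousWithinAt) fun X hX => (hpos X hX).ne'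
  obtain ⟨X₁, hX₁, hmax⟩ := hKc.exists_isMaxOn ⟨X₀, hX₀K⟩ hqc
  set m := V X₁ / Φ X₁ with hm
  have hm1 : 1 < m := lt_of_lt_of_le ((one_lt_div (hpos X₀ hX₀K)).2 hlt) (hmax hX₀K)
  have hVX₁ : V X₁ = m * Φ X₁ := by rw [hm, div_mul_cancel₀ _ (hpos X₁ hX₁).ne']
  have hle : ∀ X : Pt n, ‖X‖ ≤ r → 0 ≤ X.2 → X ≠ 0 → V X - m * Φ X ≤ V X₁ - m * Φ X₁ := by
    intro X h1 h2 h3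
    rw [hVX₁, sub_self, sub_nonpos]
    by_cases h4 : ‖X‖ < η
    · have h5 := hη X h4 h2 h3
      have h6 := hΦ.pos X h1 h2 h3
      nlinarith
    · have h5 : X ∈ K := ⟨⟨not_lt.1 h4, h1⟩, h2⟩
      exact (div_le_iff₀ (hpos X h5)).1 (hmax h5)
  have hX₁r : ‖X₁‖ < r := by
    refine lt_of_le_of_ne hX₁.1.2 fun h => ?_
    have h1 := hout X₁ h hX₁.2
    have h2 := hpos X₁ hX₁
    nlinarith
  have hnb : ∀ᶠ X in 𝓝 X₁, ‖X‖ < r ∧ X ≠ 0 :=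
    (continuous_norm.continuousAt.eventually (gt_mem_nhds hX₁r)).and
      (isOpen_ne.mem_nhds (hK0 X₁ hX₁))
  rcases eq_or_lt_of_le hX₁.2 with h0 | h0
  · obtain ⟨x, t⟩ := X₁
    obtain rfl : 0 = t := h0
    have hx0 : x ≠ 0 := fun h => hK0 _ hX₁ (by rw [h]; rfl)
    have hx1 : ‖x‖ ≤ r := norm_mk_zero x ▸ hX₁.1.2
    have hV0 : 0 < V (x, 0) := by
      rw [hVX₁]; exact mul_pos (by linarith) (hpos _ hX₁)
    obtain ⟨l, hl, hN⟩ := hΦ.hasN x hx1 hx0 hV0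
    have h1 := ((hV.hasN x (by linarith) hx0).sub (hN.const_mul m)).nonpos_of_max (by
      filter_upwards [(tendsto_vertical x).eventually hnb, self_mem_nhdsWithin] with t ht ht0
      exact hle (x, t) ht.1.le (le_of_lt ht0) ht.2)
    have h2 : l * V (x, 0) = l * m * Φ (x, 0) := by rw [hVX₁]; ring
    rw [h2] at hl
    have := lt_of_mul_lt_mul_right hl (hpos _ hX₁).le
    linarith
  · obtain ⟨l, hl, hL⟩ := hΦ.hasL X₁ hX₁.1.2 h0
    have hmaxl : IsLocalMax (fun X => V X - m * Φ X) X₁ := by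
      filter_upwards [hnb, IsOpen.eventually_mem (isOpen_lt continuous_const continuous_snd) h0]
        with X h1 h2
      exact hle X h1.1.le (le_of_lt h2) h1.2
    have h1 := ((hV.hasL X₁ (by linarith) h0).sub (hL.const_mul m)).nonpos_of_isLocalMax hmaxl
    nlinarith

lemma IsSol.le_of_barrier {r : ℝ} {V Ψ Θ : Pt n → ℝ} (hr : r < 1)
    (hV : IsSol σ 1 V) (hΨ : Barrier σ r V Ψ) (hΘ : Barrier σ r V Θ)
    (hout : ∀ X : Pt n, ‖X‖ = r → 0 ≤ X.2 → X ≠ 0 → V X ≤ Ψ X)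
    (hsing : ∀ ε : ℝ, 0 < ε → ∃ η : ℝ, 0 < η ∧
      ∀ X : Pt n, ‖X‖ < η → 0 ≤ X.2 → X ≠ 0 → V X ≤ ε * Θ X) {X₀ : Pt n} (hX₀r : ‖X₀‖ ≤ r)
    (hX₀t : 0 ≤ X₀.2) (hX₀ : X₀ ≠ 0) : V X₀ ≤ Ψ X₀ := by
  have hr0 : 0 < r := (norm_pos_iff.2 hX₀).trans_le hX₀r
  have hΘ0 := hΘ.pos X₀ hX₀r hX₀t hX₀
  refine le_of_forall_pos_le_add fun ε hε => ?_
  obtain ⟨η, hη, h⟩ := hsing (ε / Θ X₀) (by positivity)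
  have hε' : 0 < ε / Θ X₀ := by positivity
  have := hV.le_of_barrier_of_le (η := min η r) hr (lt_min hη hr0)
    (hΨ.add (hΘ.const_mul hε')) ?_ ?_ hX₀r hX₀t hX₀
  · rwa [div_mul_cancel₀ _ hΘ0.ne'] at this
  · intro X h1 h2
    have h3 : X ≠ 0 := norm_pos_iff.1 (by linarith)
    have := hout X h1 h2 h3
    have := mul_pos hε' (hΘ.pos X h1.le h2 h3)
    linarith
  · intro X h1 h2 h3
    have := h X (h1.trans_le (min_le_left _ _)) h2 h3
    have := hΨ.pos X (h1.trans_le (min_le_right _ _)).le h2 h3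
    linarith

lemma normSq_add_sq_bounds (X : Pt n) :
    ‖X‖ ^ 2 ≤ ‖X.1 - 0‖ ^ 2 + X.2 ^ 2 ∧ ‖X.1 - 0‖ ^ 2 + X.2 ^ 2 ≤ 2 * ‖X‖ ^ 2 := by
  rw [sub_zero, Prod.norm_def, ← sq_abs X.2, ← Real.norm_eq_abs]
  have h1 := norm_nonneg X.1
  have h2 := norm_nonneg X.2
  rcases le_total ‖X.1‖ ‖X.2‖ with h | h
  · rw [max_eq_right h]; constructor <;> nlinarith
  · rw [max_eq_left h]; constructor <;> nlinarith

lemma sq_rpow_half (a : ℝ) (b : ℝ) (ha : 0 ≤ a) : (a ^ 2) ^ (b / 2) = a ^ b := by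
  rw [← Real.rpow_natCast, ← Real.rpow_mul ha]; congr 1; push_cast; ring

lemma rpow_snd_le {X : Pt n} (hσ : 0 < σ) (ht : 0 ≤ X.2) :
    X.2 ^ (2 * σ) ≤ (‖X.1 - 0‖ ^ 2 + X.2 ^ 2) ^ σ := by
  rw [← sq_rpow_half _ (2 * σ) ht, mul_div_cancel_left₀ _ two_ne_zero]
  exact Real.rpow_le_rpow (sq_nonneg _) (by linarith [sq_nonneg ‖X.1 - 0‖]) hσ.le

/-- The second block is dominated by the first one. -/
lemma rpow_snd_mul_le {X : Pt n} (hσ : 0 < σ) (ht : 0 ≤ X.2) (hX : X ≠ 0) (b : ℝ) :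
    X.2 ^ (2 * σ) * (‖X.1 - 0‖ ^ 2 + X.2 ^ 2) ^ (b - σ) ≤
      (‖X.1 - 0‖ ^ 2 + X.2 ^ 2) ^ b := by
  have hR : 0 < ‖X.1 - 0‖ ^ 2 + X.2 ^ 2 := normSq_add_sq_pos hX
  calc _ ≤ (‖X.1 - 0‖ ^ 2 + X.2 ^ 2) ^ σ * (‖X.1 - 0‖ ^ 2 + X.2 ^ 2) ^ (b - σ) := by
        gcongr; exact rpow_snd_le hσ ht
    _ = _ := by rw [← Real.rpow_add hR]; congr 1; ring

lemma powBlock_two_mk_zero (hσ : 0 < σ) (b : ℝ) (x : EuclideanSpace ℝ (Fin n)) :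
    powBlock 0 (2 * σ) b (x, 0) = 0 := by
  simp [powBlock, hσ.ne']

lemma exists_barrier (hσ : σ ∈ Set.Ioo (0 : ℝ) 1) {β : ℝ} (hβ : 0 < β)
    (hβn : β < (n : ℝ) - 2 * σ) : ∃ κ c : ℝ, 0 < κ ∧ 0 < c ∧ ∃ Φ : Pt n → ℝ,
      (∀ X : Pt n, 0 ≤ X.2 → X ≠ 0 → c * ‖X‖ ^ (-β) ≤ Φ X ∧ Φ X ≤ ‖X‖ ^ (-β)) ∧
      ∀ (r : ℝ) (V : Pt n → ℝ), (∀ x : EuclideanSpace ℝ (Fin n), ‖x‖ ≤ r → x ≠ 0 → 0 < V (x, 0) →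
        ‖x‖ ^ (2 * σ) * V (x, 0) ^ (((n : ℝ) + 2 * σ) / ((n : ℝ) - 2 * σ)) < κ * V (x, 0)) →
        Barrier σ r V Φ := by
  obtain ⟨hσ0, hσ1⟩ := hσ
  have hq : 0 < β * (n - 2 * σ - β) := mul_pos hβ (by linarith)
  have hq' : 0 < (β + 2 * σ) * (n - β) := mul_pos (by linarith) (by linarith)
  obtain ⟨κ, hκ, hκ1, hκ2⟩ : ∃ κ : ℝ, 0 < κ ∧ κ ≤ 1 / 2 ∧
      κ * ((β + 2 * σ) * (n - β)) < β * (n - 2 * σ - β) := by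
    refine ⟨min (1 / 2) (β * (n - 2 * σ - β) / (2 * ((β + 2 * σ) * (n - β)))),
      lt_min (by norm_num) (by positivity), min_le_left _ _, ?_⟩
    have h1 := min_le_right (1 / 2) (β * (n - 2 * σ - β) / (2 * ((β + 2 * σ) * (n - β))))
    rw [le_div_iff₀ (by positivity)] at h1
    linarith
  have hbd : ∀ X : Pt n, 0 ≤ X.2 → X ≠ 0 →
      1 / 2 * 2 ^ (-(β / 2)) * ‖X‖ ^ (-β) ≤
        powBlock 0 0 (β / 2) X - κ * powBlock 0 (2 * σ) (β / 2 + σ) X ∧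
      powBlock 0 0 (β / 2) X - κ * powBlock 0 (2 * σ) (β / 2 + σ) X ≤ ‖X‖ ^ (-β) := by
    intro X ht hX
    have hR : 0 < ‖X.1 - 0‖ ^ 2 + X.2 ^ 2 := normSq_add_sq_pos hX
    have h0 := norm_pos_iff.2 hX
    obtain ⟨h1, h2⟩ := normSq_add_sq_bounds X
    have h3 := rpow_snd_mul_le hσ0 ht hX (-(β / 2))
    have h4 : 0 ≤ X.2 ^ (2 * σ) * (‖X.1 - 0‖ ^ 2 + X.2 ^ 2) ^ (-(β / 2) - σ) :=
      mul_nonneg (Real.rpow_nonneg ht _) (Real.rpow_nonneg hR.le _)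
    rw [powBlock_zero_left, powBlock, neg_add, ← sub_eq_add_neg]
    have h5 : (‖X.1 - 0‖ ^ 2 + X.2 ^ 2) ^ (-(β / 2)) ≤ ‖X‖ ^ (-β) := by
      rw [← sq_rpow_half _ (-β) h0.le, neg_div]
      exact Real.rpow_le_rpow_of_nonpos (by positivity) h1 (by linarith)
    have h6 : 2 ^ (-(β / 2)) * ‖X‖ ^ (-β) ≤ (‖X.1 - 0‖ ^ 2 + X.2 ^ 2) ^ (-(β / 2)) := by
      rw [← sq_rpow_half _ (-β) h0.le, neg_div, ← Real.mul_rpow (by norm_num) (by positivity)]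
      exact Real.rpow_le_rpow_of_nonpos hR h2 (by linarith)
    constructor <;> nlinarith
  refine ⟨2 * σ * κ, 1 / 2 * 2 ^ (-(β / 2)), by positivity, by positivity, _, hbd,
    fun r V hV => ⟨?_, ?_, ?_, ?_⟩⟩
  · intro X _ ht hX
    refine lt_of_lt_of_le ?_ (hbd X ht hX).1
    have h0 := norm_pos_iff.2 hX
    positivity
  · intro X hX
    exact (powBlock_continuousAt 0 le_rfl _ hX).sub
      (continuousAt_const.mul (powBlock_continuousAt 0 (by linarith) _ hX))
  · intro X _ ht
    have hX : X ≠ 0 := by rintro rfl; exact lt_irrefl _ ht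
    have hR : 0 < ‖X.1 - 0‖ ^ 2 + X.2 ^ 2 := normSq_add_sq_pos hX
    refine ⟨_, ?_, (hasL_powBlock 0 (m := 0) (β / 2) (by ring) ht).sub
      ((hasL_powBlock 0 (m := 2 * σ) (β / 2 + σ) (by ring) ht).const_mul κ)⟩
    have h3 := rpow_snd_mul_le hσ0 ht.le hX (-(β / 2) - 1)
    have h5 := Real.rpow_pos_of_pos hR (-(β / 2) - 1)
    rw [Real.rpow_zero, one_mul, show -(β / 2 + σ) - 1 = -(β / 2) - 1 - σ by ring]
    generalize X.2 ^ (2 * σ) * (‖X.1 - 0‖ ^ 2 + X.2 ^ 2) ^ (-(β / 2) - 1 - σ) = a at *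
    generalize (‖X.1 - 0‖ ^ 2 + X.2 ^ 2) ^ (-(β / 2) - 1) = b at *
    have h6 : κ * ((β + 2 * σ) * (n - β)) * a ≤ κ * ((β + 2 * σ) * (n - β)) * b := by gcongr
    have h7 : κ * ((β + 2 * σ) * (n - β)) * b < β * (n - 2 * σ - β) * b := by gcongr
    linarith
  · intro x hx hx0 hVx
    have hn0 := norm_pos_iff.2 hx0
    refine ⟨κ * (2 * σ * (‖x - 0‖ ^ 2) ^ (-(β / 2 + σ))), ?_, ?_⟩
    · have h1 := hV x hx hx0 hVx
      rw [powBlock_two_mk_zero hσ0, powBlock_zero_left, mul_zero, sub_zero]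
      simp only [sub_zero]
      rw [zero_pow two_ne_zero, add_zero, show -(β / 2) = (-β) / 2 by ring,
        show -(β / 2 + σ) = (-β - 2 * σ) / 2 by ring, sq_rpow_half _ _ hn0.le,
        sq_rpow_half _ _ hn0.le]
      have h2 : ‖x‖ ^ (-β) = ‖x‖ ^ (-β - 2 * σ) * ‖x‖ ^ (2 * σ) := by
        rw [← Real.rpow_add hn0]; congr 1; ring
      rw [h2]
      have h3 := mul_lt_mul_of_pos_left h1 (Real.rpow_pos_of_pos hn0 (-β - 2 * σ))
      linarith
    · have := (hasN_powBlock_zero hσ1 0 (β / 2) hx0).sub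
        ((hasN_powBlock_two hσ0 0 (β / 2 + σ) hx0).const_mul κ)
      rwa [zero_sub] at this

lemma exists_bounded_barrier (hn : 2 ≤ n) (hσ : σ ∈ Set.Ioo (0 : ℝ) 1) :
    ∃ κ : ℝ, 0 < κ ∧ ∃ Φ : Pt n → ℝ,
      (∀ X : Pt n, ‖X‖ ≤ 1 / 2 → 0 ≤ X.2 → X ≠ 0 → 1 / 2 ≤ Φ X ∧ Φ X ≤ 2) ∧
      ∀ (r : ℝ) (V : Pt n → ℝ), r ≤ 1 / 2 →
        (∀ x : EuclideanSpace ℝ (Fin n), ‖x‖ ≤ r → x ≠ 0 → 0 < V (x, 0) →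
        ‖x‖ ^ σ * V (x, 0) ^ (((n : ℝ) + 2 * σ) / ((n : ℝ) - 2 * σ)) < κ * V (x, 0)) →
        Barrier σ r V Φ := by
  obtain ⟨hσ0, hσ1⟩ := hσ
  have hn' : (2 : ℝ) ≤ n := by exact_mod_cast hn
  have hbd : ∀ X : Pt n, ‖X‖ ≤ 1 / 2 → 0 ≤ X.2 → X ≠ 0 →
      1 / 2 ≤ 2 - powBlock 0 0 (-(σ / 2)) X - 1 / 4 * powBlock 0 (2 * σ) (σ / 2) X ∧
      2 - powBlock 0 0 (-(σ / 2)) X - 1 / 4 * powBlock 0 (2 * σ) (σ / 2) X ≤ 2 := by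
    intro X hX2 ht hX
    have hR : 0 < ‖X.1 - 0‖ ^ 2 + X.2 ^ 2 := normSq_add_sq_pos hX
    obtain ⟨-, h2⟩ := normSq_add_sq_bounds X
    have h3 := rpow_snd_mul_le hσ0 ht hX (σ / 2)
    have h4 : 0 ≤ X.2 ^ (2 * σ) * (‖X.1 - 0‖ ^ 2 + X.2 ^ 2) ^ (σ / 2 - σ) :=
      mul_nonneg (Real.rpow_nonneg ht _) (Real.rpow_nonneg hR.le _)
    rw [powBlock_zero_left, powBlock, neg_neg, show -(σ / 2) = σ / 2 - σ by ring]
    have h5 : (‖X.1 - 0‖ ^ 2 + X.2 ^ 2) ^ (σ / 2) ≤ 1 :=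
      Real.rpow_le_one hR.le (by nlinarith [norm_nonneg X]) (by linarith)
    have h6 := Real.rpow_nonneg hR.le (σ / 2)
    constructor <;> linarith
  refine ⟨σ / 4, by positivity, _, hbd, fun r V hr hV => ⟨?_, ?_, ?_, ?_⟩⟩
  · intro X hXr ht hX
    linarith [(hbd X (hXr.trans hr) ht hX).1]
  · intro X hX
    exact (continuousAt_const.sub (powBlock_continuousAt 0 le_rfl _ hX)).sub
      (continuousAt_const.mul (powBlock_continuousAt 0 (by linarith) _ hX))
  · intro X _ ht
    have hX : X ≠ 0 := by rintro rfl; exact lt_irrefl _ ht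
    have hR : 0 < ‖X.1 - 0‖ ^ 2 + X.2 ^ 2 := normSq_add_sq_pos hX
    refine ⟨_, ?_, ((hasL_const 2).sub (hasL_powBlock 0 (m := 0) (-(σ / 2)) (by ring) ht)).sub
      ((hasL_powBlock 0 (m := 2 * σ) (σ / 2) (by ring) ht).const_mul (1 / 4))⟩
    have h3 := rpow_snd_mul_le hσ0 ht.le hX (σ / 2 - 1)
    have h5 := Real.rpow_pos_of_pos hR (σ / 2 - 1)
    rw [Real.rpow_zero, one_mul, neg_neg, show -(σ / 2) - 1 = σ / 2 - 1 - σ by ring]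
    generalize X.2 ^ (2 * σ) * (‖X.1 - 0‖ ^ 2 + X.2 ^ 2) ^ (σ / 2 - 1 - σ) = a at *
    generalize (‖X.1 - 0‖ ^ 2 + X.2 ^ 2) ^ (σ / 2 - 1) = b at *
    have h6 : σ / 4 * (n + σ) * a ≤ σ / 4 * (n + σ) * b := by gcongr
    have h7 : σ * ((n + σ) / 4) * b < σ * (n - σ) * b := by gcongr; linarith
    linarith
  · intro x hx hx0 hVx
    have hn0 := norm_pos_iff.2 hx0
    refine ⟨1 / 4 * (2 * σ * (‖x - 0‖ ^ 2) ^ (-(σ / 2))), ?_, ?_⟩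
    · have h1 := hV x hx hx0 hVx
      have h2 := (hbd (x, 0) (by rw [norm_mk_zero]; linarith) le_rfl
        (by simpa using hx0)).2
      rw [sub_zero x, show -(σ / 2) = (-σ) / 2 by ring, sq_rpow_half _ _ hn0.le]
      rw [show -(σ / 2) = (-σ) / 2 by ring] at h2
      have h3 := mul_lt_mul_of_pos_left h1 (Real.rpow_pos_of_pos hn0 (-σ))
      rw [← mul_assoc, ← Real.rpow_add hn0, neg_add_cancel, Real.rpow_zero, one_mul] at h3
      have h4 := mul_le_mul_of_nonneg_left h2
        (Real.rpow_nonneg hVx.le (((n : ℝ) + 2 * σ) / ((n : ℝ) - 2 * σ)))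
      linarith
    · have := ((hasN_const (σ := σ) (x := x) 2).sub (hasN_powBlock_zero hσ1 0 (-(σ / 2)) hx0)).sub
        ((hasN_powBlock_two hσ0 0 (σ / 2) hx0).const_mul (1 / 4))
      rwa [sub_zero, zero_sub] at this

end Barriers

/-! ### Boundedness and continuity at the origin -/

section Main

variable {n : ℕ} {σ : ℝ}

lemma scaleMap_zero_eq (s : ℝ) (X : Pt n) : scaleMap 0 s X = s • X := by
  ext <;> simp [scaleMap]

lemma norm_scaleMap_zero {s : ℝ} (hs : 0 < s) (X : Pt n) : ‖scaleMap 0 s X‖ = s * ‖X‖ := by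
  rw [scaleMap_zero_eq, norm_smul, Real.norm_of_nonneg hs.le]

lemma ExtSol.isSol {U : Pt n → ℝ} (hU : ExtSol n σ 2 U) : IsSol σ 1 U := by
  obtain ⟨h1, h2, h3, h4, h5⟩ := hU
  have hlt : ∀ X : Pt n, ‖X‖ < 1 → enorm' X < 2 := by
    intro X hX
    have := (normSq_add_sq_bounds X).2
    rw [sub_zero] at this
    rw [enorm', Real.sqrt_lt' (by norm_num)]
    nlinarith [norm_nonneg X]
  have hcont : ContinuousOn U ({X | ‖X‖ < 1 ∧ 0 ≤ X.2} \ {0}) :=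
    h2.mono fun X hX => ⟨⟨(hlt X hX.1.1).le, hX.1.2⟩, hX.2⟩
  have hopen : IsOpen {X : Pt n | enorm' X < 2 ∧ 0 < X.2} := by
    have hc : Continuous (enorm' : Pt n → ℝ) := by unfold enorm'; fun_prop
    exact (isOpen_lt hc continuous_const).inter
      (isOpen_lt (continuous_const (y := (0 : ℝ))) continuous_snd)
  have hC : ∀ X : Pt n, enorm' X < 2 → 0 < X.2 → ContDiffAt ℝ 2 U X := fun X hX ht =>
    h3.contDiffAt (hopen.mem_nhds ⟨hX, ht⟩)
  refine ⟨fun X hX => h1 X (hlt X hX).le, hcont,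
    fun X hX ht => ⟨hC X (hlt X hX) ht, h4 X (hlt X hX) ht⟩, fun x hx hx0 => ⟨?_, ?_, ?_⟩⟩
  · have hn : ∀ᶠ X in 𝓝 ((x, 0) : Pt n), ‖X‖ < 1 :=
      continuous_norm.continuousAt.eventually (gt_mem_nhds (by simpa [norm_mk_zero] using hx))
    filter_upwards [(tendsto_vertical x).eventually hn, self_mem_nhdsWithin] with t ht ht0
    exact (hC (x, t) (hlt _ ht) ht0).differentiableAt (by norm_num)
  · have hx' : ((x, 0) : Pt n) ∈ ({X | ‖X‖ < 1 ∧ 0 ≤ X.2} \ {0} : Set (Pt n)) :=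
      ⟨⟨by rwa [norm_mk_zero], le_rfl⟩, by simpa using hx0⟩
    have hopen' : IsOpen {X : Pt n | ‖X‖ < 1 ∧ X ≠ 0} :=
      (isOpen_lt continuous_norm continuous_const).inter isOpen_ne
    have hf : ContinuousAt (fun t : ℝ => ((x, t) : Pt n)) 0 := by fun_prop
    have h6 : ∀ᶠ t in 𝓝 (0 : ℝ), ‖((x, t) : Pt n)‖ < 1 ∧ ((x, t) : Pt n) ≠ 0 :=
      hf.eventually (hopen'.mem_nhds (x := ((x, 0) : Pt n)) ⟨hx'.1.1, hx'.2⟩)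
    refine (hcont _ hx').tendsto.comp (tendsto_nhdsWithin_iff.2
      ⟨hf.tendsto.mono_left nhdsWithin_le_nhds, ?_⟩)
    filter_upwards [nhdsWithin_le_nhds h6, self_mem_nhdsWithin] with t ht ht0
    exact ⟨⟨ht.1, ht0⟩, ht.2⟩
  · exact h5 x (by linarith) hx0

lemma IsSol.scale {U : Pt n → ℝ} (hnσ : 0 < (n : ℝ) - 2 * σ) (hU : IsSol σ 1 U)
    {s : ℝ} (hs : 0 < s) (hs8 : 8 * s ≤ 1) :
    IsSol σ 8 (fun X => s ^ (((n : ℝ) - 2 * σ) / 2) * U (scaleMap 0 s X)) := by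
  have hin : ∀ X : Pt n, ‖X‖ < 8 → ‖scaleMap 0 s X‖ < 1 := by
    intro X hX
    rw [norm_scaleMap_zero hs]
    calc s * ‖X‖ < s * 8 := by gcongr
      _ ≤ 1 := by linarith
  have h0 : ∀ X : Pt n, X ≠ 0 → scaleMap 0 s X ≠ 0 := by
    intro X hX
    rw [scaleMap_zero_eq]; exact smul_ne_zero hs.ne' hX
  have hsp : 0 < s ^ (((n : ℝ) - 2 * σ) / 2) := Real.rpow_pos_of_pos hs _
  refine ⟨?_, ?_, ?_, ?_⟩
  · intro X h1 h2 h3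
    exact mul_nonneg hsp.le (hU.nonneg _ (hin X h1) (mul_nonneg hs.le h2) (h0 X h3))
  · refine continuousOn_const.mul (hU.cont.comp (Continuous.continuousOn ?_) ?_)
    · unfold scaleMap; fun_prop
    · intro X hX
      exact ⟨⟨hin X hX.1.1, mul_nonneg hs.le hX.1.2⟩, h0 X hX.2⟩
  · intro X h1 h2
    have := ((hU.hasL _ (hin X h1) (mul_pos hs h2)).comp_scaleMap hs).const_mul
      (s ^ (((n : ℝ) - 2 * σ) / 2))
    simpa using this
  · intro x h1 h2
    have h3 : ‖(0 : EuclideanSpace ℝ (Fin n)) + s • x‖ < 1 := by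
      have := hin (x, 0) (by rwa [norm_mk_zero])
      rwa [scaleMap, mul_zero, norm_mk_zero] at this
    have h4 : (0 : EuclideanSpace ℝ (Fin n)) + s • x ≠ 0 := by
      rw [zero_add]; exact smul_ne_zero hs.ne' h2
    have h5 := ((hU.hasN _ h3 h4).comp_scaleMap hs).const_mul (s ^ (((n : ℝ) - 2 * σ) / 2))
    have h6 := hU.nonneg (0 + s • x, 0) (by rwa [norm_mk_zero]) le_rfl (by simpa using h4)
    convert h5 using 1
    simp only [scaleMap, mul_zero]
    rw [Real.mul_rpow hsp.le h6, ← Real.rpow_mul hs.le, mul_neg, mul_neg, ← mul_assoc,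
      ← Real.rpow_add hs]
    congr 3
    field_simp
    ring

/-- The natural upper bound near the singularity. -/
lemma IsSol.exists_growth {U : Pt n → ℝ} (hn : 2 ≤ n) (hσ : σ ∈ Set.Ioo (0 : ℝ) 1)
    (hU : IsSol σ 1 U) (hlim : Tendsto (fun x : EuclideanSpace ℝ (Fin n) =>
      ‖x‖ ^ (((n : ℝ) - 2 * σ) / 2) * U (x, 0)) (𝓝[≠] 0) (𝓝 0)) :
    ∃ C r : ℝ, 0 ≤ C ∧ 0 < r ∧ ∀ X : Pt n, ‖X‖ ≤ r → 0 ≤ X.2 → X ≠ 0 →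
      U X ≤ C * ‖X‖ ^ (-(((n : ℝ) - 2 * σ) / 2)) := by
  have hn' : (2 : ℝ) ≤ n := by exact_mod_cast hn
  have hnσ : 0 < (n : ℝ) - 2 * σ := by have := hσ.2; linarith
  set γ : ℝ := ((n : ℝ) - 2 * σ) / 2 with hγ
  have hγ0 : 0 < γ := by positivity
  obtain ⟨C, hC⟩ := exists_bound_unit hn hσ (B := 32 ^ γ) (by positivity)
  have hev := hlim.eventually (gt_mem_nhds one_pos)
  rw [eventually_nhdsWithin_iff] at hev
  obtain ⟨r, hr, hr1⟩ := Metric.eventually_nhds_iff.1 hev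
  refine ⟨max C 0, min r 1 / 8, le_max_right _ _, by positivity, fun X hX ht hX0 => ?_⟩
  have hs : 0 < ‖X‖ := norm_pos_iff.2 hX0
  have hsr : 8 * ‖X‖ ≤ r := by linarith [min_le_left r 1]
  have hs1 : 8 * ‖X‖ ≤ 1 := by linarith [min_le_right r 1]
  have hspos : 0 < ‖X‖ ^ γ := Real.rpow_pos_of_pos hs _
  have h1 := hC _ (hU.scale hnσ hs hs1) ?_ (‖X‖⁻¹ • X)
    (by rw [norm_smul, norm_inv, norm_norm, inv_mul_cancel₀ hs.ne'])
    (mul_nonneg (by positivity) ht)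
  · rw [scaleMap_zero_eq, smul_smul, mul_inv_cancel₀ hs.ne', one_smul] at h1
    rw [Real.rpow_neg hs.le, ← div_eq_mul_inv, le_div_iff₀ hspos, mul_comm]
    exact h1.trans (le_max_left _ _)
  · intro x hx1 hx2
    have hx0 : 0 < ‖x‖ := by linarith
    have hxs : ‖‖X‖ • x‖ = ‖X‖ * ‖x‖ := by rw [norm_smul, norm_norm]
    have h2 : ‖‖X‖ • x‖ ^ γ * U (‖X‖ • x, 0) < 1 := by
      refine hr1 ?_ (smul_ne_zero hs.ne' (norm_pos_iff.1 hx0))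
      rw [dist_zero_right, hxs]
      nlinarith
    have h3 : scaleMap (0 : EuclideanSpace ℝ (Fin n)) ‖X‖ (x, 0) = (‖X‖ • x, 0) := by
      simp [scaleMap]
    rw [hxs, Real.mul_rpow hs.le hx0.le, mul_right_comm] at h2
    simp only [h3]
    have h4 : 1 ≤ 32 ^ γ * ‖x‖ ^ γ := by
      rw [← Real.mul_rpow (by norm_num) hx0.le]
      exact Real.one_le_rpow (by linarith) hγ0.le
    have h5 : 0 < ‖x‖ ^ γ := Real.rpow_pos_of_pos hx0 _
    exact le_of_mul_le_mul_right (h2.le.trans h4) h5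

/-- Decay of the trace makes the nonlinearity a small potential. -/
lemma exists_small_potential {U : Pt n → ℝ} (hσ : 0 < σ) (hnσ : 0 < (n : ℝ) - 2 * σ)
    {a e c : ℝ} (hc : 0 < c) (he : a * (4 * σ) = e * ((n : ℝ) - 2 * σ))
    (hlim : Tendsto (fun x : EuclideanSpace ℝ (Fin n) => ‖x‖ ^ a * U (x, 0)) (𝓝[≠] 0) (𝓝 0)) :
    ∃ r : ℝ, 0 < r ∧ ∀ x : EuclideanSpace ℝ (Fin n), ‖x‖ ≤ r → x ≠ 0 → 0 < U (x, 0) →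
      ‖x‖ ^ e * U (x, 0) ^ (((n : ℝ) + 2 * σ) / ((n : ℝ) - 2 * σ)) < c * U (x, 0) := by
  set q : ℝ := 4 * σ / ((n : ℝ) - 2 * σ) with hq
  have hq0 : 0 < q := by positivity
  have h1 : Tendsto (fun x : EuclideanSpace ℝ (Fin n) => (‖x‖ ^ a * U (x, 0)) ^ q) (𝓝[≠] 0)
      (𝓝 0) := by
    have := hlim.rpow_const (p := q) (Or.inr hq0.le)
    rwa [Real.zero_rpow hq0.ne'] at this
  have hev := h1.eventually (gt_mem_nhds hc)
  rw [eventually_nhdsWithin_iff] at hev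
  obtain ⟨r, hr, hr1⟩ := Metric.eventually_nhds_iff.1 hev
  refine ⟨r / 2, by positivity, fun x hx hx0 hU => ?_⟩
  have hn0 := norm_pos_iff.2 hx0
  have h2 := hr1 (y := x) (by rw [dist_zero_right]; linarith) hx0
  rw [Real.mul_rpow (Real.rpow_nonneg hn0.le _) hU.le, ← Real.rpow_mul hn0.le,
    show a * q = e by rw [hq, ← mul_div_assoc, he]; field_simp] at h2
  have h3 : ((n : ℝ) + 2 * σ) / ((n : ℝ) - 2 * σ) = q + 1 := by
    rw [hq]; field_simp; ring
  rw [h3, Real.rpow_add_one hU.ne', ← mul_assoc]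
  gcongr

/-- A solution with the natural growth is bounded by a multiple of any barrier. -/
lemma IsSol.exists_le_mul_barrier {U Ψ Θ : Pt n → ℝ} {C r γ θ c m : ℝ} (hr0 : 0 < r) (hr : r < 1)
    (hU : IsSol σ 1 U) (hC : 0 ≤ C)
    (hgrow : ∀ X : Pt n, ‖X‖ ≤ r → 0 ≤ X.2 → X ≠ 0 → U X ≤ C * ‖X‖ ^ (-γ))
    (hc : 0 < c) (hθ : γ < θ) (hΘ : Barrier σ r U Θ)
    (hΘc : ∀ X : Pt n, 0 ≤ X.2 → X ≠ 0 → c * ‖X‖ ^ (-θ) ≤ Θ X)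
    (hΨ : Barrier σ r U Ψ) (hm : 0 < m) (hΨm : ∀ X : Pt n, ‖X‖ = r → 0 ≤ X.2 → X ≠ 0 → m ≤ Ψ X) :
    ∃ B : ℝ, 0 < B ∧ ∀ X : Pt n, ‖X‖ ≤ r → 0 ≤ X.2 → X ≠ 0 → U X ≤ B * Ψ X := by
  have hrg : 0 < r ^ (-γ) := Real.rpow_pos_of_pos hr0 _
  have hB : 0 < C * r ^ (-γ) / m + 1 := by positivity
  refine ⟨C * r ^ (-γ) / m + 1, hB, fun X h1 h2 h3 => ?_⟩
  refine hU.le_of_barrier hr (hΨ.const_mul hB) hΘ ?_ ?_ h1 h2 h3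
  · intro Y h4 h5 h6
    have h7 := hgrow Y h4.le h5 h6
    rw [h4] at h7
    calc U Y ≤ C * r ^ (-γ) / m * m := by rwa [div_mul_cancel₀ _ hm.ne']
      _ ≤ (C * r ^ (-γ) / m + 1) * Ψ Y := by
        gcongr
        · linarith
        · exact hΨm Y h4 h5 h6
  · intro ε hε
    have h4 := (tendsto_rpow_zero (e := θ - γ) (by linarith)).const_mul C
    rw [mul_zero] at h4
    have hev := h4.eventually (gt_mem_nhds (mul_pos hε hc))
    rw [eventually_nhdsWithin_iff] at hev
    obtain ⟨η, hη, hη1⟩ := Metric.eventually_nhds_iff.1 hev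
    refine ⟨min η r, lt_min hη hr0, fun Y h5 h6 h7 => ?_⟩
    have hY := norm_pos_iff.2 h7
    have h8 := hη1 (y := ‖Y‖) (by
      rw [Real.dist_eq, sub_zero, abs_of_pos hY]; exact h5.trans_le (min_le_left _ _)) hY
    have h9 := hgrow Y (h5.trans_le (min_le_right _ _)).le h6 h7
    have h10 : ‖Y‖ ^ (-γ) = ‖Y‖ ^ (θ - γ) * ‖Y‖ ^ (-θ) := by
      rw [← Real.rpow_add hY]; congr 1; ring
    calc U Y ≤ C * ‖Y‖ ^ (θ - γ) * ‖Y‖ ^ (-θ) := by rw [mul_assoc, ← h10]; exact h9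
      _ ≤ ε * c * ‖Y‖ ^ (-θ) := by gcongr
      _ = ε * (c * ‖Y‖ ^ (-θ)) := by ring
      _ ≤ ε * Θ Y := by gcongr; exact hΘc Y h6 h7

lemma IsSol.exists_bound {U : Pt n → ℝ} (hn : 2 ≤ n) (hσ : σ ∈ Set.Ioo (0 : ℝ) 1)
    (hU : IsSol σ 1 U) (hlim : Tendsto (fun x : EuclideanSpace ℝ (Fin n) =>
      ‖x‖ ^ (((n : ℝ) - 2 * σ) / 2) * U (x, 0)) (𝓝[≠] 0) (𝓝 0)) :
    ∃ M r : ℝ, 0 ≤ M ∧ 0 < r ∧ r < 1 ∧ ∀ X : Pt n, ‖X‖ ≤ r → 0 ≤ X.2 → X ≠ 0 → U X ≤ M := by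
  have hn' : (2 : ℝ) ≤ n := by exact_mod_cast hn
  have hnσ : 0 < (n : ℝ) - 2 * σ := by have := hσ.2; linarith
  obtain ⟨C, r₀, hC, hr₀, hgrow⟩ := hU.exists_growth hn hσ hlim
  set γ : ℝ := ((n : ℝ) - 2 * σ) / 2 with hγ
  have hγ0 : 0 < γ := by positivity
  obtain ⟨κ₁, c₁, hκ₁, hc₁, Θ, hΘ, hΘb⟩ := exists_barrier (n := n) hσ (β := 3 / 2 * γ)
    (by positivity) (by linarith)
  obtain ⟨κ₂, c₂, hκ₂, hc₂, Ψ, hΨ, hΨb⟩ := exists_barrier (n := n) hσ (β := γ / 4)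
    (by positivity) (by linarith)
  obtain ⟨κ₃, hκ₃, Φ, hΦ, hΦb⟩ := exists_bounded_barrier hn hσ
  obtain ⟨r₁, hr₁, hpot⟩ := exists_small_potential hσ.1 hnσ (e := 2 * σ) (lt_min hκ₁ hκ₂)
    (by ring) hlim
  set r : ℝ := min (min r₀ r₁) (1 / 2) with hr
  have hr0 : 0 < r := by positivity
  have hrr₀ : r ≤ r₀ := (min_le_left _ _).trans (min_le_left _ _)
  have hrr₁ : r ≤ r₁ := (min_le_left _ _).trans (min_le_right _ _)
  have hr2 : r ≤ 1 / 2 := min_le_right _ _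
  have hΘr : ∀ r' ≤ r, Barrier σ r' U Θ := fun r' hr' => hΘb r' U fun x h1 h2 h3 =>
    (hpot x (h1.trans (hr'.trans hrr₁)) h2 h3).trans_le (by gcongr; exact min_le_left _ _)
  have hΨr : Barrier σ r U Ψ := hΨb r U fun x h1 h2 h3 =>
    (hpot x (h1.trans hrr₁) h2 h3).trans_le (by gcongr; exact min_le_right _ _)
  obtain ⟨B, hB, hBU⟩ := hU.exists_le_mul_barrier (m := c₂ * r ^ (-(γ / 4))) hr0 (by linarith) hC
    (fun X h1 => hgrow X (h1.trans hrr₀)) hc₁ (by linarith) (hΘr r le_rfl)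
    (fun X h1 h2 => (hΘ X h1 h2).1) hΨr (mul_pos hc₂ (Real.rpow_pos_of_pos hr0 _))
    (fun X h1 h2 h3 => by rw [← h1]; exact (hΨ X h2 h3).1)
  have hlim' : Tendsto (fun x : EuclideanSpace ℝ (Fin n) => ‖x‖ ^ (γ / 2) * U (x, 0)) (𝓝[≠] 0)
      (𝓝 0) := by
    have h1 : Tendsto (fun x : EuclideanSpace ℝ (Fin n) => B * ‖x‖ ^ (γ / 4)) (𝓝[≠] 0) (𝓝 0) := by
      have := ((tendsto_rpow_zero (e := γ / 4) (by linarith)).comp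
        (tendsto_norm_nhdsNE_zero (E := EuclideanSpace ℝ (Fin n)))).const_mul B
      rwa [mul_zero] at this
    have h2 : ∀ᶠ x : EuclideanSpace ℝ (Fin n) in 𝓝[≠] 0, ‖x‖ < r ∧ x ≠ 0 := by
      refine Filter.Eventually.and (nhdsWithin_le_nhds ?_) self_mem_nhdsWithin
      filter_upwards [Metric.ball_mem_nhds _ hr0] with x hx
      simpa using hx
    refine tendsto_of_tendsto_of_tendsto_of_le_of_le' tendsto_const_nhds h1 ?_ ?_
    · filter_upwards [h2] with x hx
      exact mul_nonneg (by positivity) (hU.nonneg (x, 0) (by rw [norm_mk_zero]; linarith) le_rfl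
        (by simpa using hx.2))
    · filter_upwards [h2] with x hx
      have hx0 : ((x, 0) : Pt n) ≠ 0 := by simpa using hx.2
      have hn0 := norm_pos_iff.2 hx.2
      have h3 := hBU (x, 0) (by rw [norm_mk_zero]; exact hx.1.le) le_rfl hx0
      have h4 := (hΨ (x, 0) le_rfl hx0).2
      rw [norm_mk_zero] at h4
      calc ‖x‖ ^ (γ / 2) * U (x, 0) ≤ ‖x‖ ^ (γ / 2) * (B * ‖x‖ ^ (-(γ / 4))) := by
            gcongr; exact h3.trans (by gcongr)
        _ = B * (‖x‖ ^ (γ / 2) * ‖x‖ ^ (-(γ / 4))) := by ring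
        _ = B * ‖x‖ ^ (γ / 4) := by rw [← Real.rpow_add hn0]; congr 2; ring
  obtain ⟨r₂, hr₂, hpot'⟩ := exists_small_potential hσ.1 hnσ (e := σ) hκ₃
    (by rw [hγ]; ring) hlim'
  set r' : ℝ := min r r₂ with hr'
  have hr'0 : 0 < r' := lt_min hr0 hr₂
  have hr'r : r' ≤ r := min_le_left _ _
  obtain ⟨A, hA, hAU⟩ := hU.exists_le_mul_barrier (m := 1 / 2) hr'0 (by linarith) hC
    (fun X h1 => hgrow X (h1.trans (hr'r.trans hrr₀))) hc₁ (by linarith) (hΘr r' hr'r)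
    (fun X h1 h2 => (hΘ X h1 h2).1)
    (hΦb r' U (by linarith) fun x h1 => hpot' x (h1.trans (min_le_right _ _))) (by norm_num)
    (fun X h1 h2 h3 => (hΦ X (by linarith) h2 h3).1)
  refine ⟨A * 2, r', by positivity, hr'0, by linarith, fun X h1 h2 h3 => ?_⟩
  exact (hAU X h1 h2 h3).trans (by gcongr; exact (hΦ X (by linarith) h2 h3).2)

/-- The trace of a bounded solution oscillates little near the origin. -/
lemma IsSol.exists_abs_sub_le {U : Pt n → ℝ} (hn : 2 ≤ n) (hσ : σ ∈ Set.Ioo (0 : ℝ) 1)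
    (hU : IsSol σ 1 U) {M r : ℝ} (hM : 0 ≤ M) (hr : 0 < r) (hr1 : r < 1)
    (hb : ∀ X : Pt n, ‖X‖ ≤ r → 0 ≤ X.2 → X ≠ 0 → U X ≤ M) {δ : ℝ} (hδ : 0 < δ) :
    ∃ η : ℝ, 0 < η ∧ ∀ x y : EuclideanSpace ℝ (Fin n), ‖x‖ ≤ η → x ≠ 0 → ‖y‖ ≤ η → y ≠ 0 →
      |U (x, 0) - U (y, 0)| ≤ δ := by
  have hn' : (2 : ℝ) ≤ n := by exact_mod_cast hn
  have hnσ : 0 < (n : ℝ) - 2 * σ := by have := hσ.2; linarith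
  set P : ℝ := ((n : ℝ) + 2 * σ) / ((n : ℝ) - 2 * σ) with hP
  have hP0 : 0 ≤ P := div_nonneg (by linarith [hσ.1]) hnσ.le
  set s : ℝ := r / 5 with hs
  have hs0 : 0 < s := by positivity
  obtain ⟨ρ, hρ, hρ1, hmod⟩ := exists_modulus hn hσ hM
    (F₀ := s ^ (2 * σ) * M ^ P) (by positivity) hδ
  have hin : ∀ X : Pt n, ‖X‖ ≤ 5 → ‖scaleMap 0 s X‖ ≤ r := by
    intro X hX
    rw [norm_scaleMap_zero hs0]
    calc s * ‖X‖ ≤ s * 5 := by gcongr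
      _ = r := by rw [hs]; ring
  have h0 : ∀ X : Pt n, X ≠ 0 → scaleMap 0 s X ≠ 0 := by
    intro X hX
    rw [scaleMap_zero_eq]; exact smul_ne_zero hs0.ne' hX
  have hbdd : ∀ X : Pt n, ‖X‖ ≤ r → 0 ≤ X.2 → X ≠ 0 → |U X| ≤ M := by
    intro X h1 h2 h3
    rw [abs_of_nonneg (hU.nonneg X (h1.trans_lt hr1) h2 h3)]
    exact hb X h1 h2 h3
  have hbd : ∀ x : EuclideanSpace ℝ (Fin n), ‖x‖ ≤ 5 →
      ‖(0 : EuclideanSpace ℝ (Fin n)) + s • x‖ ≤ r := by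
    intro x hx
    have := hin (x, 0) (by rwa [norm_mk_zero])
    rwa [scaleMap, mul_zero, norm_mk_zero] at this
  have hbd0 : ∀ x : EuclideanSpace ℝ (Fin n), x ≠ 0 →
      (0 : EuclideanSpace ℝ (Fin n)) + s • x ≠ 0 := by
    intro x hx
    rw [zero_add]; exact smul_ne_zero hs0.ne' hx
  have hslab : ∀ T : ℝ, 0 < T → T ≤ 1 → SlabSol σ M (s ^ (2 * σ) * M ^ P) T
      (fun X => U (scaleMap 0 s X)) 0 (fun x => s ^ (2 * σ) * U (0 + s • x, 0) ^ P) := by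
    intro T hT hT1
    have hX5 : ∀ X : Pt n, ‖X.1‖ ≤ 5 → 0 ≤ X.2 → |X.2 - T| ≤ 1 → ‖X‖ ≤ 5 := by
      intro X h1 h2 h3
      rw [Prod.norm_def, Real.norm_of_nonneg h2]
      exact max_le h1 (by linarith [(abs_le.1 h3).2])
    refine ⟨?_, ?_, ?_, ?_, ?_⟩
    · refine hU.cont.comp (Continuous.continuousOn (by unfold scaleMap; fun_prop)) ?_
      rintro X ⟨⟨h1, h2, h3⟩, h4⟩
      exact ⟨⟨(hin X (hX5 X h1 h2 h3)).trans_lt hr1, mul_nonneg hs0.le h2⟩, h0 X h4⟩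
    · intro X h1 h2 h3 h4
      exact hbdd _ (hin X (hX5 X h1 h2 h3)) (mul_nonneg hs0.le h2) (h0 X h4)
    · intro X h1 h2 h3
      simpa using (hU.hasL _ ((hin X (hX5 X h1 h2.le h3)).trans_lt hr1)
        (mul_pos hs0 h2)).comp_scaleMap hs0
    · intro _ x h1 h2
      simpa using (hU.hasN _ ((hbd x h1).trans_lt hr1) (hbd0 x h2)).comp_scaleMap hs0
    · intro _ x h1 h2
      have h3 : ((0 + s • x, 0) : Pt n) ≠ 0 := by simpa using hbd0 x h2
      have h4 : ‖((0 + s • x, 0) : Pt n)‖ ≤ r := by rw [norm_mk_zero]; exact hbd x h1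
      have h5 := hU.nonneg _ (h4.trans_lt hr1) le_rfl h3
      have h6 := hb _ h4 le_rfl h3
      rw [abs_of_nonneg (mul_nonneg (by positivity) (Real.rpow_nonneg h5 _))]
      gcongr
  refine ⟨s * ρ, by positivity, fun x y hx hx0 hy hy0 => ?_⟩
  have hsr : s * ρ < 1 := by
    have : s ≤ 1 := by linarith
    nlinarith
  have hsc : ∀ z : EuclideanSpace ℝ (Fin n), ‖z‖ ≤ s * ρ → ‖s⁻¹ • z‖ ≤ ρ := by
    intro z hz
    rwa [norm_smul, norm_inv, Real.norm_of_nonneg hs0.le, inv_mul_le_iff₀ hs0]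
  have hcontz : ∀ z : EuclideanSpace ℝ (Fin n), ‖z‖ ≤ s * ρ → z ≠ 0 →
      Tendsto (fun T : ℝ => U (z, s * T)) (𝓝[>] 0) (𝓝 (U (z, 0))) := by
    intro z hz hz0
    have h1 : Tendsto (fun t : ℝ => U (z, t)) (𝓝[Set.Ici 0] 0) (𝓝 (U (z, 0))) :=
      (hU.hasN z (hz.trans_lt hsr) hz0).2.1
    refine h1.comp (tendsto_nhdsWithin_iff.2 ⟨?_, ?_⟩)
    · have : Tendsto (fun T : ℝ => s * T) (𝓝 0) (𝓝 (s * 0)) :=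
        (continuous_const.mul continuous_id).tendsto 0
      rw [mul_zero] at this
      exact this.mono_left nhdsWithin_le_nhds
    · filter_upwards [self_mem_nhdsWithin] with T hT
      exact mul_nonneg hs0.le (le_of_lt hT)
  refine le_of_tendsto ((hcontz x hx hx0).sub (hcontz y hy hy0)).abs ?_
  filter_upwards [Ioc_mem_nhdsGT (zero_lt_one' ℝ)] with T hT
  have := hmod T hT.1 _ _ _ (hslab T hT.1 hT.2) _ _ (hsc x hx) (hsc y hy)
  simpa [scaleMap, smul_smul, hs0.ne'] using this

end Main

/-- If `lim_{|x|→0} |x|^{(n-2σ)/2} u(x) = 0`, then `u` extends as a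
continuous function near the origin. -/
theorem stmt_11 (n : ℕ) (hn : 2 ≤ n) (σ : ℝ) (hσ : σ ∈ Set.Ioo (0 : ℝ) 1)
    (U : Pt n → ℝ) (hU : ExtSol n σ 2 U)
    (hlim : Tendsto (fun x : EuclideanSpace ℝ (Fin n) =>
        ‖x‖ ^ (((n : ℝ) - 2 * σ) / 2) * U (x, 0))
      (𝓝[≠] (0 : EuclideanSpace ℝ (Fin n))) (𝓝 0)) :
    ∃ τ : ℝ, 0 < τ ∧ ∃ v : EuclideanSpace ℝ (Fin n) → ℝ,
      ContinuousOn v {x : EuclideanSpace ℝ (Fin n) | ‖x‖ < τ} ∧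
      ∀ x : EuclideanSpace ℝ (Fin n), ‖x‖ < τ → x ≠ 0 → v x = U (x, 0) := by
  have hS := hU.isSol
  obtain ⟨M, r, hM, hr, hr1, hb⟩ := hS.exists_bound hn hσ hlim
  set u : EuclideanSpace ℝ (Fin n) → ℝ := fun x => U (x, 0) with hu
  have huc : ContinuousOn u ({x | ‖x‖ < 1} \ {0}) := by
    refine hS.cont.comp (by fun_prop) fun x hx => ⟨⟨?_, le_rfl⟩, by simpa using hx.2⟩
    rw [norm_mk_zero]; exact hx.1
  obtain ⟨e, he, -⟩ := exists_unit_smul hn 0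
  have : Nontrivial (EuclideanSpace ℝ (Fin n)) :=
    ⟨e, 0, norm_pos_iff.1 (by rw [he]; exact one_pos)⟩
  have : (𝓝[≠] (0 : EuclideanSpace ℝ (Fin n))).NeBot := Module.punctured_nhds_neBot ℝ _ 0
  have hcauchy : Cauchy (map u (𝓝[≠] 0)) := by
    refine Metric.cauchy_iff.2 ⟨inferInstance, fun ε hε => ?_⟩
    obtain ⟨η, hη, h⟩ := hS.exists_abs_sub_le hn hσ hM hr hr1 hb (half_pos hε)
    refine ⟨_, image_mem_map (inter_mem (nhdsWithin_le_nhds (Metric.closedBall_mem_nhds 0 hη))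
      self_mem_nhdsWithin), ?_⟩
    rintro _ ⟨x, ⟨hx, hx0⟩, rfl⟩ _ ⟨y, ⟨hy, hy0⟩, rfl⟩
    rw [Real.dist_eq]
    exact (h x y (by simpa using hx) hx0 (by simpa using hy) hy0).trans_lt (half_lt_self hε)
  obtain ⟨c, hc⟩ := CompleteSpace.complete hcauchy
  refine ⟨1, one_pos, Function.update u 0 c, continuousOn_update_iff.2 ⟨huc, fun _ => ?_⟩,
    fun x _ hx0 => Function.update_of_ne hx0 _ _⟩
  exact Tendsto.mono_left hc (nhdsWithin_mono _ fun x hx => hx.2)
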